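/- Let n = 2m ≥ 4 be an even integer, c_n = 2^{n-2}((n-2)/2)! π^{n/2}, and ω_{n-1} = |S^{n-1}|. Let u : ℝⁿ → ℝ be smooth with (-Δ)^m u = 2 Q e^{nu}, Q e^{nu} ∈ L¹(ℝⁿ), suppose for every δ > 0 there is R_δ with Q(x) ≥ e^{-δ|x|²} for |x| ≥ R_δ, and suppose ∫₀^∞ e^{u(rθ)} dr = +∞ for every unit vector θ. Then 1 - (1/c_n)∫_{ℝⁿ} Q e^{nu} dx = lim_{r→∞} ( ∫_{∂B_r(0)} e^{(n-1)u} dσ )^{n/(n-1)} / ( n ω_{n-1}^{1/(n-1)} ∫_{B_r(0)} e^{nu} dx ); in particular the limit on the right exists and is nonnegative. -/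

import Mathlib

open MeasureTheory Real Filter Metric
open scoped ENNReal Topology

/-- The constant `c_n = 2^(n-2) * ((n-2)/2)! * pi^(n/2)`. -/
noncomputable def cconst (n : ℕ) : ℝ :=
  2 ^ (n - 2) * (Nat.factorial ((n - 2) / 2)) * Real.pi ^ (n / 2)

/-- The logarithmic potential `v x = (1/c_n) * ∫ log (|x-y|/|y|) f y dy`. -/
noncomputable def logPot (n : ℕ) (f : EuclideanSpace ℝ (Fin n) → ℝ)
    (x : EuclideanSpace ℝ (Fin n)) : ℝ :=
  (1 / cconst n) * ∫ y, Real.log (‖x - y‖ / ‖y‖) * f y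

/-- The Laplacian of `f : ℝ^n → ℝ`, as the trace of the second derivative. -/
noncomputable def laplacian {n : ℕ} (f : EuclideanSpace ℝ (Fin n) → ℝ)
    (x : EuclideanSpace ℝ (Fin n)) : ℝ :=
  ∑ i, iteratedFDeriv ℝ 2 f x ![EuclideanSpace.single i 1, EuclideanSpace.single i 1]

/-- The m-th iterate `(-Δ)^m` of the negative Laplacian. -/
noncomputable def negLapIter {n : ℕ} (m : ℕ) (f : EuclideanSpace ℝ (Fin n) → ℝ) :
    EuclideanSpace ℝ (Fin n) → ℝ :=
  (fun (g : EuclideanSpace ℝ (Fin n) → ℝ) x => -laplacian g x)^[m] f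

/-- The surface measure on the unit sphere of `ℝ^n`, obtained from the polar decomposition of
the Lebesgue measure. -/
noncomputable def sphereMeasure (n : ℕ) :
    MeasureTheory.Measure (Metric.sphere (0 : EuclideanSpace ℝ (Fin n)) 1) :=
  (volume : MeasureTheory.Measure (EuclideanSpace ℝ (Fin n))).toSphere

/-- `ω_{n-1}`, the total surface measure of the unit sphere in `ℝ^n`. -/
noncomputable def omegaN (n : ℕ) : ℝ := (sphereMeasure n Set.univ).toReal

/-- The surface integral `∫_{∂B_s(0)} g dσ`, written in polar coordinates as
`s^{n-1} ∫_{S^{n-1}} g(sθ) dθ`. -/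
noncomputable def sphereIntegral (n : ℕ) (g : EuclideanSpace ℝ (Fin n) → ℝ) (s : ℝ) : ℝ :=
  s ^ (n - 1) * ∫ θ, g (s • (θ : EuclideanSpace ℝ (Fin n))) ∂(sphereMeasure n)

/-- The spherical average `⨍_{∂B_s(0)} g dσ = (1/ω_{n-1}) ∫_{S^{n-1}} g(sθ) dθ`. -/
noncomputable def sphereAvg (n : ℕ) (g : EuclideanSpace ℝ (Fin n) → ℝ) (s : ℝ) : ℝ :=
  (∫ θ, g (s • (θ : EuclideanSpace ℝ (Fin n))) ∂(sphereMeasure n)) / omegaN n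

/-! ### Kernels -/

/-- positive part to a power -/
noncomputable def posPow (j : ℕ) (t : ℝ) : ℝ := (max t 0) ^ j

theorem posPow_hasDerivAt (j : ℕ) (t : ℝ) :
    HasDerivAt (posPow (j + 2)) ((j + 2 : ℝ) * posPow (j + 1) t) t := by
  rcases lt_trichotomy t 0 with h | h | h
  · have : posPow (j+2) =ᶠ[𝓝 t] fun _ => 0 := by
      filter_upwards [gt_mem_nhds h] with s hs
      simp [posPow, max_eq_right hs.le]
    have h2 : (j + 2 : ℝ) * posPow (j + 1) t = 0 := by
      simp [posPow, max_eq_right h.le]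
    rw [h2]
    exact (hasDerivAt_const t (0:ℝ)).congr_of_eventuallyEq this
  · subst h
    have h2 : (j + 2 : ℝ) * posPow (j + 1) 0 = 0 := by
      simp [posPow]
    rw [h2]
    rw [hasDerivAt_iff_isLittleO_nhds_zero]
    simp only [posPow, zero_add, max_self, smul_zero, sub_zero]
    have h3 : (fun h : ℝ => h ^ (j+2)) =o[𝓝 0] fun h => h := by
      have := Asymptotics.isLittleO_pow_pow (𝕜 := ℝ) (m := 1) (n := j+2) (by omega)
      simpa using this
    refine Asymptotics.IsBigO.trans_isLittleO ?_ h3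
    refine Asymptotics.IsBigO.of_bound 1 (Eventually.of_forall fun s => ?_)
    simp only [ne_eq, Nat.add_eq_zero_iff, OfNat.ofNat_ne_zero, and_false, not_false_eq_true,
      zero_pow, sub_zero, norm_pow, Real.norm_eq_abs, one_mul]
    apply pow_le_pow_left₀ (abs_nonneg _)
    rcases le_total s 0 with h | h
    · simp [max_eq_right h]
    · simp [max_eq_left h]
  · have : posPow (j+2) =ᶠ[𝓝 t] fun s => s ^ (j+2) := by
      filter_upwards [lt_mem_nhds h] with s hs
      simp [posPow, max_eq_left hs.le]
    have h2 : (j + 2 : ℝ) * posPow (j + 1) t = ((j+2:ℕ):ℝ) * t ^ (j+2-1) := by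
      simp [posPow, max_eq_left h.le]
    rw [h2]
    exact (hasDerivAt_pow (j+2) t).congr_of_eventuallyEq this

theorem posPow_continuous (j : ℕ) : Continuous (posPow j) := by
  unfold posPow; fun_prop

theorem posPow_contDiff (j : ℕ) : ContDiff ℝ j (posPow (j + 1)) := by
  induction j with
  | zero => simpa using posPow_continuous 1
  | succ j ih =>
    have : ((j + 1 : ℕ) : WithTop ℕ∞) = (j : WithTop ℕ∞) + 1 := by norm_cast
    rw [this, contDiff_succ_iff_deriv]
    refine ⟨fun t => (posPow_hasDerivAt j t).differentiableAt, by simp, ?_⟩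
    have : deriv (posPow (j + 1 + 1)) = fun t => (j + 2 : ℝ) * posPow (j + 1) t := by
      funext t; exact (posPow_hasDerivAt j t).deriv
    rw [this]
    exact contDiff_const.mul ih

section kernels
variable {n : ℕ}

/-- The kernel `(1 - |y|^2)_+^j`. -/
noncomputable def kap (j : ℕ) (y : EuclideanSpace ℝ (Fin n)) : ℝ := posPow j (1 - ‖y‖ ^ 2)

theorem kap_continuous (j : ℕ) : Continuous (kap (n := n) j) := by
  unfold kap; exact (posPow_continuous j).comp (by fun_prop)

theorem kap_contDiff (j : ℕ) : ContDiff ℝ j (kap (n := n) (j + 1)) := by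
  unfold kap
  exact (posPow_contDiff j).comp (contDiff_const.sub (contDiff_norm_sq ℝ))

theorem kap_zero_of_one_le {j : ℕ} (hj : 1 ≤ j) {y : EuclideanSpace ℝ (Fin n)} (hy : 1 ≤ ‖y‖) :
    kap j y = 0 := by
  have : 1 - ‖y‖ ^ 2 ≤ 0 := by nlinarith
  simp [kap, posPow, max_eq_right this]; omega

theorem kap_nonneg (j : ℕ) (y : EuclideanSpace ℝ (Fin n)) : 0 ≤ kap j y := by
  unfold kap posPow; positivity

theorem kap_le_one (j : ℕ) (y : EuclideanSpace ℝ (Fin n)) : kap j y ≤ 1 := by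
  unfold kap posPow
  apply pow_le_one₀ (by positivity)
  apply max_le _ zero_le_one
  nlinarith [sq_nonneg ‖y‖]

theorem compactSupport_of_zero {P : EuclideanSpace ℝ (Fin n) → ℝ}
    (h : ∀ y, 1 ≤ ‖y‖ → P y = 0) : HasCompactSupport P := by
  refine HasCompactSupport.of_support_subset_isCompact
    (isCompact_closedBall (0 : EuclideanSpace ℝ (Fin n)) 1) ?_
  intro y hy
  by_contra hc
  apply hy
  apply h
  simp at hc; exact hc.le

theorem kap_compactSupport {j : ℕ} (hj : 1 ≤ j) : HasCompactSupport (kap (n := n) j) :=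
  compactSupport_of_zero fun _ hy => kap_zero_of_one_le hj hy

/-- coordinate vector -/
noncomputable abbrev ee (i : Fin n) : EuclideanSpace ℝ (Fin n) := EuclideanSpace.single i 1

theorem kap_fderiv (j : ℕ) (y : EuclideanSpace ℝ (Fin n)) (i : Fin n) :
    fderiv ℝ (kap (j + 2)) y (ee i) = -(2 * (j + 2 : ℝ)) * (kap (j + 1) y * y i) := by
  have h1 : HasFDerivAt (fun y : EuclideanSpace ℝ (Fin n) => 1 - ‖y‖ ^ 2) (-(2 • innerSL ℝ y)) y :=
    ((hasStrictFDerivAt_norm_sq y).hasFDerivAt.const_sub 1)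
  have h2 : HasFDerivAt (kap (j+2)) (((j + 2 : ℝ) * posPow (j + 1) (1 - ‖y‖^2)) •
      (-(2 • innerSL ℝ y) : EuclideanSpace ℝ (Fin n) →L[ℝ] ℝ)) y :=
    (posPow_hasDerivAt j (1 - ‖y‖ ^ 2)).comp_hasFDerivAt y h1
  rw [h2.fderiv]
  simp [kap, ee]
  have : inner ℝ y (EuclideanSpace.single i (1:ℝ)) = y i := by
    simp [EuclideanSpace.inner_single_right]
  try rw [this]
  ring

/-- integration by parts -/
theorem ibp {φ ψ : EuclideanSpace ℝ (Fin n) → ℝ} (hφ : ContDiff ℝ 1 φ) (hc : HasCompactSupport φ)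
    (hψ : ContDiff ℝ 1 ψ) (v : EuclideanSpace ℝ (Fin n)) :
    ∫ y, φ y * fderiv ℝ ψ y v = - ∫ y, fderiv ℝ φ y v * ψ y := by
  have c1 : Continuous fun y => fderiv ℝ φ y v := (hφ.continuous_fderiv (by simp)).clm_apply continuous_const
  have c2 : Continuous fun y => fderiv ℝ ψ y v := (hψ.continuous_fderiv (by simp)).clm_apply continuous_const
  have := integral_bilinear_fderiv_right_eq_neg_left_of_integrable (μ := (volume : Measure (EuclideanSpace ℝ (Fin n))))
    (f := φ) (g := ψ) (v := v) (B := ContinuousLinearMap.mul ℝ ℝ) ?_ ?_ ?_ ?_ ?_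
  · simpa using this
  · simp only [ContinuousLinearMap.mul_apply']
    exact (c1.mul hψ.continuous).integrable_of_hasCompactSupport ((hc.fderiv_apply (𝕜 := ℝ) v).mul_right)
  · simp only [ContinuousLinearMap.mul_apply']
    exact (hφ.continuous.mul c2).integrable_of_hasCompactSupport (hc.mul_right)
  · simp only [ContinuousLinearMap.mul_apply']
    exact (hφ.continuous.mul hψ.continuous).integrable_of_hasCompactSupport (hc.mul_right)
  · exact fun x _ => (hφ.differentiable (by simp)).differentiableAt
  · exact fun x _ => (hψ.differentiable (by simp)).differentiableAt

theorem laplacian_eq (w : EuclideanSpace ℝ (Fin n) → ℝ) (hw : ContDiff ℝ 2 w)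
    (x : EuclideanSpace ℝ (Fin n)) :
    laplacian w x = ∑ i, fderiv ℝ (fun y => fderiv ℝ w y (ee i)) x (ee i) := by
  unfold laplacian
  refine Finset.sum_congr rfl fun i _ => ?_
  rw [iteratedFDeriv_two_apply]
  have hd : DifferentiableAt ℝ (fderiv ℝ w) x :=
    ((hw.fderiv_right (m := 1) (by norm_num)).differentiable (by simp)).differentiableAt
  rw [fderiv_clm_apply hd (differentiableAt_const _)]
  simp [ee]

theorem pd_smooth {w : EuclideanSpace ℝ (Fin n) → ℝ} (hw : ContDiff ℝ (⊤ : ℕ∞) w) (i : Fin n) :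
    ContDiff ℝ (⊤ : ℕ∞) (fun y => fderiv ℝ w y (ee i)) :=
  (hw.fderiv_right (m := (⊤ : ℕ∞)) (by exact_mod_cast le_refl _)).clm_apply contDiff_const

theorem laplacian_smooth {w : EuclideanSpace ℝ (Fin n) → ℝ} (hw : ContDiff ℝ (⊤ : ℕ∞) w) :
    ContDiff ℝ (⊤ : ℕ∞) (laplacian w) := by
  have : laplacian w = fun x => ∑ i, fderiv ℝ (fun y => fderiv ℝ w y (ee i)) x (ee i) := by
    funext x; exact laplacian_eq w (contDiff_infty.mp hw 2) x
  rw [this]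
  exact ContDiff.sum fun i _ => pd_smooth (pd_smooth hw i) i

theorem negLapIter_succ (k : ℕ) (w : EuclideanSpace ℝ (Fin n) → ℝ) :
    negLapIter (k + 1) w = fun x => - laplacian (negLapIter k w) x := by
  unfold negLapIter
  rw [Function.iterate_succ_apply']

theorem negLapIter_smooth {w : EuclideanSpace ℝ (Fin n) → ℝ} (hw : ContDiff ℝ (⊤ : ℕ∞) w) (k : ℕ) :
    ContDiff ℝ (⊤ : ℕ∞) (negLapIter k w) := by
  induction k with
  | zero => exact hw
  | succ k ih => rw [negLapIter_succ]; exact (laplacian_smooth ih).neg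

/-- weighted ball mean -/
noncomputable def Imean (j : ℕ) (w : EuclideanSpace ℝ (Fin n) → ℝ) (x : EuclideanSpace ℝ (Fin n))
    (r : ℝ) : ℝ := ∫ y, kap j y * w (x + r • y)

theorem fderiv_comp_affine {w : EuclideanSpace ℝ (Fin n) → ℝ} (hw : Differentiable ℝ w)
    (x y v : EuclideanSpace ℝ (Fin n)) (r : ℝ) :
    fderiv ℝ (fun y => w (x + r • y)) y v = r * fderiv ℝ w (x + r • y) v := by
  have h1 : HasFDerivAt (fun y : EuclideanSpace ℝ (Fin n) => x + r • y)
      (r • ContinuousLinearMap.id ℝ (EuclideanSpace ℝ (Fin n))) y :=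
    ((hasFDerivAt_id y).const_smul r).const_add x
  have h2 := (hw (x + r • y)).hasFDerivAt.comp y h1
  have h3 : fderiv ℝ (fun y => w (x + r • y)) y =
    (fderiv ℝ w (x + r • y)).comp (r • ContinuousLinearMap.id ℝ (EuclideanSpace ℝ (Fin n))) := h2.fderiv
  rw [h3]; simp

theorem affine_smooth {k : WithTop ℕ∞} {w : EuclideanSpace ℝ (Fin n) → ℝ} (hw : ContDiff ℝ k w)
    (x : EuclideanSpace ℝ (Fin n)) (r : ℝ) : ContDiff ℝ k (fun y => w (x + r • y)) :=
  hw.comp (contDiff_const.add (contDiff_id.const_smul r))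

theorem clm_sum (L : EuclideanSpace ℝ (Fin n) →L[ℝ] ℝ) (y : EuclideanSpace ℝ (Fin n)) :
    L y = ∑ i, y i * L (ee i) := by
  conv_lhs => rw [← (EuclideanSpace.basisFun (Fin n) ℝ).sum_repr y]
  simp [ee]

end kernels

section rel
variable {n : ℕ}

theorem Imean_hasDerivAt_aux (j : ℕ) {w : EuclideanSpace ℝ (Fin n) → ℝ}
    (hw : ContDiff ℝ (⊤ : ℕ∞) w) (x : EuclideanSpace ℝ (Fin n)) (r₀ : ℝ) :
    HasDerivAt (Imean (j + 1) w x) (∫ y, kap (j + 1) y * fderiv ℝ w (x + r₀ • y) y) r₀ := by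
  have hw1 : ContDiff ℝ 1 w := contDiff_infty.mp hw 1
  have hfd : Continuous (fderiv ℝ w) := hw1.continuous_fderiv (by simp)
  have hcont : Continuous fun p : ℝ × EuclideanSpace ℝ (Fin n) => fderiv ℝ w (x + p.1 • p.2) p.2 :=
    (hfd.comp (by fun_prop)).clm_apply continuous_snd
  obtain ⟨C, hC⟩ := ((isCompact_closedBall r₀ 1).prod
    (isCompact_closedBall (0 : EuclideanSpace ℝ (Fin n)) 1)).exists_bound_of_continuousOn
      hcont.continuousOn
  have hkc := kap_continuous (n := n) (j + 1)
  have hks := kap_compactSupport (n := n) (j := j + 1) (by omega)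
  have hki : Integrable (kap (n := n) (j + 1)) := hkc.integrable_of_hasCompactSupport hks
  refine (hasDerivAt_integral_of_dominated_loc_of_deriv_le (s := closedBall r₀ 1)
    (bound := fun y => C * kap (j + 1) y) (closedBall_mem_nhds r₀ one_pos)
    (F := fun r y => kap (j + 1) y * w (x + r • y))
    (F' := fun r y => kap (j + 1) y * fderiv ℝ w (x + r • y) y) ?_ ?_ ?_ ?_ ?_ ?_).2
  · refine Eventually.of_forall fun r => Continuous.aestronglyMeasurable ?_
    exact hkc.mul (hw.continuous.comp (by fun_prop))
  · exact (hkc.mul (hw.continuous.comp (by fun_prop))).integrable_of_hasCompactSupport hks.mul_right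
  · refine Continuous.aestronglyMeasurable ?_
    exact hkc.mul ((hfd.comp (by fun_prop)).clm_apply continuous_id)
  · refine Eventually.of_forall fun y r hr => ?_
    rcases le_total 1 ‖y‖ with h | h
    · simp [kap_zero_of_one_le (j := j + 1) (by omega) h]
    · have := hC (r, y) ⟨hr, by simpa using h⟩
      rw [norm_mul, Real.norm_of_nonneg (kap_nonneg _ _), mul_comm]
      exact mul_le_mul_of_nonneg_right this (kap_nonneg _ _)
  · exact hki.const_mul C
  · refine Eventually.of_forall fun y r _ => ?_
    have h1 : HasDerivAt (fun r : ℝ => x + r • y) y r := by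
      simpa using ((hasDerivAt_id r).smul_const y).const_add x
    exact (((hw1.differentiable (by simp)) (x + r • y)).hasFDerivAt.comp_hasDerivAt r h1).const_mul _

theorem Imean_hasDerivAt (j : ℕ) {w : EuclideanSpace ℝ (Fin n) → ℝ}
    (hw : ContDiff ℝ (⊤ : ℕ∞) w) (x : EuclideanSpace ℝ (Fin n)) (r : ℝ) :
    HasDerivAt (Imean (j + 1) w x) (r / (2 * (j + 2)) * Imean (j + 2) (laplacian w) x r) r := by
  convert Imean_hasDerivAt_aux j hw x r using 1
  have hw2 : ContDiff ℝ 2 w := contDiff_infty.mp hw 2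
  have hkc := kap_continuous (n := n) (j + 1)
  have hks := kap_compactSupport (n := n) (j := j + 1) (by omega)
  have hk2 := kap_compactSupport (n := n) (j := j + 2) (by omega)
  have hkd : ContDiff ℝ 1 (kap (n := n) (j + 2)) :=
    (kap_contDiff (n := n) (j + 1)).of_le (by exact_mod_cast Nat.le_add_left 1 j)
  have e1 : ∀ y, kap (j + 1) y * fderiv ℝ w (x + r • y) y =
      ∑ i, -(1 / (2 * (j + 2 : ℝ))) * (fderiv ℝ (kap (j + 2)) y (ee i) * fderiv ℝ w (x + r • y) (ee i)) := by
    intro y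
    rw [clm_sum, Finset.mul_sum]
    refine Finset.sum_congr rfl fun i _ => ?_
    rw [kap_fderiv]
    field_simp
  have e2 : ∀ y, kap (j + 2) y * laplacian w (x + r • y) =
      ∑ i, kap (j + 2) y * fderiv ℝ (fun y => fderiv ℝ w y (ee i)) (x + r • y) (ee i) := by
    intro y
    rw [laplacian_eq w hw2, Finset.mul_sum]
  unfold Imean
  simp_rw [e1, e2]
  have hpd : ∀ i, ContDiff ℝ (⊤ : ℕ∞) (fun y => fderiv ℝ w y (ee i)) := fun i => pd_smooth hw i
  have hc2 : ∀ i, Continuous fun y => fderiv ℝ (fun y => fderiv ℝ w y (ee i)) (x + r • y) (ee i) :=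
    fun i => (pd_smooth (hpd i) i).continuous.comp (by fun_prop)
  rw [integral_finsetSum, integral_finsetSum, Finset.mul_sum]
  · refine Finset.sum_congr rfl fun i _ => ?_
    rw [integral_const_mul]
    have := ibp (φ := kap (n := n) (j + 2)) (ψ := fun y => fderiv ℝ w (x + r • y) (ee i)) hkd hk2
      (contDiff_infty.mp (affine_smooth (hpd i) x r) 1) (ee i)
    simp_rw [fderiv_comp_affine (w := fun y => fderiv ℝ w y (ee i)) ((contDiff_infty.mp (hpd i) 1).differentiable (by simp))] at this
    rw [eq_neg_iff_add_eq_zero] at this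
    have h3 : ∫ y, kap (j + 2) y * (r * fderiv ℝ (fun y => fderiv ℝ w y (ee i)) (x + r • y) (ee i)) =
      r * ∫ y, kap (j + 2) y * (fderiv ℝ (fun y => fderiv ℝ w y (ee i)) (x + r • y) (ee i)) := by
      rw [← integral_const_mul]; congr 1; ext y; ring
    rw [h3] at this
    have h4 : ((2:ℝ) * (j + 2)) ≠ 0 := by positivity
    field_simp
    linarith
  · intro i _
    refine ((((hkd.continuous_fderiv (by simp)).clm_apply continuous_const).mul
      ((hpd i).continuous.comp (by fun_prop))).integrable_of_hasCompactSupport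
        (hk2.fderiv_apply (𝕜 := ℝ) (ee i)).mul_right).const_mul _
  · intro i _
    exact ((kap_continuous _).mul (hc2 i)).integrable_of_hasCompactSupport hk2.mul_right

theorem Imean_lap (j : ℕ) {w : EuclideanSpace ℝ (Fin n) → ℝ}
    (hw : ContDiff ℝ (⊤ : ℕ∞) w) (x : EuclideanSpace ℝ (Fin n)) (r : ℝ) :
    r ^ 2 * Imean (j + 3) (laplacian w) x r =
      4 * (j + 3) * (j + 2) * Imean (j + 1) w x r
       - (4 * (j + 3) * (j + 2) + 2 * n * (j + 3)) * Imean (j + 2) w x r := by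
  have hw2 : ContDiff ℝ 2 w := contDiff_infty.mp hw 2
  have hk1 := kap_compactSupport (n := n) (j := j + 1) (by omega)
  have hk2 := kap_compactSupport (n := n) (j := j + 2) (by omega)
  have hk3 := kap_compactSupport (n := n) (j := j + 3) (by omega)
  have hkd2 : ContDiff ℝ 1 (kap (n := n) (j + 2)) :=
    (kap_contDiff (n := n) (j + 1)).of_le (by exact_mod_cast Nat.le_add_left 1 j)
  have hkd3 : ContDiff ℝ 1 (kap (n := n) (j + 3)) :=
    (kap_contDiff (n := n) (j + 2)).of_le (by exact_mod_cast (by omega : 1 ≤ j + 2))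
  have hpd : ∀ i, ContDiff ℝ (⊤ : ℕ∞) (fun y => fderiv ℝ w y (ee i)) := fun i => pd_smooth hw i
  have hc2 : ∀ i, Continuous fun y => fderiv ℝ (fun y => fderiv ℝ w y (ee i)) (x + r • y) (ee i) :=
    fun i => (pd_smooth (hpd i) i).continuous.comp (by fun_prop)
  have hwc : Continuous fun y : EuclideanSpace ℝ (Fin n) => w (x + r • y) := hw.continuous.comp (by fun_prop)
  have e2 : ∀ y, kap (j + 3) y * laplacian w (x + r • y) =
      ∑ i, kap (j + 3) y * fderiv ℝ (fun y => fderiv ℝ w y (ee i)) (x + r • y) (ee i) := by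
    intro y
    rw [laplacian_eq w hw2, Finset.mul_sum]
  -- the function kap_{j+2} y_i
  have hq : ∀ i : Fin n, ContDiff ℝ 1 fun y : EuclideanSpace ℝ (Fin n) => kap (j + 2) y * y i := fun i =>
    hkd2.mul (by fun_prop)
  have hqs : ∀ i : Fin n, HasCompactSupport fun y : EuclideanSpace ℝ (Fin n) => kap (j + 2) y * y i := fun i =>
    hk2.mul_right
  have hqd : ∀ (i : Fin n) y, fderiv ℝ (fun y : EuclideanSpace ℝ (Fin n) => kap (j + 2) y * y i) y (ee i) =
      kap (j + 2) y - 2 * (j + 2) * (kap (j + 1) y * (y i) ^ 2) := by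
    intro i y
    have h1 : HasFDerivAt (fun y : EuclideanSpace ℝ (Fin n) => y i) (EuclideanSpace.proj (𝕜 := ℝ) i : EuclideanSpace ℝ (Fin n) →L[ℝ] ℝ) y :=
      (EuclideanSpace.proj (𝕜 := ℝ) i : EuclideanSpace ℝ (Fin n) →L[ℝ] ℝ).hasFDerivAt
    have h2 := (hkd2.differentiable (by simp) y).hasFDerivAt.mul h1
    have h3 : fderiv ℝ (fun y : EuclideanSpace ℝ (Fin n) => kap (j + 2) y * y i) y = _ := h2.fderiv
    rw [h3]
    simp only [add_apply, smul_apply, smul_eq_mul]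
    rw [kap_fderiv]
    simp [ee]
    ring
  have step : ∀ i, r ^ 2 * ∫ y, kap (j + 3) y * fderiv ℝ (fun y => fderiv ℝ w y (ee i)) (x + r • y) (ee i)
      = -(2 * (j + 3)) * ∫ y, (kap (j + 2) y - 2 * (j + 2) * (kap (j + 1) y * (y i) ^ 2)) * w (x + r • y) := by
    intro i
    have i1 := ibp (φ := kap (n := n) (j + 3)) (ψ := fun y => fderiv ℝ w (x + r • y) (ee i)) hkd3 hk3
      (contDiff_infty.mp (affine_smooth (hpd i) x r) 1) (ee i)
    simp_rw [fderiv_comp_affine (w := fun y => fderiv ℝ w y (ee i)) ((contDiff_infty.mp (hpd i) 1).differentiable (by simp))] at i1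
    have i2 := ibp (φ := fun y => kap (n := n) (j + 2) y * y i) (ψ := fun y => w (x + r • y)) (hq i) (hqs i)
      (contDiff_infty.mp (affine_smooth hw x r) 1) (ee i)
    simp_rw [fderiv_comp_affine (w := w) ((contDiff_infty.mp hw 1).differentiable (by simp))] at i2
    simp_rw [hqd i] at i2
    have e3 : ∀ y : EuclideanSpace ℝ (Fin n), fderiv ℝ (kap (j + 3)) y (ee i) = -(2 * (j + 3 : ℝ)) * (kap (j + 2) y * y i) := by
      intro y
      have := kap_fderiv (j + 1) y i
      push_cast at this
      rw [show j + 3 = j + 1 + 2 by ring, this]; ring_nf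
    simp_rw [e3] at i1
    have h5 : r ^ 2 * ∫ y, kap (j + 3) y * fderiv ℝ (fun y => fderiv ℝ w y (ee i)) (x + r • y) (ee i)
      = r * ∫ y, kap (j + 3) y * (r * fderiv ℝ (fun y => fderiv ℝ w y (ee i)) (x + r • y) (ee i)) := by
      rw [← integral_const_mul, ← integral_const_mul]; congr 1; ext y; ring
    have h6 : r * ∫ y, -(2 * (j + 3 : ℝ)) * (kap (j + 2) y * y i) * fderiv ℝ w (x + r • y) (ee i)
      = -(2 * (j + 3 : ℝ)) * ∫ y, (kap (j + 2) y * y i) * (r * fderiv ℝ w (x + r • y) (ee i)) := by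
      rw [← integral_const_mul, ← integral_const_mul]; congr 1; ext y; ring
    rw [h5, i1, mul_neg, h6, i2]
    ring
  have hint1 : Integrable fun y => kap (j + 1) y * w (x + r • y) :=
    ((kap_continuous _).mul hwc).integrable_of_hasCompactSupport hk1.mul_right
  have hint2 : Integrable fun y => kap (j + 2) y * w (x + r • y) :=
    ((kap_continuous _).mul hwc).integrable_of_hasCompactSupport hk2.mul_right
  have hinti : ∀ i : Fin n, Integrable fun y => (kap (j + 2) y - 2 * (j + 2) * (kap (j + 1) y * (y i) ^ 2)) * w (x + r • y) := by
    intro i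
    have c : Continuous fun y : EuclideanSpace ℝ (Fin n) => y i := by fun_prop
    have h1 : Integrable fun y : EuclideanSpace ℝ (Fin n) => (kap (j + 1) y * (y i) ^ 2) * w (x + r • y) :=
      (((kap_continuous _).mul (c.pow 2)).mul hwc).integrable_of_hasCompactSupport hk1.mul_right.mul_right
    have := hint2.sub (h1.const_mul (2 * (j + 2)))
    refine this.congr (Eventually.of_forall fun y => ?_)
    simp only [Pi.sub_apply]; ring
  unfold Imean
  simp_rw [e2]
  rw [integral_finsetSum, Finset.mul_sum]
  swap
  · intro i _
    exact ((kap_continuous _).mul (hc2 i)).integrable_of_hasCompactSupport hk3.mul_right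
  simp_rw [step]
  rw [← Finset.mul_sum, ← integral_finsetSum _ (fun i _ => hinti i)]
  have e4 : ∀ y : EuclideanSpace ℝ (Fin n), ∑ i, (kap (j + 2) y - 2 * (j + 2) * (kap (j + 1) y * (y i) ^ 2)) * w (x + r • y)
      = (n + 2 * (j + 2)) * (kap (j + 2) y * w (x + r • y)) - 2 * (j + 2) * (kap (j + 1) y * w (x + r • y)) := by
    intro y
    rw [← Finset.sum_mul, Finset.sum_sub_distrib, ← Finset.mul_sum, ← Finset.mul_sum]
    have hn : ∑ i, (y i) ^ 2 = ‖y‖ ^ 2 := by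
      rw [EuclideanSpace.norm_sq_eq]; simp
    rw [hn]
    have hk : kap (j + 1) y * ‖y‖ ^ 2 = kap (j + 1) y - kap (j + 2) y := by
      rcases le_total 1 ‖y‖ with h | h
      · rw [kap_zero_of_one_le (by omega) h, kap_zero_of_one_le (by omega) h]; simp
      · have : 0 ≤ 1 - ‖y‖ ^ 2 := by nlinarith [norm_nonneg y]
        simp only [kap, posPow, max_eq_left this]; ring
    rw [hk]; simp; ring
  simp_rw [e4]
  rw [integral_sub (hint2.const_mul _) (hint1.const_mul _), integral_const_mul, integral_const_mul]
  ring

end rel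

section rep
variable {n : ℕ}

theorem Imean_neg (j : ℕ) (w : EuclideanSpace ℝ (Fin n) → ℝ) (x : EuclideanSpace ℝ (Fin n)) (r : ℝ) :
    Imean j (fun y => - w y) x r = - Imean j w x r := by
  unfold Imean; rw [← integral_neg]; congr 1; ext y; ring

theorem kernel_integrable {P w : EuclideanSpace ℝ (Fin n) → ℝ} (hP : Continuous P)
    (hP0 : ∀ y, 1 ≤ ‖y‖ → P y = 0) (hw : Continuous w) (x : EuclideanSpace ℝ (Fin n)) (r : ℝ) :
    Integrable fun y => P y * w (x + r • y) :=
  (hP.mul (hw.comp (by fun_prop))).integrable_of_hasCompactSupport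
    (compactSupport_of_zero hP0).mul_right

theorem exists_kernel (d k : ℕ) : ∀ j : ℕ, d + 2 * k + 1 ≤ j →
    ∃ P : EuclideanSpace ℝ (Fin n) → ℝ, ContDiff ℝ d P ∧ (∀ y, 1 ≤ ‖y‖ → P y = 0) ∧
      ∀ w : EuclideanSpace ℝ (Fin n) → ℝ, ContDiff ℝ (⊤ : ℕ∞) w → ∀ x r,
        r ^ (2 * k) * Imean j (negLapIter k w) x r = ∫ y, P y * w (x + r • y) := by
  induction k with
  | zero =>
    intro j hj
    refine ⟨kap j, ?_, fun y hy => kap_zero_of_one_le (by omega) hy, fun w hw x r => ?_⟩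
    · obtain ⟨i, rfl⟩ : ∃ i, j = i + 1 := ⟨j - 1, by omega⟩
      exact (kap_contDiff i).of_le (by exact_mod_cast (by omega : d ≤ i))
    · simp [Imean, negLapIter]
  | succ k ih =>
    intro j hj
    obtain ⟨i, rfl⟩ : ∃ i, j = i + 3 := ⟨j - 3, by omega⟩
    obtain ⟨P1, c1, z1, h1⟩ := ih (i + 1) (by omega)
    obtain ⟨P2, c2, z2, h2⟩ := ih (i + 2) (by omega)
    set a : ℝ := 4 * (i + 3) * (i + 2) with ha
    set b : ℝ := 4 * (i + 3) * (i + 2) + 2 * n * (i + 3) with hb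
    refine ⟨fun y => b * P2 y - a * P1 y, (contDiff_const.mul c2).sub (contDiff_const.mul c1),
      fun y hy => by simp [z1 y hy, z2 y hy], fun w hw x r => ?_⟩
    rw [negLapIter_succ, Imean_neg]
    have h3 := Imean_lap i (negLapIter_smooth hw k) x r
    have i1 := kernel_integrable c1.continuous z1 hw.continuous x r
    have i2 := kernel_integrable c2.continuous z2 hw.continuous x r
    have : ∫ y, (b * P2 y - a * P1 y) * w (x + r • y) =
        b * (∫ y, P2 y * w (x + r • y)) - a * (∫ y, P1 y * w (x + r • y)) := by
      rw [← integral_const_mul, ← integral_const_mul, ← integral_sub (i2.const_mul _) (i1.const_mul _)]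
      congr 1; ext y; ring
    rw [this, ← h1 w hw, ← h2 w hw]
    have e : r ^ (2 * (k + 1)) * -Imean (i + 3) (laplacian (negLapIter k w)) x r
      = - (r ^ (2 * k) * (r ^ 2 * Imean (i + 3) (laplacian (negLapIter k w)) x r)) := by ring
    rw [e, h3]
    ring

/-- The normalized means. -/
noncomputable def Ak (N k : ℕ) (u : EuclideanSpace ℝ (Fin n) → ℝ) (x : EuclideanSpace ℝ (Fin n)) (r : ℝ) : ℝ :=
  ((N.factorial : ℝ) / (N + k).factorial) * Imean (N + k) (negLapIter k u) x r

theorem Ak_hasDerivAt {N : ℕ} (hN : 1 ≤ N) (k : ℕ) {u : EuclideanSpace ℝ (Fin n) → ℝ}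
    (hu : ContDiff ℝ (⊤ : ℕ∞) u) (x : EuclideanSpace ℝ (Fin n)) (r : ℝ) :
    HasDerivAt (Ak N k u x) (-(r / 2) * Ak N (k + 1) u x r) r := by
  obtain ⟨j, hj⟩ : ∃ j, N + k = j + 1 := ⟨N + k - 1, by omega⟩
  have h := (Imean_hasDerivAt j (negLapIter_smooth hu k) x r).const_mul ((N.factorial : ℝ) / (N + k).factorial)
  unfold Ak
  rw [negLapIter_succ, Imean_neg, ← add_assoc, hj]
  rw [hj] at h
  refine h.congr_deriv ?_
  rw [Nat.factorial_succ (j + 1)]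
  push_cast
  have : ((j + 1).factorial : ℝ) ≠ 0 := by positivity
  have : ((j : ℝ) + 1 + 1) ≠ 0 := by positivity
  have : ((j : ℝ) + 2) ≠ 0 := by positivity
  field_simp
  ring

/-- The backward Taylor sum. -/
noncomputable def Ssum (N m : ℕ) (u : EuclideanSpace ℝ (Fin n) → ℝ) (x : EuclideanSpace ℝ (Fin n)) (r : ℝ) : ℝ :=
  ∑ k ∈ Finset.range m, (r ^ 2 / 4) ^ k / k.factorial * Ak N k u x r

theorem Ssum_hasDerivAt {N : ℕ} (hN : 1 ≤ N) (m : ℕ) {u : EuclideanSpace ℝ (Fin n) → ℝ}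
    (hu : ContDiff ℝ (⊤ : ℕ∞) u) (x : EuclideanSpace ℝ (Fin n)) (r : ℝ) :
    HasDerivAt (Ssum N (m + 1) u x)
      (-(r / 2) * (r ^ 2 / 4) ^ m / m.factorial * Ak N (m + 1) u x r) r := by
  induction m with
  | zero =>
    have : Ssum N (0 + 1) u x = Ak N 0 u x := by
      funext r; simp [Ssum]
    rw [this]
    refine (Ak_hasDerivAt hN 0 hu x r).congr_deriv ?_
    simp
  | succ m ih =>
    have : Ssum N (m + 1 + 1) u x = fun r => Ssum N (m + 1) u x r +
        (r ^ 2 / 4) ^ (m + 1) / (m + 1).factorial * Ak N (m + 1) u x r := by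
      funext r; simp only [Ssum]; rw [Finset.sum_range_succ]
    rw [this]
    have hp : HasDerivAt (fun r : ℝ => (r ^ 2 / 4) ^ (m + 1) / (m + 1).factorial)
        ((m + 1) * (r ^ 2 / 4) ^ m * (r / 2) / (m + 1).factorial) r := by
      have := ((((hasDerivAt_pow 2 r).div_const 4).pow (m + 1))).div_const ((m + 1).factorial : ℝ)
      refine this.congr_deriv ?_
      push_cast
      ring
    refine (ih.add (hp.mul (Ak_hasDerivAt hN (m + 1) hu x r))).congr_deriv ?_
    rw [Nat.factorial_succ m]
    push_cast
    have : (m.factorial : ℝ) ≠ 0 := by positivity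
    have : (m : ℝ) + 1 ≠ 0 := by positivity
    field_simp
    ring

theorem Ssum_zero (N m : ℕ) (u : EuclideanSpace ℝ (Fin n) → ℝ) (x : EuclideanSpace ℝ (Fin n)) :
    Ssum N (m + 1) u x 0 = (∫ y : EuclideanSpace ℝ (Fin n), kap N y) * u x := by
  unfold Ssum
  rw [Finset.sum_range_succ']
  rw [Finset.sum_eq_zero]
  · simp [Ak, Imean, negLapIter, integral_mul_const]
    field_simp
  · intro k _
    simp

theorem Ssum_kernel (d N m : ℕ) (h : d + m + 1 ≤ N) :
    ∃ P : EuclideanSpace ℝ (Fin n) → ℝ, ContDiff ℝ d P ∧ (∀ y, 1 ≤ ‖y‖ → P y = 0) ∧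
      ∀ w : EuclideanSpace ℝ (Fin n) → ℝ, ContDiff ℝ (⊤ : ℕ∞) w → ∀ x r,
        Ssum N m w x r = ∫ y, P y * w (x + r • y) := by
  have : ∀ k ∈ Finset.range m, ∃ P : EuclideanSpace ℝ (Fin n) → ℝ, ContDiff ℝ d P ∧ (∀ y, 1 ≤ ‖y‖ → P y = 0) ∧
      ∀ w : EuclideanSpace ℝ (Fin n) → ℝ, ContDiff ℝ (⊤ : ℕ∞) w → ∀ x r,
        r ^ (2 * k) * Imean (N + k) (negLapIter k w) x r = ∫ y, P y * w (x + r • y) := by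
    intro k hk
    have := Finset.mem_range.mp hk
    exact exists_kernel d k (N + k) (by omega)
  choose! P hP1 hP2 hP3 using this
  refine ⟨fun y => ∑ k ∈ Finset.range m, (1 / 4 ^ k / k.factorial * ((N.factorial : ℝ) / (N + k).factorial)) * P k y,
    ContDiff.sum fun k hk => contDiff_const.mul (hP1 k hk), ?_, ?_⟩
  · intro y hy
    exact Finset.sum_eq_zero fun k hk => by rw [hP2 k hk y hy]; simp
  · intro w hw x r
    simp_rw [Finset.sum_mul]
    rw [integral_finsetSum]
    · unfold Ssum
      refine Finset.sum_congr rfl fun k hk => ?_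
      simp_rw [mul_assoc]
      rw [integral_const_mul, integral_const_mul, ← hP3 k hk w hw x r]
      unfold Ak
      rw [pow_mul, div_pow]
      ring
    · intro k hk
      simp_rw [mul_assoc]
      exact ((kernel_integrable (hP1 k hk).continuous (hP2 k hk) hw.continuous x r).const_mul _).const_mul _

theorem beta_integral (N : ℕ) : ∀ a : ℕ, ∫ r in (0:ℝ)..1, r ^ (2 * a + 1) * (1 - r ^ 2) ^ N =
    (a.factorial : ℝ) * N.factorial / (2 * (a + 1 + N).factorial) := by
  induction N with
  | zero =>
    intro a
    simp [integral_pow]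
    rw [Nat.factorial_succ]
    push_cast
    have : (a.factorial : ℝ) ≠ 0 := by positivity
    field_simp
    ring
  | succ N ih =>
    intro a
    have hd : ∀ r : ℝ, HasDerivAt (fun r : ℝ => r ^ (2 * a + 2) * (1 - r ^ 2) ^ (N + 1))
        ((2 * a + 2) * (r ^ (2 * a + 1) * (1 - r ^ 2) ^ (N + 1)) -
          2 * (N + 1) * (r ^ (2 * (a + 1) + 1) * (1 - r ^ 2) ^ N)) r := by
      intro r
      have h1 := hasDerivAt_pow (2 * a + 2) r
      have h2 := (((hasDerivAt_pow 2 r).const_sub 1).pow (N + 1))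
      refine (h1.mul h2).congr_deriv ?_
      push_cast
      simp only [Pi.pow_apply]
      ring
    have hi := intervalIntegral.integral_eq_sub_of_hasDerivAt (a := 0) (b := 1) (fun r _ => hd r)
      (Continuous.intervalIntegrable (by fun_prop) _ _)
    rw [intervalIntegral.integral_sub (Continuous.intervalIntegrable (by fun_prop) _ _)
      (Continuous.intervalIntegrable (by fun_prop) _ _), intervalIntegral.integral_const_mul,
      intervalIntegral.integral_const_mul, ih (a + 1)] at hi
    simp at hi
    have h0 : (a + 1 + (N + 1)).factorial = (a + 1 + 1 + N).factorial := by congr 1; ring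
    rw [h0, Nat.factorial_succ N]
    rw [Nat.factorial_succ a] at hi
    push_cast at hi ⊢
    have : ((a + 1 + 1 + N).factorial : ℝ) ≠ 0 := by positivity
    have h3 : (a : ℝ) + 1 ≠ 0 := by positivity
    field_simp at hi ⊢
    have h4 : (2 * (a:ℝ) + 2) = 2 * (a + 1) := by ring
    apply mul_left_cancel₀ h3
    nlinarith [hi]

theorem kap_integral {m : ℕ} (hm : 1 ≤ m) (hn : n = 2 * m) {N : ℕ} (hN : 1 ≤ N) :
    ∫ y : EuclideanSpace ℝ (Fin n), kap N y = Real.pi ^ m * N.factorial / (m + N).factorial := by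
  have hne : Nonempty (Fin n) := ⟨⟨0, by omega⟩⟩
  have hfin : Module.finrank ℝ (EuclideanSpace ℝ (Fin n)) = 2 * m := by simp [hn]
  unfold kap
  rw [integral_fun_norm_addHaar (volume : Measure (EuclideanSpace ℝ (Fin n))) (fun r => posPow N (1 - r ^ 2))]
  have hv : (volume : Measure (EuclideanSpace ℝ (Fin n))).real (ball 0 1) = Real.pi ^ m / m.factorial := by
    rw [measureReal_def, InnerProductSpace.volume_ball_of_dim_even hfin]
    simp
    positivity
  rw [hv, hfin]
  have hI : ∫ y in Set.Ioi (0:ℝ), y ^ (2 * m - 1) • posPow N (1 - y ^ 2) =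
      ∫ r in (0:ℝ)..1, r ^ (2 * (m - 1) + 1) * (1 - r ^ 2) ^ N := by
    rw [intervalIntegral.integral_of_le zero_le_one]
    refine (setIntegral_eq_of_subset_of_forall_sdiff_eq_zero measurableSet_Ioi (s := Set.Ioc (0:ℝ) 1)
      (fun x hx => hx.1) ?_).trans ?_
    rotate_left
    · refine setIntegral_congr_fun measurableSet_Ioc fun r hr => ?_
      have : 0 ≤ 1 - r ^ 2 := by nlinarith [hr.1, hr.2]
      simp only [posPow, max_eq_left this, smul_eq_mul]
      rw [show 2 * m - 1 = 2 * (m - 1) + 1 by omega]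
    · intro r hr
      have h1 : 1 < r := by
        by_contra h
        exact hr.2 ⟨hr.1, not_lt.mp h⟩
      have : 1 - r ^ 2 ≤ 0 := by nlinarith
      simp [posPow, max_eq_right this]
      right; omega
  rw [hI, beta_integral]
  obtain ⟨p, rfl⟩ : ∃ p, m = p + 1 := ⟨m - 1, by omega⟩
  simp only [add_tsub_cancel_right]
  rw [Nat.factorial_succ p]
  simp only [nsmul_eq_mul, smul_eq_mul]
  push_cast
  have : (p.factorial : ℝ) ≠ 0 := by positivity
  field_simp

end rep

section kker

theorem posPow_nonneg (j : ℕ) (t : ℝ) : 0 ≤ posPow j t := by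
  unfold posPow; positivity

theorem posPow_le_one (j : ℕ) {t : ℝ} (ht : t ≤ 1) : posPow j t ≤ 1 := by
  unfold posPow
  exact pow_le_one₀ (le_max_right _ _) (max_le ht zero_le_one)

theorem posPow_zero {j : ℕ} (hj : 1 ≤ j) {t : ℝ} (ht : t ≤ 0) : posPow j t = 0 := by
  unfold posPow
  rw [max_eq_right ht, zero_pow (by omega)]

/-- The truncated logarithmic kernel. -/
noncomputable def kk (M : ℕ) (ρ : ℝ) : ℝ := ∫ t in ρ..1, posPow M (1 - t ^ 2) / t

theorem kk_cont_aux (M : ℕ) : ContinuousOn (fun t : ℝ => posPow M (1 - t ^ 2) / t) (Set.Ioi 0) := by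
  apply ContinuousOn.div
  · exact ((posPow_continuous M).comp (by fun_prop)).continuousOn
  · fun_prop
  · intro x hx; exact ne_of_gt hx

theorem uIcc_sub_Ioi {a b : ℝ} (ha : 0 < a) (hb : 0 < b) : Set.uIcc a b ⊆ Set.Ioi 0 := by
  intro x hx
  exact lt_of_lt_of_le (lt_min ha hb) hx.1

theorem kk_ii (M : ℕ) {a b : ℝ} (ha : 0 < a) (hb : 0 < b) :
    IntervalIntegrable (fun t : ℝ => posPow M (1 - t ^ 2) / t) volume a b :=
  ((kk_cont_aux M).mono (uIcc_sub_Ioi ha hb)).intervalIntegrable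

theorem kk_hasDerivAt (M : ℕ) {ρ : ℝ} (hρ : 0 < ρ) :
    HasDerivAt (kk M) (-(posPow M (1 - ρ ^ 2) / ρ)) ρ := by
  apply intervalIntegral.integral_hasDerivAt_left (kk_ii M hρ one_pos)
  · exact (kk_cont_aux M).stronglyMeasurableAtFilter isOpen_Ioi ρ hρ
  · exact (kk_cont_aux M).continuousAt (Ioi_mem_nhds hρ)

theorem kk_zero {M : ℕ} (hM : 1 ≤ M) {ρ : ℝ} (hρ : 1 ≤ ρ) : kk M ρ = 0 := by
  unfold kk
  rw [intervalIntegral.integral_symm]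
  have : ∫ t in (1:ℝ)..ρ, posPow M (1 - t ^ 2) / t = ∫ t in (1:ℝ)..ρ, (0:ℝ) := by
    apply intervalIntegral.integral_congr
    intro t ht
    rw [Set.uIcc_of_le hρ] at ht
    simp only
    rw [posPow_zero hM (by nlinarith [ht.1]), zero_div]
  rw [this]; simp

theorem kk_nonneg_le {M : ℕ} (hM : 1 ≤ M) {ρ : ℝ} (h0 : 0 < ρ) : 0 ≤ kk M ρ ∧ kk M ρ ≤ ρ⁻¹ := by
  rcases le_total 1 ρ with h | h
  · rw [kk_zero hM h]; exact ⟨le_rfl, by positivity⟩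
  · constructor
    · apply intervalIntegral.integral_nonneg h
      intro t ht
      exact div_nonneg (posPow_nonneg _ _) (h0.le.trans ht.1)
    · have : kk M ρ ≤ ∫ t in ρ..1, 1 / t := by
        apply intervalIntegral.integral_mono_on h (kk_ii M h0 one_pos)
        · apply ContinuousOn.intervalIntegrable
          apply ContinuousOn.div (by fun_prop) (by fun_prop)
          intro t ht
          exact ne_of_gt (uIcc_sub_Ioi h0 one_pos ht)
        · intro t ht
          have : 0 < t := h0.trans_le ht.1
          gcongr
          exact posPow_le_one _ (by nlinarith)
      rw [integral_one_div_of_pos h0 one_pos] at this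
      have h2 := Real.log_le_sub_one_of_pos (inv_pos.mpr h0)
      rw [one_div] at this
      linarith

theorem kk_anti {M : ℕ} {a b : ℝ} (ha : 0 < a) (hab : a ≤ b) : kk M b ≤ kk M a := by
  have hb := ha.trans_le hab
  have : kk M a = (∫ t in a..b, posPow M (1 - t ^ 2) / t) + kk M b := by
    unfold kk
    rw [intervalIntegral.integral_add_adjacent_intervals (kk_ii M ha hb) (kk_ii M hb one_pos)]
  rw [this]
  have : 0 ≤ ∫ t in a..b, posPow M (1 - t ^ 2) / t := by
    apply intervalIntegral.integral_nonneg hab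
    intro t ht
    exact div_nonneg (posPow_nonneg _ _) (ha.le.trans ht.1)
  linarith

theorem kk_continuousOn (M : ℕ) : ContinuousOn (kk M) (Set.Ioi 0) :=
  fun _ hx => (kk_hasDerivAt M hx).continuousAt.continuousWithinAt

/-- `kk + log` is Lipschitz. -/
theorem kk_log_lip (M : ℕ) (hM : 1 ≤ M) {a b : ℝ} (ha : 0 < a) (hb : 0 < b) :
    |(kk M a + Real.log a) - (kk M b + Real.log b)| ≤ M * |a - b| := by
  have h := Convex.norm_image_sub_le_of_norm_hasDerivWithin_le (f := fun t => kk M t + Real.log t)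
    (f' := fun t => -(posPow M (1 - t ^ 2) / t) + t⁻¹) (s := Set.Ioi 0) (C := M) (x := b) (y := a)
    (fun t ht => ((kk_hasDerivAt M ht).add (Real.hasDerivAt_log (ne_of_gt ht))).hasDerivWithinAt)
    ?_ (convex_Ioi 0) hb ha
  · simpa using h
  · intro t ht
    have ht : 0 < t := ht
    have e : -(posPow M (1 - t ^ 2) / t) + t⁻¹ = (1 - posPow M (1 - t ^ 2)) / t := by
      field_simp; ring
    have h1 : posPow M (1 - t ^ 2) ≤ 1 := posPow_le_one _ (by nlinarith)
    rw [e, Real.norm_eq_abs, abs_of_nonneg (div_nonneg (by linarith) ht.le), div_le_iff₀ ht]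
    have hM' : (1:ℝ) ≤ M := by exact_mod_cast hM
    rcases le_total 1 t with h | h
    · have := posPow_nonneg M (1 - t ^ 2)
      nlinarith
    · have h0 : 0 ≤ 1 - t ^ 2 := by nlinarith
      have hb := one_add_mul_le_pow (a := -t^2) (by nlinarith) M
      unfold posPow
      rw [max_eq_left h0]
      have : (1 + -t ^ 2) ^ M = (1 - t ^ 2) ^ M := by ring_nf
      rw [this] at hb
      nlinarith [mul_nonneg (by linarith : (0:ℝ) ≤ M) (by nlinarith : 0 ≤ t - t ^ 2)]
end kker

section rep2
variable {n : ℕ}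

theorem inv_norm_integrableOn (hn : 2 ≤ n) (R : ℝ) :
    IntegrableOn (fun z : EuclideanSpace ℝ (Fin n) => ‖z‖⁻¹) (ball 0 R) := by
  have hne : Nonempty (Fin n) := ⟨⟨0, by omega⟩⟩
  have hfin : Module.finrank ℝ (EuclideanSpace ℝ (Fin n)) = n := by simp
  have h : Integrable (fun z : EuclideanSpace ℝ (Fin n) =>
      (Set.Iio R).indicator (fun r : ℝ => r⁻¹) ‖z‖) := by
    rw [integrable_fun_norm_addHaar (volume : Measure (EuclideanSpace ℝ (Fin n))) (f := (Set.Iio R).indicator (fun r : ℝ => r⁻¹)), hfin]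
    have hb : IntegrableOn (fun y : ℝ => y ^ (n - 2)) (Set.Ioo 0 R) :=
      ((continuous_pow (n - 2)).integrableOn_Icc).mono_set Set.Ioo_subset_Icc_self
    have : IntegrableOn ((Set.Iio R).indicator (fun y : ℝ => y ^ (n - 2))) (Set.Ioi 0) := by
      rw [IntegrableOn, integrable_indicator_iff measurableSet_Iio, IntegrableOn, Measure.restrict_restrict measurableSet_Iio]
      refine hb.mono_set ?_
      rintro x ⟨h1, h2⟩; exact ⟨h2, h1⟩
    refine this.congr_fun ?_ measurableSet_Ioi
    intro r hr
    have hr : (0:ℝ) < r := hr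
    simp only [Set.indicator, smul_eq_mul]
    split_ifs
    · obtain ⟨p, rfl⟩ : ∃ p, n = p + 2 := ⟨n - 2, by omega⟩
      simp only [add_tsub_cancel_right, show p + 2 - 1 = p + 1 by omega]
      rw [pow_succ, mul_assoc, mul_inv_cancel₀ hr.ne', mul_one]
    · simp
  rw [← integrable_indicator_iff measurableSet_ball]
  refine h.congr (ae_of_all _ fun z => ?_)
  simp [Set.indicator]

theorem sing_int (hn : 2 ≤ n) {f : EuclideanSpace ℝ (Fin n) → ℝ} (hc : Continuous f)
    (hi : Integrable f) (x : EuclideanSpace ℝ (Fin n)) :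
    Integrable (fun z => ‖z‖⁻¹ * f (x + z)) := by
  have hi' : Integrable (fun z => f (x + z)) := hi.comp_add_left x
  have hms : AEStronglyMeasurable (fun z => ‖z‖⁻¹ * f (x + z)) volume :=
    (measurable_norm.inv.mul (hc.comp (by fun_prop)).measurable).aestronglyMeasurable
  rw [← integrableOn_univ, ← Set.union_compl_self (ball (0 : EuclideanSpace ℝ (Fin n)) 1)]
  refine IntegrableOn.union ?_ ?_
  · obtain ⟨B, hB⟩ := (isCompact_closedBall (0 : EuclideanSpace ℝ (Fin n)) 1).exists_bound_of_continuousOn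
      (f := fun z => f (x + z)) (by fun_prop)
    refine Integrable.mono' ((inv_norm_integrableOn hn 1).mul_const B) hms.restrict ?_
    filter_upwards [ae_restrict_mem measurableSet_ball] with z hz
    rw [norm_mul, norm_inv, norm_norm]
    gcongr
    exact hB z (ball_subset_closedBall hz)
  · refine Integrable.mono' hi'.norm.integrableOn hms.restrict ?_
    filter_upwards [ae_restrict_mem measurableSet_ball.compl] with z hz
    have hz : 1 ≤ ‖z‖ := by simpa using hz
    rw [norm_mul, norm_inv, norm_norm]
    have : ‖z‖⁻¹ ≤ 1 := inv_le_one_of_one_le₀ hz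
    nlinarith [norm_nonneg (f (x + z))]

theorem norm_ae_pos (hn : 2 ≤ n) : ∀ᵐ z : EuclideanSpace ℝ (Fin n), 0 < ‖z‖ := by
  have hne : Nonempty (Fin n) := ⟨⟨0, by omega⟩⟩
  filter_upwards [compl_mem_ae_iff.mpr (measure_singleton (0 : EuclideanSpace ℝ (Fin n)))] with z hz
  exact norm_pos_iff.mpr hz

theorem kk_measurable_aux (M : ℕ) (R : ℝ) (hR : 0 < R) (hn : 2 ≤ n) :
    AEStronglyMeasurable (fun z : EuclideanSpace ℝ (Fin n) => kk M (‖z‖ / R)) volume := by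
  have : AEStronglyMeasurable (fun z : EuclideanSpace ℝ (Fin n) => kk M (‖z‖ / R)) (volume.restrict {z | 0 < ‖z‖}) := by
    apply ContinuousOn.aestronglyMeasurable
    · refine (kk_continuousOn M).comp (by fun_prop) ?_
      intro z hz
      exact div_pos hz hR
    · exact measurableSet_lt measurable_const measurable_norm
  rwa [Measure.restrict_eq_self_of_ae_mem] at this
  exact norm_ae_pos hn

theorem kk_int {M : ℕ} (hM : 1 ≤ M) (hn : 2 ≤ n) {f : EuclideanSpace ℝ (Fin n) → ℝ} (hc : Continuous f)
    (hi : Integrable f) (x : EuclideanSpace ℝ (Fin n)) {R : ℝ} (hR : 0 < R) :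
    Integrable (fun z => kk M (‖z‖ / R) * f (x + z)) := by
  refine Integrable.mono' ((sing_int hn hc hi x).norm.const_mul R)
    ((kk_measurable_aux M R hR hn).mul (hc.comp (by fun_prop)).aestronglyMeasurable) ?_
  filter_upwards [norm_ae_pos hn] with z hz
  have := kk_nonneg_le hM (div_pos hz hR)
  rw [norm_mul, norm_mul, norm_inv, norm_norm, ← mul_assoc, Real.norm_of_nonneg this.1]
  gcongr
  refine this.2.trans_eq ?_
  field_simp

/-- The truncated potential. -/
noncomputable def Fpot (M : ℕ) (f : EuclideanSpace ℝ (Fin n) → ℝ) (x : EuclideanSpace ℝ (Fin n)) (R : ℝ) : ℝ :=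
  ∫ z, kk M (‖z‖ / R) * f (x + z)

theorem Fpot_hasDerivAt {M : ℕ} (hM : 1 ≤ M) (hn : 2 ≤ n) {f : EuclideanSpace ℝ (Fin n) → ℝ}
    (hc : Continuous f) (hi : Integrable f) (x : EuclideanSpace ℝ (Fin n)) {R : ℝ} (hR : 0 < R) :
    HasDerivAt (Fpot M f x) (R ^ (n - 1) * Imean M f x R) R := by
  have hi' : Integrable (fun z => f (x + z)) := hi.comp_add_left x
  have h := hasDerivAt_integral_of_dominated_loc_of_deriv_le (μ := volume) (𝕜 := ℝ)
    (F := fun R z => kk M (‖z‖ / R) * f (x + z)) (x₀ := R) (s := Set.Ioi (R / 2))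
    (F' := fun R z => (posPow M (1 - (‖z‖ / R) ^ 2) / R) * f (x + z))
    (bound := fun z => (2 / R) * ‖f (x + z)‖) (Ioi_mem_nhds (by linarith)) ?_ ?_ ?_ ?_ ?_ ?_
  · refine h.2.congr_deriv ?_
    have e := Measure.integral_comp_smul (volume : Measure (EuclideanSpace ℝ (Fin n)))
      (fun z => posPow M (1 - (‖z‖ / R) ^ 2) * f (x + z)) R
    have e1 : Imean M f x R = ∫ y, posPow M (1 - (‖R • y‖ / R) ^ 2) * f (x + R • y) := by
      unfold Imean kap
      congr 1; ext y
      rw [norm_smul, Real.norm_of_nonneg hR.le, mul_div_cancel_left₀ _ hR.ne']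
    have e2 : ∫ z, posPow M (1 - (‖z‖ / R) ^ 2) / R * f (x + z) =
        R⁻¹ * ∫ z, posPow M (1 - (‖z‖ / R) ^ 2) * f (x + z) := by
      rw [← integral_const_mul]; congr 1; ext z; ring
    rw [e1, e, e2]
    simp only [smul_eq_mul]
    rw [finrank_euclideanSpace_fin, abs_of_nonneg (by positivity), ← mul_assoc]
    congr 1
    obtain ⟨p, rfl⟩ : ∃ p, n = p + 1 := ⟨n - 1, by omega⟩
    simp only [add_tsub_cancel_right]
    field_simp
    ring
  · filter_upwards [Ioi_mem_nhds hR] with S hS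
    exact (kk_int hM hn hc hi x hS).1
  · exact kk_int hM hn hc hi x hR
  · refine (Continuous.mul (Continuous.div_const ((posPow_continuous M).comp ?_) _) (hc.comp ?_)).aestronglyMeasurable
    · fun_prop
    · fun_prop
  · refine ae_of_all _ fun z S hS => ?_
    have hS : R / 2 < S := hS
    have hS0 : 0 < S := by linarith
    rw [norm_mul]
    gcongr
    rw [Real.norm_of_nonneg (div_nonneg (posPow_nonneg _ _) hS0.le)]
    calc _ ≤ 1 / S := by
          gcongr
          exact posPow_le_one _ (by nlinarith [sq_nonneg (‖z‖ / S)])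
      _ ≤ 2 / R := by rw [div_le_div_iff₀ hS0 hR]; linarith
  · exact hi'.norm.const_mul _
  · filter_upwards [norm_ae_pos hn] with z hz S hS
    have hS : R / 2 < S := hS
    have hS0 : 0 < S := by linarith
    have h1 := (kk_hasDerivAt M (div_pos hz hS0)).comp S
      (((hasDerivAt_inv hS0.ne').const_mul ‖z‖))
    refine (h1.mul_const (f (x + z))).congr_deriv ?_
    simp only [div_pow]
    field_simp

theorem Fpot_tendsto {M : ℕ} (hM : 1 ≤ M) (hn : 2 ≤ n) {f : EuclideanSpace ℝ (Fin n) → ℝ}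
    (hc : Continuous f) (hi : Integrable f) (x : EuclideanSpace ℝ (Fin n)) :
    Tendsto (Fpot M f x) (𝓝[>] 0) (𝓝 0) := by
  have h := tendsto_integral_filter_of_dominated_convergence (μ := volume) (l := 𝓝[>] (0:ℝ))
    (F := fun R z => kk M (‖z‖ / R) * f (x + z)) (f := fun _ => (0:ℝ))
    (fun z => ‖kk M (‖z‖ / 1) * f (x + z)‖) ?_ ?_ (kk_int hM hn hc hi x one_pos).norm ?_
  · simp only [integral_zero] at h
    exact h
  · filter_upwards [self_mem_nhdsWithin] with R hR
    exact (kk_int hM hn hc hi x hR).1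
  · filter_upwards [Ioc_mem_nhdsGT (zero_lt_one' ℝ)] with R hR
    filter_upwards [norm_ae_pos hn] with z hz
    have h1 := kk_nonneg_le hM (div_pos hz hR.1)
    have h2 : kk M (‖z‖ / R) ≤ kk M (‖z‖ / 1) := by
      apply kk_anti (by positivity)
      gcongr
      · exact hR.1
      · exact hR.2
    rw [norm_mul, norm_mul, Real.norm_of_nonneg h1.1, Real.norm_of_nonneg (h1.1.trans h2)]
    gcongr
  · filter_upwards [norm_ae_pos hn] with z hz
    apply tendsto_const_nhds.congr'
    filter_upwards [Ioc_mem_nhdsGT hz] with R hR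
    rw [kk_zero hM, zero_mul]
    rw [one_le_div hR.1]
    exact hR.2

/-- The normalization constant. -/
noncomputable def betaN (m N : ℕ) : ℝ := Real.pi ^ m * N.factorial / (m + N).factorial

theorem betaN_pos (m N : ℕ) : 0 < betaN m N := by unfold betaN; positivity

theorem cconst_pos (n : ℕ) : 0 < cconst n := by unfold cconst; positivity

theorem rep_formula {m : ℕ} (hm : 1 ≤ m) (hn : n = 2 * m) {u f : EuclideanSpace ℝ (Fin n) → ℝ}
    (hu : ContDiff ℝ (⊤ : ℕ∞) u) (hPDE : ∀ x, negLapIter m u x = 2 * f x)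
    (hc : Continuous f) (hi : Integrable f) {N : ℕ} (hN : 1 ≤ N) (x : EuclideanSpace ℝ (Fin n))
    {R : ℝ} (hR : 0 < R) :
    u x = Ssum N m u x R / betaN m N + Fpot (N + m) f x R / cconst n := by
  obtain ⟨p, rfl⟩ : ∃ p, m = p + 1 := ⟨m - 1, by omega⟩
  have hM : 1 ≤ N + (p + 1) := by omega
  have hn2 : 2 ≤ n := by omega
  set β := betaN (p + 1) N with hβ
  have hβ0 : 0 < β := betaN_pos _ _
  have hc0 := cconst_pos n
  have hder : ∀ R, 0 < R → HasDerivAt (fun R => Ssum N (p + 1) u x R / β +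
      Fpot (N + (p + 1)) f x R / cconst n) 0 R := by
    intro R hR
    refine (((Ssum_hasDerivAt hN p hu x R).div_const β).add
      ((Fpot_hasDerivAt hM hn2 hc hi x hR).div_const (cconst n))).congr_deriv ?_
    have e : negLapIter (p + 1) u = fun y => 2 * f y := funext hPDE
    have e1 : Imean (N + (p + 1)) (negLapIter (p + 1) u) x R = 2 * Imean (N + (p + 1)) f x R := by
      rw [e]; unfold Imean
      rw [← integral_const_mul]; congr 1; ext y; ring
    unfold Ak
    rw [e1, hβ]
    generalize Imean (N + (p + 1)) f x R = I
    rw [hn]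
    unfold betaN cconst
    simp only [show 2 * (p + 1) - 2 = 2 * p by omega, show 2 * (p + 1) / 2 = p + 1 by omega,
      show 2 * p / 2 = p by omega, show 2 * (p + 1) - 1 = 2 * p + 1 by omega,
      show p + 1 + N = N + (p + 1) by omega]
    rw [div_pow, ← pow_mul, show (4:ℝ) ^ p = 2 ^ (2 * p) by rw [pow_mul]; norm_num]
    field_simp
    ring
  have hconst : ∀ S, 0 < S → Ssum N (p + 1) u x S / β + Fpot (N + (p + 1)) f x S / cconst n =
      Ssum N (p + 1) u x R / β + Fpot (N + (p + 1)) f x R / cconst n := by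
    intro S hS
    exact isOpen_Ioi.is_const_of_deriv_eq_zero (s := Set.Ioi (0:ℝ)) isPreconnected_Ioi
      (fun r hr => (hder r hr).differentiableAt.differentiableWithinAt)
      (fun r hr => (hder r hr).deriv) hS hR
  have hlim : Tendsto (fun S => Ssum N (p + 1) u x S / β + Fpot (N + (p + 1)) f x S / cconst n)
      (𝓝[>] 0) (𝓝 (Ssum N (p + 1) u x 0 / β + 0 / cconst n)) := by
    refine Tendsto.add (Tendsto.div_const ?_ _) ((Fpot_tendsto hM hn2 hc hi x).div_const _)
    exact ((Ssum_hasDerivAt hN p hu x 0).continuousAt.tendsto).mono_left nhdsWithin_le_nhds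
  have hlim2 : Tendsto (fun S => Ssum N (p + 1) u x S / β + Fpot (N + (p + 1)) f x S / cconst n)
      (𝓝[>] 0) (𝓝 (Ssum N (p + 1) u x R / β + Fpot (N + (p + 1)) f x R / cconst n)) := by
    apply tendsto_const_nhds.congr'
    filter_upwards [self_mem_nhdsWithin] with S hS
    exact (hconst S hS).symm
  have := tendsto_nhds_unique hlim hlim2
  rw [← this, Ssum_zero, kap_integral (by omega) hn hN]
  rw [hβ]
  have := betaN_pos (p + 1) N
  unfold betaN at this ⊢
  field_simp
  simp

end rep2

section pot
variable {n : ℕ}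

/-- The normalized logarithmic kernel. -/
noncomputable def lk (x y : EuclideanSpace ℝ (Fin n)) : ℝ := Real.log (max 1 ‖y‖ / ‖y - x‖)

/-- The logarithmic potential. -/
noncomputable def Epot (f : EuclideanSpace ℝ (Fin n) → ℝ) (x : EuclideanSpace ℝ (Fin n)) : ℝ :=
  ∫ y, lk x y * f y

theorem lk_bound (x y : EuclideanSpace ℝ (Fin n)) (hxy : 0 < ‖y - x‖) :
    |lk x y| ≤ (1 + ‖x‖) * (‖y - x‖⁻¹ + 1) := by
  have h1 : ‖y‖ ≤ ‖y - x‖ + ‖x‖ := by simpa using norm_add_le (y - x) x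
  have h2 : ‖y - x‖ ≤ ‖y‖ + ‖x‖ := norm_sub_le y x
  have hm : 0 < max 1 ‖y‖ := by positivity
  have hm1 : 1 ≤ max 1 ‖y‖ := le_max_left _ _
  have hm2 : ‖y‖ ≤ max 1 ‖y‖ := le_max_right _ _
  have hx := norm_nonneg x
  have hinv : 0 < ‖y - x‖⁻¹ := inv_pos.mpr hxy
  unfold lk
  rw [abs_le]
  constructor
  · have := Real.log_le_sub_one_of_pos (div_pos hxy hm)
    rw [← inv_div, Real.log_inv]
    have h3 : ‖y - x‖ / max 1 ‖y‖ ≤ 1 + ‖x‖ := by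
      rw [div_le_iff₀ hm]; nlinarith
    nlinarith
  · have := Real.log_le_sub_one_of_pos (div_pos hm hxy)
    have h3 : max 1 ‖y‖ ≤ 1 + ‖x‖ + ‖y - x‖ := max_le (by linarith) (by linarith)
    have h4 : max 1 ‖y‖ / ‖y - x‖ ≤ (1 + ‖x‖) * ‖y - x‖⁻¹ + 1 := by
      rw [div_le_iff₀ hxy]
      have : ((1 + ‖x‖) * ‖y - x‖⁻¹ + 1) * ‖y - x‖ = (1 + ‖x‖) + ‖y - x‖ := by field_simp
      rw [this]; exact h3
    nlinarith

theorem norm_sub_ae_pos (hn : 2 ≤ n) (x : EuclideanSpace ℝ (Fin n)) :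
    ∀ᵐ y : EuclideanSpace ℝ (Fin n), 0 < ‖y - x‖ := by
  have hne : Nonempty (Fin n) := ⟨⟨0, by omega⟩⟩
  filter_upwards [compl_mem_ae_iff.mpr (measure_singleton x)] with z hz
  exact norm_pos_iff.mpr (sub_ne_zero.mpr hz)

theorem lk_measurable (x : EuclideanSpace ℝ (Fin n)) : Measurable (lk x) := by
  unfold lk
  fun_prop

theorem sing_int' (hn : 2 ≤ n) {f : EuclideanSpace ℝ (Fin n) → ℝ} (hc : Continuous f)
    (hi : Integrable f) (x : EuclideanSpace ℝ (Fin n)) :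
    Integrable (fun y => ‖y - x‖⁻¹ * f y) := by
  have := (sing_int hn hc hi x).comp_sub_right x
  simpa using this

theorem lk_int (hn : 2 ≤ n) {f : EuclideanSpace ℝ (Fin n) → ℝ} (hc : Continuous f)
    (hi : Integrable f) (x : EuclideanSpace ℝ (Fin n)) : Integrable (fun y => lk x y * f y) := by
  refine Integrable.mono' (((sing_int' hn hc hi x).norm.add hi.norm).const_mul (1 + ‖x‖))
    ((lk_measurable x).mul hc.measurable).aestronglyMeasurable ?_
  filter_upwards [norm_sub_ae_pos hn x] with y hy
  have := lk_bound x y hy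
  simp only [Pi.add_apply, norm_mul, norm_inv, norm_norm]
  rw [Real.norm_eq_abs (lk x y)]
  calc |lk x y| * ‖f y‖ ≤ (1 + ‖x‖) * (‖y - x‖⁻¹ + 1) * ‖f y‖ := by gcongr
    _ = _ := by ring

theorem Fpot_eq (M : ℕ) (f : EuclideanSpace ℝ (Fin n) → ℝ) (x : EuclideanSpace ℝ (Fin n)) (R : ℝ) :
    Fpot M f x R = ∫ y, kk M (‖y - x‖ / R) * f y := by
  unfold Fpot
  rw [← integral_sub_right_eq_self _ x]
  simp

theorem kk_int' {M : ℕ} (hM : 1 ≤ M) (hn : 2 ≤ n) {f : EuclideanSpace ℝ (Fin n) → ℝ} (hc : Continuous f)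
    (hi : Integrable f) (x : EuclideanSpace ℝ (Fin n)) {R : ℝ} (hR : 0 < R) :
    Integrable (fun y => kk M (‖y - x‖ / R) * f y) := by
  have := (kk_int hM hn hc hi x hR).comp_sub_right x
  simpa using this

theorem Fpot_Epot_diff {M : ℕ} (hM : 1 ≤ M) (hn : 2 ≤ n) {f : EuclideanSpace ℝ (Fin n) → ℝ} (hc : Continuous f)
    (hi : Integrable f) (x x' : EuclideanSpace ℝ (Fin n)) {R : ℝ} (hR : 0 < R) :
    |(Fpot M f x R - Epot f x) - (Fpot M f x' R - Epot f x')| ≤ M * ‖x - x'‖ / R * ∫ y, ‖f y‖ := by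
  have i1 := kk_int' hM hn hc hi x hR
  have i2 := kk_int' hM hn hc hi x' hR
  have i3 := lk_int hn hc hi x
  have i4 := lk_int hn hc hi x'
  rw [Fpot_eq, Fpot_eq]
  unfold Epot
  have i5 : Integrable (fun y => kk M (‖y - x‖ / R) * f y - lk x y * f y) := i1.sub i3
  have i6 : Integrable (fun y => kk M (‖y - x'‖ / R) * f y - lk x' y * f y) := i2.sub i4
  rw [← integral_sub i1 i3, ← integral_sub i2 i4, ← integral_sub i5 i6,
    ← integral_const_mul, ← Real.norm_eq_abs]
  apply norm_integral_le_of_norm_le (hi.norm.const_mul _)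
  filter_upwards [norm_sub_ae_pos hn x, norm_sub_ae_pos hn x'] with y hy hy'
  have hm : 0 < max 1 ‖y‖ := by positivity
  have h := kk_log_lip M hM (div_pos hy hR) (div_pos hy' hR)
  have e : kk M (‖y - x‖ / R) * f y - lk x y * f y - (kk M (‖y - x'‖ / R) * f y - lk x' y * f y) =
    ((kk M (‖y - x‖ / R) + Real.log (‖y - x‖ / R)) - (kk M (‖y - x'‖ / R) + Real.log (‖y - x'‖ / R))) * f y := by
    unfold lk
    rw [Real.log_div hm.ne' hy.ne', Real.log_div hm.ne' hy'.ne', Real.log_div hy.ne' hR.ne',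
      Real.log_div hy'.ne' hR.ne']
    ring
  rw [e, norm_mul, Real.norm_eq_abs]
  refine mul_le_mul_of_nonneg_right (h.trans ?_) (norm_nonneg _)
  rw [← sub_div, abs_div, abs_of_pos hR, mul_div_assoc]
  gcongr
  have := abs_norm_sub_norm_le (y - x) (y - x')
  rw [show (y - x) - (y - x') = x' - x by abel, norm_sub_rev x' x] at this
  exact this

/-- The remainder function. -/
noncomputable def hfun (u f : EuclideanSpace ℝ (Fin n) → ℝ) (x : EuclideanSpace ℝ (Fin n)) : ℝ :=
  u x - Epot f x / cconst n

theorem hfun_diff {m : ℕ} (hm : 1 ≤ m) (hn : n = 2 * m) {u f : EuclideanSpace ℝ (Fin n) → ℝ}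
    (hu : ContDiff ℝ (⊤ : ℕ∞) u) (hPDE : ∀ x, negLapIter m u x = 2 * f x)
    (hc : Continuous f) (hi : Integrable f) {N : ℕ} (hN : 1 ≤ N) (x x' : EuclideanSpace ℝ (Fin n))
    {R : ℝ} (hR : 0 < R) :
    |(hfun u f x - hfun u f x') - (Ssum N m u x R - Ssum N m u x' R) / betaN m N| ≤
      ((N + m : ℕ) : ℝ) * ‖x - x'‖ / R * (∫ y, ‖f y‖) / cconst n := by
  have h1 := rep_formula hm hn hu hPDE hc hi hN x hR
  have h2 := rep_formula hm hn hu hPDE hc hi hN x' hR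
  have h3 := Fpot_Epot_diff (M := N + m) (by omega) (by omega) hc hi x x' hR
  have hc0 := cconst_pos n
  have e : (hfun u f x - hfun u f x') - (Ssum N m u x R - Ssum N m u x' R) / betaN m N =
    ((Fpot (N + m) f x R - Epot f x) - (Fpot (N + m) f x' R - Epot f x')) / cconst n := by
    unfold hfun
    rw [h1, h2]; ring
  rw [e, abs_div, abs_of_pos hc0]
  gcongr

theorem kernel_continuous {P w : EuclideanSpace ℝ (Fin n) → ℝ} (hP : Continuous P)
    (hP0 : ∀ y, 1 ≤ ‖y‖ → P y = 0) (hw : Continuous w) (r : ℝ) :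
    Continuous fun x => ∫ y, P y * w (x + r • y) := by
  have : (fun x => ∫ y, P y * w (x + r • y)) = fun x => ∫ y in closedBall 0 1, P y * w (x + r • y) := by
    funext x
    rw [setIntegral_eq_integral_of_forall_compl_eq_zero]
    intro y hy
    rw [hP0 y, zero_mul]
    simp at hy
    exact hy.le
  rw [this]
  apply continuous_parametric_integral_of_continuous _ (isCompact_closedBall _ _)
  fun_prop

theorem hfun_continuous {m : ℕ} (hm : 1 ≤ m) (hn : n = 2 * m) {u f : EuclideanSpace ℝ (Fin n) → ℝ}
    (hu : ContDiff ℝ (⊤ : ℕ∞) u) (hPDE : ∀ x, negLapIter m u x = 2 * f x)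
    (hc : Continuous f) (hi : Integrable f) : Continuous (hfun u f) := by
  obtain ⟨P, hP1, hP2, hP3⟩ := Ssum_kernel (n := n) 0 (m + 1) m (by omega)
  have hS : Continuous fun x => Ssum (m + 1) m u x 1 := by
    have := kernel_continuous hP1.continuous hP2 hu.continuous 1
    simpa only [← hP3 u hu] using this
  rw [continuous_iff_continuousAt]
  intro x'
  rw [ContinuousAt, tendsto_iff_norm_sub_tendsto_zero]
  have hb : ∀ x, ‖hfun u f x - hfun u f x'‖ ≤
      |(Ssum (m + 1) m u x 1 - Ssum (m + 1) m u x' 1) / betaN m (m + 1)| +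
      ((m + 1 + m : ℕ) : ℝ) * ‖x - x'‖ / 1 * (∫ y, ‖f y‖) / cconst n := by
    intro x
    have := hfun_diff hm hn hu hPDE hc hi (N := m + 1) (by omega) x x' one_pos
    rw [Real.norm_eq_abs]
    have h2 := abs_add_le (hfun u f x - hfun u f x' - (Ssum (m + 1) m u x 1 - Ssum (m + 1) m u x' 1) / betaN m (m + 1))
      ((Ssum (m + 1) m u x 1 - Ssum (m + 1) m u x' 1) / betaN m (m + 1))
    rw [sub_add_cancel] at h2
    linarith
  refine squeeze_zero (fun _ => norm_nonneg _) hb ?_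
  have hcont : Continuous fun x => |(Ssum (m + 1) m u x 1 - Ssum (m + 1) m u x' 1) / betaN m (m + 1)| +
      ((m + 1 + m : ℕ) : ℝ) * ‖x - x'‖ / 1 * (∫ y, ‖f y‖) / cconst n := by fun_prop
  simpa using hcont.tendsto x'

theorem hfun_limit {m : ℕ} (hm : 1 ≤ m) (hn : n = 2 * m) {u f : EuclideanSpace ℝ (Fin n) → ℝ}
    (hu : ContDiff ℝ (⊤ : ℕ∞) u) (hPDE : ∀ x, negLapIter m u x = 2 * f x)
    (hc : Continuous f) (hi : Integrable f) {N : ℕ} (hN : 1 ≤ N) (x x' : EuclideanSpace ℝ (Fin n)) :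
    Tendsto (fun R => (Ssum N m u x R - Ssum N m u x' R) / betaN m N) atTop
      (𝓝 (hfun u f x - hfun u f x')) := by
  rw [tendsto_iff_norm_sub_tendsto_zero]
  refine squeeze_zero' (g := fun R => (((N + m : ℕ) : ℝ) * ‖x - x'‖ * (∫ y, ‖f y‖) / cconst n) / R)
    (Eventually.of_forall fun _ => norm_nonneg _) ?_ (tendsto_const_nhds.div_atTop tendsto_id)
  filter_upwards [eventually_gt_atTop 0] with R hR
  have := hfun_diff hm hn hu hPDE hc hi hN x x' hR
  rw [Real.norm_eq_abs, abs_sub_comm]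
  refine this.trans_eq ?_
  ring

end pot

section interp
variable {n : ℕ}

/-- Lagrange basis at the nodes `0, …, D-1`. -/
noncomputable def lagP (D j : ℕ) : Polynomial ℝ :=
  Lagrange.basis (Finset.range D) (fun i : ℕ => (i : ℝ)) j

theorem nodes_inj (D : ℕ) : Set.InjOn (fun i : ℕ => (i : ℝ)) (Finset.range D) :=
  Nat.cast_injective.injOn

theorem lag_exact {D : ℕ} {p : Polynomial ℝ} (hp : p.degree < D) (t : ℝ) :
    p.eval t = ∑ j ∈ Finset.range D, (lagP D j).eval t * p.eval (j : ℝ) := by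
  have h := Lagrange.eq_interpolate (s := Finset.range D) (v := fun i : ℕ => (i : ℝ)) (f := p)
    (nodes_inj D) (by simpa using hp)
  conv_lhs => rw [h]
  rw [Lagrange.interpolate_apply, Polynomial.eval_finsetSum]
  refine Finset.sum_congr rfl fun j _ => ?_
  rw [Polynomial.eval_mul, Polynomial.eval_C, mul_comm]
  rfl

theorem interp_bound (d : ℕ) (t : ℝ) : ∃ C : ℝ, 0 ≤ C ∧ ∀ φ : ℝ → ℝ, ContDiff ℝ ((d + 1 : ℕ) : WithTop ℕ∞) φ →
    ∀ K : ℝ, (∀ s, |iteratedDeriv (d + 1) φ s| ≤ K) →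
    |φ t - ∑ j ∈ Finset.range (d + 1), (lagP (d + 1) j).eval t * φ j| ≤ C * K := by
  set T : ℝ := |t| + d + 1 with hT
  have hT0 : 0 < T := by positivity
  set B : ℝ := (2 * T) ^ (d + 1) / d.factorial with hB
  have hB0 : 0 ≤ B := by positivity
  refine ⟨B + ∑ j ∈ Finset.range (d + 1), |(lagP (d + 1) j).eval t| * B, by positivity, ?_⟩
  intro φ hφ K hK
  have hK0 : 0 ≤ K := (abs_nonneg _).trans (hK 0)
  have hTT : -T < T := by linarith
  have htay : ∀ s ∈ Set.Icc (-T) T, |φ s - taylorWithinEval φ d (Set.Icc (-T) T) (-T) s| ≤ B * K := by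
    intro s hs
    have h := taylor_mean_remainder_bound (n := d) (C := K) hTT.le
      (by exact_mod_cast hφ.contDiffOn) hs (fun y hy => by
        rw [iteratedDerivWithin_eq_iteratedDeriv (uniqueDiffOn_Icc hTT) hφ.contDiffAt hy]
        exact hK y)
    refine h.trans ?_
    rw [hB, div_mul_eq_mul_div, mul_comm]
    have : 0 ≤ s - -T := by linarith [hs.1]
    gcongr
    linarith [hs.2]
  set p : Polynomial ℝ := ∑ k ∈ Finset.range (d + 1),
    Polynomial.C ((k.factorial : ℝ)⁻¹ * iteratedDerivWithin k φ (Set.Icc (-T) T) (-T)) *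
      (Polynomial.X - Polynomial.C (-T)) ^ k with hp
  have hpe : ∀ s, taylorWithinEval φ d (Set.Icc (-T) T) (-T) s = p.eval s := by
    intro s
    rw [taylor_within_apply, hp, Polynomial.eval_finsetSum]
    refine Finset.sum_congr rfl fun k _ => ?_
    simp only [Polynomial.eval_mul, Polynomial.eval_C, Polynomial.eval_pow, Polynomial.eval_sub,
      Polynomial.eval_X, smul_eq_mul]
    ring
  have hpd : p.degree < ((d + 1 : ℕ) : WithBot ℕ) := by
    rw [← Polynomial.mem_degreeLT]
    refine Submodule.sum_mem _ fun k hk => ?_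
    rw [Polynomial.mem_degreeLT]
    refine lt_of_le_of_lt ((Polynomial.degree_mul_le _ _).trans (add_le_add Polynomial.degree_C_le le_rfl)) ?_
    rw [zero_add, Polynomial.degree_pow, Polynomial.degree_X_sub_C]
    simp only [nsmul_eq_mul, mul_one]
    exact_mod_cast Finset.mem_range.mp hk
  have hex := lag_exact hpd t
  have e : φ t - ∑ j ∈ Finset.range (d + 1), (lagP (d + 1) j).eval t * φ j =
      (φ t - p.eval t) - ∑ j ∈ Finset.range (d + 1), (lagP (d + 1) j).eval t * (φ j - p.eval (j : ℝ)) := by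
    simp only [mul_sub, Finset.sum_sub_distrib]
    rw [← hex]; ring
  rw [e, add_mul, Finset.sum_mul]
  refine (abs_sub _ _).trans (add_le_add ?_ ((Finset.abs_sum_le_sum_abs _ _).trans (Finset.sum_le_sum fun j hj => ?_)))
  · rw [← hpe]
    refine htay t ⟨?_, ?_⟩
    · have := neg_abs_le t
      have : (0:ℝ) ≤ d := by positivity
      linarith
    · have := le_abs_self t
      have : (0:ℝ) ≤ d := by positivity
      linarith
  · rw [abs_mul, mul_assoc, ← hpe]
    gcongr
    refine htay j ⟨?_, ?_⟩
    · have : (0:ℝ) ≤ j := by positivity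
      linarith
    · have : (j:ℝ) ≤ d := by exact_mod_cast Nat.lt_succ_iff.mp (Finset.mem_range.mp hj)
      have := abs_nonneg t
      linarith

theorem kernel_interp (d : ℕ) {P : EuclideanSpace ℝ (Fin n) → ℝ} (hP : ContDiff ℝ ((d + 1 : ℕ) : WithTop ℕ∞) P)
    (hP0 : ∀ y, 1 ≤ ‖y‖ → P y = 0) (t : ℝ) : ∃ C : ℝ, 0 ≤ C ∧ ∀ z ξ : EuclideanSpace ℝ (Fin n),
    |P (z - t • ξ) - ∑ j ∈ Finset.range (d + 1), (lagP (d + 1) j).eval t * P (z - (j : ℝ) • ξ)| ≤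
      C * ‖ξ‖ ^ (d + 1) := by
  obtain ⟨C, hC0, hC⟩ := interp_bound d t
  obtain ⟨K, hK⟩ := ((compactSupport_of_zero hP0).iteratedFDeriv (𝕜 := ℝ) (d + 1)).exists_bound_of_continuous
    (hP.continuous_iteratedFDeriv le_rfl)
  have hK0 : 0 ≤ K := (norm_nonneg _).trans (hK 0)
  refine ⟨C * K, by positivity, fun z ξ => ?_⟩
  have h := hC (fun s => P (z - s • ξ)) (hP.comp (by fun_prop)) (K * ‖ξ‖ ^ (d + 1)) ?_
  · refine h.trans_eq (by ring)
  intro s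
  rw [← Real.norm_eq_abs, ← norm_iteratedFDeriv_eq_norm_iteratedDeriv]
  set L : ℝ →L[ℝ] EuclideanSpace ℝ (Fin n) := -(ContinuousLinearMap.toSpanSingleton ℝ ξ) with hL
  have e : (fun s : ℝ => P (z - s • ξ)) = (fun y => P (z + y)) ∘ L := by
    funext s
    simp [hL, sub_eq_add_neg]
  have hsm : ContDiff ℝ ((d + 1 : ℕ) : WithTop ℕ∞) (fun y => P (z + y)) := hP.comp (by fun_prop)
  rw [e, L.iteratedFDeriv_comp_right hsm s le_rfl]
  refine (ContinuousMultilinearMap.norm_compContinuousLinearMap_le _ _).trans ?_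
  rw [iteratedFDeriv_comp_add_left]
  simp only [Finset.prod_const, Finset.card_univ, Fintype.card_fin]
  gcongr
  · exact hK _
  · rw [hL, norm_neg, ContinuousLinearMap.norm_toSpanSingleton]

end interp

section growth
variable {n : ℕ}

theorem smul_mean_bound (j : ℕ) {g : EuclideanSpace ℝ (Fin n) → ℝ} (hg : Integrable g)
    (hg0 : ∀ y, 0 ≤ g y) {r : ℝ} (hr : 1 ≤ r) :
    Integrable (fun y => kap j y * g (r • y)) ∧ ∫ y, kap j y * g (r • y) ≤ ∫ y, g y := by
  have hr0 : 0 < r := by linarith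
  have hi : Integrable (fun y => g (r • y)) := hg.comp_smul hr0.ne'
  have hi2 : Integrable (fun y => kap j y * g (r • y)) := by
    refine hi.mono' ((kap_continuous j).aestronglyMeasurable.mul hi.1) (ae_of_all _ fun y => ?_)
    rw [norm_mul, Real.norm_of_nonneg (kap_nonneg _ _), Real.norm_of_nonneg (hg0 _)]
    exact mul_le_of_le_one_left (hg0 _) (kap_le_one _ _)
  refine ⟨hi2, ?_⟩
  calc ∫ y, kap j y * g (r • y) ≤ ∫ y, g (r • y) := by
        refine integral_mono hi2 hi fun y => mul_le_of_le_one_left (hg0 _) (kap_le_one _ _)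
    _ = |(r ^ Module.finrank ℝ (EuclideanSpace ℝ (Fin n)))⁻¹| * ∫ y, g y := by
        rw [Measure.integral_comp_smul]; rfl
    _ ≤ 1 * ∫ y, g y := by
        gcongr
        · exact integral_nonneg hg0
        · rw [abs_of_nonneg (by positivity)]
          exact inv_le_one_of_one_le₀ (one_le_pow₀ hr)
    _ = _ := one_mul _

theorem Ak_top_bound {m N : ℕ} (hN : 1 ≤ N) {u : EuclideanSpace ℝ (Fin n) → ℝ}
    (hu : ContDiff ℝ (⊤ : ℕ∞) u) (hi : Integrable (negLapIter m u)) :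
    ∃ C : ℝ, ∀ r, 0 ≤ r → |Ak N m u 0 r| ≤ C := by
  have hcont : Continuous (Ak N m u 0) := by
    rw [continuous_iff_continuousAt]
    exact fun r => (Ak_hasDerivAt hN m hu 0 r).continuousAt
  obtain ⟨C1, hC1⟩ := (isCompact_Icc (a := (0:ℝ)) (b := 1)).exists_bound_of_continuousOn hcont.continuousOn
  refine ⟨max C1 (((N.factorial : ℝ) / (N + m).factorial) * ∫ y, ‖negLapIter m u y‖), fun r hr => ?_⟩
  rcases le_total r 1 with h | h
  · exact (hC1 r ⟨hr, h⟩).trans (le_max_left _ _)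
  · refine le_trans ?_ (le_max_right _ _)
    unfold Ak
    rw [abs_mul, abs_of_nonneg (by positivity)]
    gcongr
    have h2 := smul_mean_bound (N + m) hi.norm (fun y => norm_nonneg _) h
    unfold Imean
    rw [← Real.norm_eq_abs]
    refine (norm_integral_le_integral_norm _).trans (le_trans (le_of_eq ?_) h2.2)
    congr 1; ext y
    rw [norm_mul, Real.norm_of_nonneg (kap_nonneg _ _), zero_add]

theorem Ak_growth {m N : ℕ} (hN : 1 ≤ N) {u : EuclideanSpace ℝ (Fin n) → ℝ}
    (hu : ContDiff ℝ (⊤ : ℕ∞) u) (hi : Integrable (negLapIter m u)) (i : ℕ) :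
    ∀ k, k + i = m → ∃ C : ℝ, 0 ≤ C ∧ ∀ r, 0 ≤ r → |Ak N k u 0 r| ≤ C * (1 + r) ^ (2 * i) := by
  induction i with
  | zero =>
    intro k hk
    obtain rfl : k = m := by omega
    obtain ⟨C, hC⟩ := Ak_top_bound hN hu hi
    exact ⟨C, (abs_nonneg _).trans (hC 0 le_rfl), fun r hr => by simpa using hC r hr⟩
  | succ i ih =>
    intro k hk
    obtain ⟨C, hC0, hC⟩ := ih (k + 1) (by omega)
    refine ⟨|Ak N k u 0 0| + C, by positivity, fun r hr => ?_⟩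
    have h := norm_image_sub_le_of_norm_deriv_le_segment' (f := Ak N k u 0) (a := 0) (b := r)
      (C := (r / 2) * (C * (1 + r) ^ (2 * i)))
      (fun x _ => (Ak_hasDerivAt hN k hu 0 x).hasDerivWithinAt) ?_ r ⟨hr, le_rfl⟩
    · have h1 : |Ak N k u 0 r| ≤ |Ak N k u 0 0| + (r / 2) * (C * (1 + r) ^ (2 * i)) * (r - 0) := by
        have := abs_add_le (Ak N k u 0 r - Ak N k u 0 0) (Ak N k u 0 0)
        rw [sub_add_cancel] at this
        rw [Real.norm_eq_abs] at h
        linarith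
      refine h1.trans ?_
      have e : (1 + r) ^ (2 * (i + 1)) = (1 + r) ^ (2 * i) * (1 + r) ^ 2 := by ring
      have h3 : 1 ≤ (1 + r) ^ (2 * (i + 1)) := one_le_pow₀ (by linarith)
      have h4 : (r / 2) * (C * (1 + r) ^ (2 * i)) * (r - 0) ≤ C * (1 + r) ^ (2 * (i + 1)) := by
        rw [e]
        have : (r / 2) * (C * (1 + r) ^ (2 * i)) * (r - 0) = C * ((1 + r) ^ (2 * i) * (r ^ 2 / 2)) := by ring
        rw [this]
        gcongr
        nlinarith
      nlinarith [abs_nonneg (Ak N k u 0 0)]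
    · intro s hs
      rw [norm_mul, norm_neg, Real.norm_of_nonneg (by linarith [hs.1]), Real.norm_eq_abs]
      have := hC s hs.1
      have h0 := hs.1
      have h1 := hs.2.le
      calc _ ≤ (r / 2) * (C * (1 + s) ^ (2 * i)) := by gcongr
        _ ≤ _ := by gcongr

theorem abs_growth {m : ℕ} (hm : 1 ≤ m) (hn : n = 2 * m) {u : EuclideanSpace ℝ (Fin n) → ℝ}
    (hu : ContDiff ℝ (⊤ : ℕ∞) u) (hi : Integrable (negLapIter m u))
    (hexp : Integrable fun x => Real.exp (n * u x - ‖x‖ ^ 2)) :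
    ∃ C : ℝ, 0 ≤ C ∧ ∀ r, 1 ≤ r → ∫ y, kap 1 y * |u (r • y)| ≤ C * r ^ (2 * m) := by
  obtain ⟨C, hC0, hC⟩ := Ak_growth (N := 1) le_rfl hu hi m 0 (by omega)
  set I := ∫ x, Real.exp (n * u x - ‖x‖ ^ 2) with hI
  have hI0 : 0 ≤ I := integral_nonneg fun _ => (Real.exp_pos _).le
  set β := ∫ y : EuclideanSpace ℝ (Fin n), kap 1 y with hβ
  have hβ0 : 0 ≤ β := integral_nonneg fun _ => kap_nonneg _ _
  have hkc : HasCompactSupport (kap 1 : EuclideanSpace ℝ (Fin n) → ℝ) := kap_compactSupport le_rfl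
  refine ⟨2 * (I + β) + C * 2 ^ (2 * m), by positivity, fun r hr => ?_⟩
  have hr0 : 0 < r := by linarith
  obtain ⟨h1, h2⟩ := smul_mean_bound 1 hexp (fun y => (Real.exp_pos _).le) hr
  have hk := kap_continuous (n := n) 1
  have hrr : Continuous fun y : EuclideanSpace ℝ (Fin n) => u (r • y) := hu.continuous.comp (by fun_prop)
  have j1 : Integrable fun y : EuclideanSpace ℝ (Fin n) => kap 1 y * u (r • y) :=
    (hk.mul hrr).integrable_of_hasCompactSupport hkc.mul_right
  have j2 : Integrable fun y : EuclideanSpace ℝ (Fin n) => kap 1 y * |u (r • y)| :=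
    (hk.mul hrr.abs).integrable_of_hasCompactSupport hkc.mul_right
  have j3 : Integrable fun y : EuclideanSpace ℝ (Fin n) => kap 1 y :=
    hk.integrable_of_hasCompactSupport hkc
  have key : ∀ y : EuclideanSpace ℝ (Fin n), kap 1 y * |u (r • y)| ≤
      2 * (kap 1 y * Real.exp (n * u (r • y) - ‖r • y‖ ^ 2)) + 2 * r ^ 2 * kap 1 y - kap 1 y * u (r • y) := by
    intro y
    have hk0 := kap_nonneg (n := n) 1 y
    rcases le_total 1 ‖y‖ with hy | hy
    · rw [kap_zero_of_one_le le_rfl hy]; simp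
    · have hx : ‖r • y‖ ^ 2 ≤ r ^ 2 := by
        rw [norm_smul, Real.norm_of_nonneg hr0.le, mul_pow]
        have : ‖y‖ ^ 2 ≤ 1 := pow_le_one₀ (norm_nonneg _) hy
        nlinarith [sq_nonneg r]
      have hn1 : (1:ℝ) ≤ n := by exact_mod_cast (by omega : 1 ≤ n)
      have he := Real.add_one_le_exp (n * u (r • y) - ‖r • y‖ ^ 2)
      have hep := Real.exp_pos (n * u (r • y) - ‖r • y‖ ^ 2)
      have : |u (r • y)| ≤ 2 * Real.exp (n * u (r • y) - ‖r • y‖ ^ 2) + 2 * r ^ 2 - u (r • y) := by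
        rcases abs_cases (u (r • y)) with ⟨h, h'⟩ | ⟨h, h'⟩
        · rw [h]; nlinarith
        · rw [h]; nlinarith [sq_nonneg r]
      nlinarith
  have hA : Ak 1 0 u 0 r = ∫ y, kap 1 y * u (r • y) := by
    simp [Ak, Imean, negLapIter]
  have hA2 := hC r hr0.le
  rw [hA] at hA2
  have h3 : ∫ y, kap 1 y * |u (r • y)| ≤ 2 * I + 2 * r ^ 2 * β - ∫ y, kap 1 y * u (r • y) := by
    have h4 := integral_mono j2 (((h1.const_mul 2).add (j3.const_mul (2 * r ^ 2))).sub j1) key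
    have h5 : ∫ y, (2 * (kap 1 y * Real.exp (n * u (r • y) - ‖r • y‖ ^ 2)) + 2 * r ^ 2 * kap 1 y - kap 1 y * u (r • y)) =
        2 * (∫ y, (kap 1 y * Real.exp (n * u (r • y) - ‖r • y‖ ^ 2))) + 2 * r ^ 2 * β - ∫ y, kap 1 y * u (r • y) := by
      have j4 : Integrable fun y : EuclideanSpace ℝ (Fin n) =>
          2 * (kap 1 y * Real.exp (n * u (r • y) - ‖r • y‖ ^ 2)) + 2 * r ^ 2 * kap 1 y :=
        (h1.const_mul 2).add (j3.const_mul (2 * r ^ 2))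
      rw [integral_sub j4 j1, integral_add (h1.const_mul 2) (j3.const_mul (2 * r ^ 2)), integral_const_mul, integral_const_mul]
    refine h4.trans ?_
    refine (le_of_eq h5).trans ?_
    linarith
  have h6 : (1 + r) ^ (2 * m) ≤ 2 ^ (2 * m) * r ^ (2 * m) := by
    rw [← mul_pow]; gcongr; linarith
  have h7 : r ^ 2 ≤ r ^ (2 * m) := pow_le_pow_right₀ hr (by omega)
  have h8 : 1 ≤ r ^ (2 * m) := one_le_pow₀ hr
  have h9 := neg_abs_le (∫ y, kap 1 y * u (r • y))
  calc _ ≤ 2 * I + 2 * r ^ 2 * β + C * (1 + r) ^ (2 * m) := by linarith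
    _ ≤ 2 * I * r ^ (2 * m) + 2 * r ^ (2 * m) * β + C * (2 ^ (2 * m) * r ^ (2 * m)) := by
        have : 2 * I ≤ 2 * I * r ^ (2 * m) := le_mul_of_one_le_right (by positivity) h8
        gcongr
    _ = _ := by ring

theorem ball_growth {m : ℕ} (hm : 1 ≤ m) (hn : n = 2 * m) {u : EuclideanSpace ℝ (Fin n) → ℝ}
    (hu : ContDiff ℝ (⊤ : ℕ∞) u) (hi : Integrable (negLapIter m u))
    (hexp : Integrable fun x => Real.exp (n * u x - ‖x‖ ^ 2)) :
    ∃ C : ℝ, 0 ≤ C ∧ ∀ r, 1 ≤ r → ∫ y in closedBall 0 2, |u (r • y)| ≤ C * r ^ (2 * m) := by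
  obtain ⟨C, hC0, hC⟩ := abs_growth hm hn hu hi hexp
  refine ⟨4 ^ n * 2 * (C * 4 ^ (2 * m)), by positivity, fun r hr => ?_⟩
  have h := hC (4 * r) (by linarith)
  have hkc : HasCompactSupport (kap 1 : EuclideanSpace ℝ (Fin n) → ℝ) := kap_compactSupport le_rfl
  set g : EuclideanSpace ℝ (Fin n) → ℝ := fun z => kap 1 ((4:ℝ)⁻¹ • z) * |u (r • z)| with hg
  have hgc : Continuous g := by
    have h1 : Continuous fun z : EuclideanSpace ℝ (Fin n) => kap 1 ((4:ℝ)⁻¹ • z) := (kap_continuous 1).comp (by fun_prop)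
    have h2 : Continuous fun z : EuclideanSpace ℝ (Fin n) => u (r • z) := hu.continuous.comp (by fun_prop)
    exact h1.mul h2.abs
  have hgi : Integrable g := by
    refine hgc.integrable_of_hasCompactSupport (HasCompactSupport.mul_right ?_)
    exact hkc.comp_smul (c := (4:ℝ)⁻¹) (by norm_num)
  have e := Measure.integral_comp_smul (volume : Measure (EuclideanSpace ℝ (Fin n))) g 4
  have e1 : (fun x => g ((4:ℝ) • x)) = fun y => kap 1 y * |u ((4 * r) • y)| := by
    funext y
    simp only [hg, smul_smul]
    norm_num
    left
    rw [mul_comm]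
  rw [e1, finrank_euclideanSpace_fin, abs_of_nonneg (by positivity)] at e
  have e2 : ∫ z, g z = 4 ^ n * ∫ y, kap 1 y * |u ((4 * r) • y)| := by
    rw [e]; simp
  have hg0 : ∀ z, 0 ≤ g z := fun z => mul_nonneg (kap_nonneg _ _) (abs_nonneg _)
  have h3 : ∫ y in closedBall 0 2, |u (r • y)| ≤ ∫ y in closedBall 0 2, 2 * g y := by
    refine setIntegral_mono_on ?_ (hgi.const_mul 2).integrableOn measurableSet_closedBall ?_
    · have h2 : Continuous fun z : EuclideanSpace ℝ (Fin n) => u (r • z) := hu.continuous.comp (by fun_prop)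
      exact h2.abs.continuousOn.integrableOn_compact (isCompact_closedBall _ _)
    · intro y hy
      have hy : ‖y‖ ≤ 2 := by simpa using hy
      have : (1:ℝ) / 2 ≤ kap 1 ((4:ℝ)⁻¹ • y) := by
        unfold kap posPow
        rw [norm_smul]
        refine le_trans ?_ (pow_le_pow_left₀ (by norm_num; linarith) (le_max_left _ _) 1)
        norm_num
        have h0 := norm_nonneg y
        have : (1 / 4 * ‖y‖) ^ 2 ≤ (1 / 2) ^ 2 := by gcongr; linarith
        linarith
      simp only [hg]
      nlinarith [abs_nonneg (u (r • y))]
  have h4 : ∫ y in closedBall 0 2, 2 * g y ≤ ∫ y, 2 * g y :=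
    setIntegral_le_integral (hgi.const_mul 2) (ae_of_all _ fun y => by have := hg0 y; positivity)
  rw [integral_const_mul 2 (fun y => g y) (μ := volume), e2] at h4
  calc _ ≤ 2 * (4 ^ n * (C * (4 * r) ^ (2 * m))) := by
        refine h3.trans (h4.trans ?_); gcongr
    _ = _ := by rw [mul_pow]; ring

end growth

section hpoly
variable {n : ℕ}

theorem Ssum_shift {P w : EuclideanSpace ℝ (Fin n) → ℝ} (x : EuclideanSpace ℝ (Fin n)) {R : ℝ} (hR : 0 < R) (s : ℝ) :
    ∫ y, P y * w (s • x + R • y) = ∫ y, P (y - s • (R⁻¹ • x)) * w (R • y) := by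
  rw [← integral_sub_right_eq_self _ (s • (R⁻¹ • x))]
  congr 1; ext y
  congr 2
  rw [smul_sub, smul_comm R s, smul_inv_smul₀ hR.ne']
  abel

theorem Ssum_shift_int {P w : EuclideanSpace ℝ (Fin n) → ℝ} (hP : Continuous P)
    (hP0 : ∀ y, 1 ≤ ‖y‖ → P y = 0) (hw : Continuous w) (x : EuclideanSpace ℝ (Fin n)) {R : ℝ} (hR : 0 < R) (s : ℝ) :
    Integrable fun y => P (y - s • (R⁻¹ • x)) * w (R • y) := by
  have := (kernel_integrable hP hP0 hw (s • x) R).comp_sub_right (s • (R⁻¹ • x))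
  refine this.congr (ae_of_all _ fun y => ?_)
  simp only
  congr 2
  rw [smul_sub, smul_comm R s, smul_inv_smul₀ hR.ne']
  abel

theorem Ssum_interp {m : ℕ} (hm : 1 ≤ m) (hn : n = 2 * m) {u : EuclideanSpace ℝ (Fin n) → ℝ}
    (hu : ContDiff ℝ (⊤ : ℕ∞) u) (hi : Integrable (negLapIter m u))
    (hexp : Integrable fun x => Real.exp (n * u x - ‖x‖ ^ 2)) (x : EuclideanSpace ℝ (Fin n)) (t : ℝ) :
    Tendsto (fun R => Ssum (3 * m + 2) m u (t • x) R -
      ∑ j ∈ Finset.range (2 * m + 1), (lagP (2 * m + 1) j).eval t * Ssum (3 * m + 2) m u ((j : ℝ) • x) R)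
      atTop (𝓝 0) := by
  obtain ⟨P, hP1, hP2, hP3⟩ := Ssum_kernel (n := n) (2 * m + 1) (3 * m + 2) m (by omega)
  obtain ⟨C1, hC1, h1⟩ := ball_growth hm hn hu hi hexp
  obtain ⟨C2, hC2, h2⟩ := kernel_interp (2 * m) hP1 hP2 t
  rw [tendsto_zero_iff_norm_tendsto_zero]
  refine squeeze_zero' (g := fun R => (C2 * ‖x‖ ^ (2 * m + 1) * C1) / R) (Eventually.of_forall fun _ => norm_nonneg _) ?_
    (tendsto_const_nhds.div_atTop tendsto_id)
  filter_upwards [eventually_ge_atTop 1, eventually_ge_atTop ((|t| + (2 * m + 1)) * ‖x‖)] with R hR1 hR2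
  have hR : 0 < R := by linarith
  set ξ := R⁻¹ • x with hξ
  have hξn : ‖ξ‖ = ‖x‖ / R := by
    rw [hξ, norm_smul, norm_inv, Real.norm_of_nonneg hR.le]; field_simp
  have hξb : (|t| + (2 * m + 1)) * ‖ξ‖ ≤ 1 := by
    rw [hξn, ← mul_div_assoc, div_le_one hR]; exact hR2
  have hIntg : ∀ s : ℝ, Integrable fun y => P (y - s • ξ) * u (R • y) := fun s =>
    Ssum_shift_int hP1.continuous hP2 hu.continuous x hR s
  have hS : ∀ s : ℝ, Ssum (3 * m + 2) m u (s • x) R = ∫ y, P (y - s • ξ) * u (R • y) := fun s => by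
    rw [hP3 u hu, Ssum_shift x hR s]
  have e : Ssum (3 * m + 2) m u (t • x) R -
      ∑ j ∈ Finset.range (2 * m + 1), (lagP (2 * m + 1) j).eval t * Ssum (3 * m + 2) m u ((j : ℝ) • x) R =
      ∫ y, (P (y - t • ξ) - ∑ j ∈ Finset.range (2 * m + 1), (lagP (2 * m + 1) j).eval t * P (y - (j : ℝ) • ξ)) * u (R • y) := by
    simp_rw [hS, ← integral_const_mul]
    have hIntg' : ∀ j ∈ Finset.range (2 * m + 1), Integrable fun y =>
        (lagP (2 * m + 1) j).eval t * (P (y - (j : ℝ) • ξ) * u (R • y)) :=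
      fun j _ => (hIntg (j : ℝ)).const_mul _
    rw [← integral_finsetSum _ hIntg',
      ← integral_sub (hIntg t) (integrable_finsetSum _ hIntg')]
    congr 1; ext y
    rw [sub_mul, Finset.sum_mul]
    congr 1
    refine Finset.sum_congr rfl fun j _ => by ring
  have hz : ∀ s : ℝ, |s| ≤ |t| + (2 * m + 1) → ∀ y : EuclideanSpace ℝ (Fin n), 2 < ‖y‖ → P (y - s • ξ) = 0 := by
    intro s hs y hy
    apply hP2
    have h3 := norm_sub_norm_le y (s • ξ)
    have h4 : ‖s • ξ‖ ≤ 1 := by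
      rw [norm_smul, Real.norm_eq_abs]
      exact (mul_le_mul_of_nonneg_right hs (norm_nonneg _)).trans hξb
    linarith
  have hm0 : (0:ℝ) ≤ m := by positivity
  have hcu : Continuous fun y : EuclideanSpace ℝ (Fin n) => u (R • y) := hu.continuous.comp (by fun_prop)
  have hio : IntegrableOn (fun y : EuclideanSpace ℝ (Fin n) => |u (R • y)|) (closedBall 0 2) :=
    hcu.abs.continuousOn.integrableOn_compact (isCompact_closedBall _ _)
  rw [e, ← setIntegral_eq_integral_of_forall_compl_eq_zero (s := closedBall 0 2)]
  · calc _ ≤ ∫ y in closedBall 0 2, C2 * ‖ξ‖ ^ (2 * m + 1) * |u (R • y)| := by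
          apply norm_integral_le_of_norm_le (hio.const_mul _)
          refine ae_of_all _ fun y => ?_
          rw [norm_mul, Real.norm_eq_abs, Real.norm_eq_abs]
          exact mul_le_mul_of_nonneg_right (h2 y ξ) (abs_nonneg _)
      _ = C2 * ‖ξ‖ ^ (2 * m + 1) * ∫ y in closedBall 0 2, |u (R • y)| := by rw [integral_const_mul]
      _ ≤ C2 * ‖ξ‖ ^ (2 * m + 1) * (C1 * R ^ (2 * m)) := by
          gcongr
          exact h1 R hR1
      _ = _ := by
          rw [hξn, div_pow, pow_succ R]
          field_simp
  · intro y hy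
    have hy : 2 < ‖y‖ := by simpa using hy
    rw [hz t (by linarith) y hy, Finset.sum_eq_zero, sub_zero, zero_mul]
    intro j hj
    rw [hz j _ y hy, mul_zero]
    have : (j : ℝ) ≤ 2 * m := by exact_mod_cast Nat.lt_succ_iff.mp (Finset.mem_range.mp hj)
    rw [abs_of_nonneg (by positivity)]
    have := abs_nonneg t
    linarith

theorem hfun_poly {m : ℕ} (hm : 1 ≤ m) (hn : n = 2 * m) {u f : EuclideanSpace ℝ (Fin n) → ℝ}
    (hu : ContDiff ℝ (⊤ : ℕ∞) u) (hPDE : ∀ x, negLapIter m u x = 2 * f x)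
    (hc : Continuous f) (hi : Integrable f)
    (hexp : Integrable fun x => Real.exp (n * u x - ‖x‖ ^ 2)) :
    ∃ p : ℕ → EuclideanSpace ℝ (Fin n) → ℝ, (∀ k, Continuous (p k)) ∧
      ∀ x t, hfun u f (t • x) = ∑ k ∈ Finset.range (2 * m + 1), p k x * t ^ k := by
  have hi2 : Integrable (negLapIter m u) := by
    rw [show negLapIter m u = fun y => 2 * f y from funext hPDE]
    exact hi.const_mul 2
  set N := 3 * m + 2 with hN
  have hβ := betaN_pos m N
  have hkey : ∀ x t, hfun u f (t • x) =
      ∑ j ∈ Finset.range (2 * m + 1), (lagP (2 * m + 1) j).eval t * hfun u f ((j : ℝ) • x) := by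
    intro x t
    have hone : ∑ j ∈ Finset.range (2 * m + 1), (lagP (2 * m + 1) j).eval t = 1 := by
      have := lag_exact (D := 2 * m + 1) (p := 1) (by rw [Polynomial.degree_one]; exact_mod_cast Nat.succ_pos _) t
      simpa using this.symm
    have h1 := (Ssum_interp hm hn hu hi2 hexp x t).div_const (betaN m N)
    have h2 := (hfun_limit hm hn hu hPDE hc hi (N := N) (by omega) (t • x) 0).sub
      (tendsto_finsetSum (Finset.range (2 * m + 1)) fun j _ =>
        (hfun_limit hm hn hu hPDE hc hi (N := N) (by omega) ((j : ℝ) • x) 0).const_mul ((lagP (2 * m + 1) j).eval t))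
    have h3 := tendsto_nhds_unique (h1.congr fun R => ?_) h2
    · simp only [mul_sub, Finset.sum_sub_distrib, ← Finset.sum_mul, hone] at h3
      rw [zero_div] at h3
      linarith
    · simp only [mul_div_assoc', ← Finset.sum_div, mul_sub, Finset.sum_sub_distrib, ← Finset.sum_mul, hone]
      ring
  have hcont := hfun_continuous hm hn hu hPDE hc hi
  refine ⟨fun k x => ∑ j ∈ Finset.range (2 * m + 1), (lagP (2 * m + 1) j).coeff k * hfun u f ((j : ℝ) • x),
    fun k => ?_, fun x t => ?_⟩
  · refine continuous_finsetSum _ fun j _ => continuous_const.mul (hcont.comp (by fun_prop))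
  · rw [hkey x t]
    simp_rw [Finset.sum_mul]
    rw [Finset.sum_comm]
    refine Finset.sum_congr rfl fun j hj => ?_
    rw [Polynomial.eval_eq_sum_range' (n := 2 * m + 1), Finset.sum_mul]
    · refine Finset.sum_congr rfl fun k _ => by ring
    · have := Lagrange.degree_basis (nodes_inj (2 * m + 1)) hj
      rw [Finset.card_range] at this
      have h5 := Polynomial.natDegree_eq_of_degree_eq_some this
      unfold lagP
      omega

end hpoly

section
variable {n : ℕ}

instance sphereMeasure_finite : IsFiniteMeasure (sphereMeasure n) := by
  unfold sphereMeasure; infer_instance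

theorem polar_lintegral (hn : 2 ≤ n) {F : EuclideanSpace ℝ (Fin n) → ℝ≥0∞} (hF : Measurable F) :
    ∫⁻ x, F x = ∫⁻ θ, (∫⁻ r in Set.Ioi (0:ℝ),
      ENNReal.ofReal (r ^ (n - 1)) * F (r • (θ : EuclideanSpace ℝ (Fin n)))) ∂(sphereMeasure n) := by
  have hne : Nonempty (Fin n) := ⟨⟨0, by omega⟩⟩
  have hmp := (volume : Measure (EuclideanSpace ℝ (Fin n))).measurePreserving_homeomorphUnitSphereProd
  have hfr : Module.finrank ℝ (EuclideanSpace ℝ (Fin n)) = n := by simp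
  rw [hfr] at hmp
  have hG : Measurable fun p : sphere (0 : EuclideanSpace ℝ (Fin n)) 1 × Set.Ioi (0:ℝ) =>
      F ((p.2 : ℝ) • (p.1 : EuclideanSpace ℝ (Fin n))) := by
    apply hF.comp
    fun_prop
  calc ∫⁻ x, F x = ∫⁻ x in ({0}ᶜ : Set (EuclideanSpace ℝ (Fin n))), F x := by
        rw [restrict_compl_singleton]
    _ = ∫⁻ x : ({0}ᶜ : Set (EuclideanSpace ℝ (Fin n))), F (x : EuclideanSpace ℝ (Fin n))
          ∂(Measure.comap (Subtype.val) volume) := by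
        rw [lintegral_subtype_comap (measurableSet_singleton _).compl]
    _ = ∫⁻ x : ({0}ᶜ : Set (EuclideanSpace ℝ (Fin n))),
          (fun p : sphere (0 : EuclideanSpace ℝ (Fin n)) 1 × Set.Ioi (0:ℝ) =>
            F ((p.2 : ℝ) • (p.1 : EuclideanSpace ℝ (Fin n)))) (homeomorphUnitSphereProd _ x)
          ∂(Measure.comap (Subtype.val) volume) := by
        congr 1; ext x
        have hx : ‖(x : EuclideanSpace ℝ (Fin n))‖ ≠ 0 := norm_ne_zero_iff.mpr x.2
        simp [smul_smul, hx]
    _ = ∫⁻ θ, (∫⁻ r, F ((r : ℝ) • (θ : EuclideanSpace ℝ (Fin n))) ∂(Measure.volumeIoiPow (n - 1)))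
          ∂(sphereMeasure n) := by
        rw [hmp.lintegral_comp hG, lintegral_prod _ hG.aemeasurable]
        rfl
    _ = _ := by
        congr 1; ext θ
        have hFθ : Measurable fun r : ℝ => F (r • (θ : EuclideanSpace ℝ (Fin n))) := by
          apply hF.comp; fun_prop
        have h5 := lintegral_withDensity_eq_lintegral_mul (Measure.comap (Subtype.val : Set.Ioi (0:ℝ) → ℝ) volume)
          (f := fun r => ENNReal.ofReal ((r:ℝ) ^ (n - 1))) (by fun_prop)
          (hFθ.comp measurable_subtype_coe)
        rw [Measure.volumeIoiPow]
        refine Eq.trans h5 ?_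
        exact lintegral_subtype_comap measurableSet_Ioi
          (fun r : ℝ => ENNReal.ofReal (r ^ (n - 1)) * F (r • (θ : EuclideanSpace ℝ (Fin n))))

/-- a unit vector orthogonal to a given vector. -/
theorem exists_unit_orth (hn : 2 ≤ n) (y : EuclideanSpace ℝ (Fin n)) :
    ∃ e : EuclideanSpace ℝ (Fin n), ‖e‖ = 1 ∧ inner ℝ y e = 0 := by
  have h1 := Submodule.finrank_add_finrank_orthogonal (ℝ ∙ y)
  have h2 : Module.finrank ℝ (ℝ ∙ y) ≤ 1 := (finrank_span_le_card {y}).trans (by simp)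
  have h3 : 0 < Module.finrank ℝ (ℝ ∙ y)ᗮ := by
    have : Module.finrank ℝ (EuclideanSpace ℝ (Fin n)) = n := by simp
    omega
  have : Nontrivial (ℝ ∙ y)ᗮ := Module.finrank_pos_iff.mp h3
  obtain ⟨e, he⟩ := exists_norm_eq ((ℝ ∙ y)ᗮ) (zero_le_one (α := ℝ))
  exact ⟨e, he, Submodule.mem_orthogonal_singleton_iff_inner_right.mp e.2⟩

theorem coord_rpow_integrable (hn : 2 ≤ n) :
    ∫⁻ z in ball (0 : EuclideanSpace ℝ (Fin n)) 1,
      ENNReal.ofReal (|z ⟨0, by omega⟩| ^ (-(1/2) : ℝ)) < ⊤ := by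
  classical
  let i0 : Fin n := ⟨0, by omega⟩
  let g : Fin n → ℝ → ℝ := fun i s => if i = i0 then (Set.Ioo (-1:ℝ) 1).indicator (fun s => |s| ^ (-(1/2) : ℝ)) s
    else (Set.Ioo (-1:ℝ) 1).indicator (fun _ => 1) s
  have hg0 : Integrable ((Set.Ioo (-1:ℝ) 1).indicator (fun s => |s| ^ (-(1/2) : ℝ))) := by
    rw [integrable_indicator_iff measurableSet_Ioo]
    have h1 : IntervalIntegrable (fun s : ℝ => |s| ^ (-(1/2) : ℝ)) volume (-1) 1 := by
      refine intervalIntegrable_of_even (fun x => by simp) (fun t ht => ?_)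
      refine (intervalIntegral.intervalIntegrable_rpow' (r := -(1/2)) (by norm_num)).congr fun s hs => ?_
      rw [Set.uIoc_of_le ht.le] at hs
      simp only [abs_of_pos hs.1]
    rw [intervalIntegrable_iff_integrableOn_Ioo_of_le (by norm_num)] at h1
    exact h1
  have hg : ∀ i, Integrable (g i) := by
    intro i
    by_cases h : i = i0
    · simpa [g, h] using hg0
    · simp only [g, h, if_false]
      rw [integrable_indicator_iff measurableSet_Ioo]
      simp
  have h2 := Integrable.fintype_prod (μ := fun _ => volume) hg
  have h3 := (EuclideanSpace.volume_preserving_symm_measurableEquiv_toLp (Fin n)).integrable_comp_emb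
    (MeasurableEquiv.measurableEmbedding _) |>.mpr h2
  refine lt_of_le_of_lt ?_ h3.2
  rw [← lintegral_indicator measurableSet_ball]
  apply lintegral_mono
  intro z
  by_cases hz : z ∈ ball (0 : EuclideanSpace ℝ (Fin n)) 1
  · have hz' : ∀ i, z i ∈ Set.Ioo (-1:ℝ) 1 := by
      intro i
      have := PiLp.norm_apply_le z i
      rw [mem_ball_zero_iff] at hz
      exact abs_lt.mp (lt_of_le_of_lt this hz)
    rw [Set.indicator_of_mem hz]
    have : (∏ i, g i (z i)) = |z i0| ^ (-(1/2) : ℝ) := by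
      rw [Finset.prod_eq_single i0]
      · simp [g, Set.indicator_of_mem (hz' i0)]
      · intro i _ hi
        simp [g, hi, Set.indicator_of_mem (hz' i)]
      · simp
    rw [← this]
    exact ofReal_le_enorm _
  · rw [Set.indicator_of_notMem hz]; exact zero_le


theorem coord_erpow (hn : 2 ≤ n) :
    ∫⁻ z in ball (0 : EuclideanSpace ℝ (Fin n)) 1, ‖z ⟨0, by omega⟩‖ₑ ^ (-(1/2) : ℝ) < ⊤ := by
  refine lt_of_le_of_lt (le_of_eq ?_) (coord_rpow_integrable hn)
  apply lintegral_congr_ae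
  apply ae_restrict_of_ae
  let i0 : Fin n := ⟨0, by omega⟩
  let L : EuclideanSpace ℝ (Fin n) →ₗ[ℝ] ℝ := (EuclideanSpace.proj i0 : EuclideanSpace ℝ (Fin n) →L[ℝ] ℝ).toLinearMap
  have hL : LinearMap.ker L ≠ ⊤ := by
    intro h
    have : EuclideanSpace.single i0 (1:ℝ) ∈ LinearMap.ker L := by rw [h]; trivial
    simp [L] at this
  have h0 := Measure.addHaar_submodule (volume : Measure (EuclideanSpace ℝ (Fin n))) _ hL
  filter_upwards [compl_mem_ae_iff.mpr h0] with z hz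
  have hz : z i0 ≠ 0 := hz
  rw [← ENNReal.ofReal_rpow_of_pos (abs_pos.mpr hz)]
  rw [← Real.norm_eq_abs, ofReal_norm]

theorem sphere_sing (hn : 2 ≤ n) : ∃ C : ℝ≥0∞, C < ⊤ ∧ ∀ y : EuclideanSpace ℝ (Fin n),
    ∫⁻ θ, ‖(θ : EuclideanSpace ℝ (Fin n)) - y‖ₑ ^ (-(1/2) : ℝ) ∂(sphereMeasure n) ≤ C := by
  let e0 : EuclideanSpace ℝ (Fin n) := EuclideanSpace.single ⟨0, by omega⟩ 1
  refine ⟨n * ∫⁻ z in ball (0 : EuclideanSpace ℝ (Fin n)) 1, ‖z ⟨0, by omega⟩‖ₑ ^ (-(1/2) : ℝ),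
    ENNReal.mul_lt_top (by simp) (coord_erpow hn), fun y => ?_⟩
  obtain ⟨e, he, hye⟩ := exists_unit_orth hn y
  have he0 : ‖e0‖ = ‖e‖ := by rw [he]; simp [e0]
  let L := (ℝ ∙ (e0 - e))ᗮ.reflection
  have hL : L e0 = e := Submodule.reflection_sub he0
  have h1 : ∀ θ : EuclideanSpace ℝ (Fin n),
      ‖θ - y‖ₑ ^ (-(1/2) : ℝ) ≤ ‖(inner ℝ θ e : ℝ)‖ₑ ^ (-(1/2) : ℝ) := by
    intro θ
    rw [ENNReal.rpow_neg, ENNReal.rpow_neg, ENNReal.inv_le_inv]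
    refine ENNReal.rpow_le_rpow ?_ (by norm_num)
    have h2 : (inner ℝ θ e : ℝ) = inner ℝ (θ - y) e := by rw [inner_sub_left, hye, sub_zero]
    rw [h2, ← ofReal_norm, ← ofReal_norm]
    apply ENNReal.ofReal_le_ofReal
    have := norm_inner_le_norm (𝕜 := ℝ) (θ - y) e
    rwa [he, mul_one] at this
  refine (lintegral_mono (fun θ : sphere (0 : EuclideanSpace ℝ (Fin n)) 1 =>
    h1 (θ : EuclideanSpace ℝ (Fin n)))).trans ?_
  have h3 : ∫⁻ z in ball (0 : EuclideanSpace ℝ (Fin n)) 1, ‖z ⟨0, by omega⟩‖ₑ ^ (-(1/2) : ℝ) =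
      ∫⁻ z, (ball (0 : EuclideanSpace ℝ (Fin n)) 1).indicator (fun z => ‖(inner ℝ z e : ℝ)‖ₑ ^ (-(1/2) : ℝ)) z := by
    rw [← lintegral_indicator measurableSet_ball, ← L.measurePreserving.lintegral_comp]
    · congr 1; ext z
      by_cases hz : z ∈ ball (0 : EuclideanSpace ℝ (Fin n)) 1
      · rw [Set.indicator_of_mem hz, Set.indicator_of_mem]
        · congr 2
          have h5 : (inner ℝ z (L e0) : ℝ) = inner ℝ (L z) e0 := by
            rw [← LinearIsometryEquiv.inner_map_map L, Submodule.reflection_reflection]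
          rw [← hL, h5, EuclideanSpace.inner_single_right]
          simp
        · rw [mem_ball_zero_iff] at hz ⊢; rwa [LinearIsometryEquiv.norm_map]
      · rw [Set.indicator_of_notMem hz, Set.indicator_of_notMem]
        rw [mem_ball_zero_iff] at hz ⊢; rwa [LinearIsometryEquiv.norm_map]
    · refine Measurable.indicator ?_ measurableSet_ball
      fun_prop
  rw [h3, polar_lintegral hn, ← lintegral_const_mul']
  · apply lintegral_mono
    intro θ
    have h4 : ∫⁻ r in Set.Ioo (0:ℝ) 1, ENNReal.ofReal (r ^ (n - 1)) = (n : ℝ≥0∞)⁻¹ := by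
      rw [Measure.restrict_congr_set Ioo_ae_eq_Ioc,
        ← ofReal_integral_eq_lintegral_ofReal (intervalIntegral.intervalIntegrable_pow _).1,
        ← intervalIntegral.integral_of_le zero_le_one]
      · have hn1 : n - 1 + 1 = n := by omega
        have hn0 : (0:ℝ) < n := by positivity
        rw [integral_pow, hn1]
        have : ((n - 1 : ℕ) : ℝ) + 1 = n := by exact_mod_cast hn1
        rw [this, one_pow, zero_pow (by omega), sub_zero, one_div, ENNReal.ofReal_inv_of_pos hn0]
        simp
      · filter_upwards [ae_restrict_mem measurableSet_Ioc] with y hy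
        exact pow_nonneg hy.1.le _
    calc ‖(inner ℝ (θ : EuclideanSpace ℝ (Fin n)) e : ℝ)‖ₑ ^ (-(1/2) : ℝ)
        = n * ∫⁻ r in Set.Ioo (0:ℝ) 1, ENNReal.ofReal (r ^ (n - 1)) * ‖(inner ℝ (θ : EuclideanSpace ℝ (Fin n)) e : ℝ)‖ₑ ^ (-(1/2) : ℝ) := by
          rw [lintegral_mul_const _ (by fun_prop), h4, ← mul_assoc, ENNReal.mul_inv_cancel, one_mul]
          · simp; omega
          · simp
      _ ≤ _ := by
          refine mul_le_mul_right ?_ _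
          refine (setLIntegral_mono' measurableSet_Ioo fun r hr => ?_).trans
            (lintegral_mono_set (Set.Ioo_subset_Ioi_self))
          refine mul_le_mul_right ?_ _
          rw [Set.indicator_of_mem]
          · rw [ENNReal.rpow_neg, ENNReal.rpow_neg, ENNReal.inv_le_inv]
            refine ENNReal.rpow_le_rpow ?_ (by norm_num)
            rw [← ofReal_norm, ← ofReal_norm]
            apply ENNReal.ofReal_le_ofReal
            rw [inner_smul_left, norm_mul]
            refine mul_le_of_le_one_left (norm_nonneg _) ?_
            simp [abs_of_pos hr.1, hr.2.le]
          · rw [mem_ball_zero_iff, norm_smul]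
            simp [abs_of_pos hr.1, hr.2]
  · simp
  · refine Measurable.indicator ?_ measurableSet_ball
    fun_prop

end

section
variable {n : ℕ}

/-- the radial comparison function. -/
noncomputable def wt (f : EuclideanSpace ℝ (Fin n) → ℝ) (r : ℝ) : ℝ :=
  -(∫ y, Real.log (max r ‖y‖ / max 1 ‖y‖) * f y) / cconst n

theorem K_far {r s d : ℝ} (hr : 0 < r) (hs : 0 ≤ s) (h1 : d ≤ r + s) (h2 : r ≤ d + s) (h3 : s ≤ d + r)
    (h4 : r / 2 ≤ d) : |Real.log (max r s / d)| ≤ min 2 (4 * s / r) := by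
  have hd : 0 < d := by linarith
  have hM : 0 < max r s := lt_of_lt_of_le hr (le_max_left _ _)
  have hM1 : r ≤ max r s := le_max_left _ _
  have hM2 : s ≤ max r s := le_max_right _ _
  have hM3 : max r s ≤ 3 * d := max_le (by linarith) (by linarith)
  have u1 : Real.log (max r s / d) ≤ max r s / d - 1 := Real.log_le_sub_one_of_pos (by positivity)
  have u2 : -Real.log (max r s / d) ≤ d / max r s - 1 := by
    rw [← Real.log_inv, inv_div]
    exact Real.log_le_sub_one_of_pos (by positivity)
  have a1 : max r s / d ≤ 3 := by rw [div_le_iff₀ hd]; exact hM3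
  have a2 : d / max r s ≤ 2 := by rw [div_le_iff₀ hM]; linarith
  have a3 : d / max r s - 1 ≤ 4 * s / r := by
    rw [div_sub_one hM.ne', div_le_div_iff₀ hM hr]
    have : d - max r s ≤ s := by linarith
    nlinarith [mul_nonneg hs hr.le, mul_le_mul_of_nonneg_left hM1 hs]
  have a4 : max r s / d - 1 ≤ 4 * s / r := by
    rw [div_sub_one hd.ne', div_le_div_iff₀ hd hr]
    rcases le_total s r with h | h
    · rw [max_eq_left h]
      have : r - d ≤ s := by linarith
      nlinarith [mul_nonneg hs hd.le, mul_le_mul_of_nonneg_left h4 hs]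
    · rw [max_eq_right h]
      have : s - d ≤ r := by linarith
      nlinarith [mul_nonneg hs hd.le, mul_le_mul_of_nonneg_left h4 hs]
  rw [abs_le]
  refine ⟨?_, le_min (by linarith) (by linarith)⟩
  have := le_min (show -Real.log (max r s / d) ≤ 2 by linarith) (show -Real.log (max r s / d) ≤ 4 * s / r by linarith)
  linarith

theorem K_near {r s d : ℝ} (hd : 0 < d) (h2 : r ≤ d + s) (h3 : s ≤ d + r)
    (h4 : d < r / 2) : 0 ≤ Real.log (max r s / d) ∧ Real.log (max r s / d) ≤ Real.log (2 * r / d) ∧ r / 2 < s := by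
  have hM1 : r ≤ max r s := le_max_left _ _
  have hM3 : max r s ≤ 2 * r := max_le (by linarith) (by linarith)
  refine ⟨Real.log_nonneg ?_, Real.log_le_log (by apply div_pos <;> linarith) (by gcongr), by linarith⟩
  rw [one_le_div hd]; linarith

/-- the key pointwise bound. -/
theorem K_bounds {f : EuclideanSpace ℝ (Fin n) → ℝ} {R0 : ℝ} (hf0 : ∀ y, R0 ≤ ‖y‖ → 0 ≤ f y)
    {x y : EuclideanSpace ℝ (Fin n)} (hx : 0 < ‖x‖) (hxR : 2 * R0 ≤ ‖x‖) (hy : 0 < ‖y - x‖) :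
    -(min 2 (4 * ‖y‖ / ‖x‖) * |f y|) ≤ Real.log (max ‖x‖ ‖y‖ / ‖y - x‖) * f y ∧
    Real.log (max ‖x‖ ‖y‖ / ‖y - x‖) * f y ≤ min 2 (4 * ‖y‖ / ‖x‖) * |f y| +
      max 0 (Real.log (2 * ‖x‖ / ‖y - x‖)) * ({z : EuclideanSpace ℝ (Fin n) | ‖x‖ / 2 < ‖z‖}.indicator (fun z => |f z|) y) := by
  have h1 : ‖y - x‖ ≤ ‖x‖ + ‖y‖ := by rw [add_comm]; exact norm_sub_le y x
  have h2 : ‖x‖ ≤ ‖y - x‖ + ‖y‖ := by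
    have := norm_sub_le y (y - x); rw [sub_sub_cancel] at this; linarith
  have h3 : ‖y‖ ≤ ‖y - x‖ + ‖x‖ := by simpa using norm_add_le (y - x) x
  have hind : 0 ≤ ({z : EuclideanSpace ℝ (Fin n) | ‖x‖ / 2 < ‖z‖}.indicator (fun z => |f z|) y) :=
    Set.indicator_nonneg (fun _ _ => abs_nonneg _) _
  have hmin : 0 ≤ min 2 (4 * ‖y‖ / ‖x‖) := by positivity
  rcases le_or_gt (‖x‖ / 2) ‖y - x‖ with h4 | h4
  · have h5 := K_far hx (norm_nonneg y) h1 h2 h3 h4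
    have h6 : |Real.log (max ‖x‖ ‖y‖ / ‖y - x‖) * f y| ≤ min 2 (4 * ‖y‖ / ‖x‖) * |f y| := by
      rw [abs_mul]; gcongr
    have h7 : 0 ≤ max 0 (Real.log (2 * ‖x‖ / ‖y - x‖)) := le_max_left _ _
    have := mul_nonneg h7 hind
    exact ⟨(abs_le.mp h6).1, by linarith [(abs_le.mp h6).2]⟩
  · obtain ⟨a1, a2, a3⟩ := K_near hy h2 h3 h4
    have hfy : 0 ≤ f y := hf0 y (by linarith)
    rw [Set.indicator_of_mem (show y ∈ {z : EuclideanSpace ℝ (Fin n) | ‖x‖ / 2 < ‖z‖} from a3), abs_of_nonneg hfy]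
    have := mul_nonneg hmin hfy
    refine ⟨by nlinarith [mul_nonneg a1 hfy], ?_⟩
    have : Real.log (max ‖x‖ ‖y‖ / ‖y - x‖) * f y ≤ max 0 (Real.log (2 * ‖x‖ / ‖y - x‖)) * f y :=
      mul_le_mul_of_nonneg_right (a2.trans (le_max_right _ _)) hfy
    linarith

theorem wt_kernel_bound {r : ℝ} (hr : 1 ≤ r) (s : ℝ) :
    0 ≤ Real.log (max r s / max 1 s) ∧ Real.log (max r s / max 1 s) ≤ Real.log r := by
  have h0 : 0 < max 1 s := by positivity
  have h1 : 1 ≤ max 1 s := le_max_left _ _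
  have h2 : s ≤ max 1 s := le_max_right _ _
  constructor
  · apply Real.log_nonneg
    rw [one_le_div h0]
    exact max_le_max_right _ hr
  · apply Real.log_le_log
    · have : 0 < max r s := lt_of_lt_of_le (by linarith) (le_max_left _ _)
      positivity
    · rw [div_le_iff₀ h0]
      refine max_le (by nlinarith) (by nlinarith)

theorem wt_int {f : EuclideanSpace ℝ (Fin n) → ℝ} (hc : Continuous f) (hi : Integrable f) {r : ℝ} (hr : 1 ≤ r) :
    Integrable fun y => Real.log (max r ‖y‖ / max 1 ‖y‖) * f y := by
  refine Integrable.mono' (hi.norm.const_mul (Real.log r)) ?_ (ae_of_all _ fun y => ?_)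
  · have : Measurable fun y : EuclideanSpace ℝ (Fin n) => Real.log (max r ‖y‖ / max 1 ‖y‖) := by fun_prop
    exact (this.mul hc.measurable).aestronglyMeasurable
  · obtain ⟨h1, h2⟩ := wt_kernel_bound hr ‖y‖
    rw [norm_mul, Real.norm_of_nonneg h1]
    gcongr

theorem wt_bound {f : EuclideanSpace ℝ (Fin n) → ℝ} (hi : Integrable f) {r : ℝ} (hr : 1 ≤ r) :
    |wt f r| ≤ (∫ y, ‖f y‖) / cconst n * Real.log r := by
  have hcp := cconst_pos n
  unfold wt
  rw [abs_div, abs_neg, abs_of_pos hcp, div_mul_eq_mul_div]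
  gcongr
  have : (∫ y, ‖f y‖) * Real.log r = ∫ y, Real.log r * ‖f y‖ := by rw [integral_const_mul, mul_comm]
  rw [this, ← Real.norm_eq_abs]
  refine norm_integral_le_of_norm_le (hi.norm.const_mul (Real.log r)) (ae_of_all _ fun y => ?_)
  obtain ⟨h1, h2⟩ := wt_kernel_bound hr ‖y‖
  rw [norm_mul, Real.norm_of_nonneg h1]
  gcongr

theorem Epot_sub_wt (hn : 2 ≤ n) {f : EuclideanSpace ℝ (Fin n) → ℝ} (hc : Continuous f) (hi : Integrable f)
    {x : EuclideanSpace ℝ (Fin n)} (hx : 1 ≤ ‖x‖) :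
    Integrable (fun y => Real.log (max ‖x‖ ‖y‖ / ‖y - x‖) * f y) ∧
    Epot f x / cconst n - wt f ‖x‖ = (∫ y, Real.log (max ‖x‖ ‖y‖ / ‖y - x‖) * f y) / cconst n := by
  have i1 := lk_int hn hc hi x
  have i2 := wt_int hc hi hx
  have i3 : Integrable fun y => lk x y * f y + Real.log (max ‖x‖ ‖y‖ / max 1 ‖y‖) * f y := i1.add i2
  have e : (fun y => lk x y * f y + Real.log (max ‖x‖ ‖y‖ / max 1 ‖y‖) * f y) =ᵐ[volume]
      fun y => Real.log (max ‖x‖ ‖y‖ / ‖y - x‖) * f y := by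
    filter_upwards [norm_sub_ae_pos hn x] with y hy
    have h0 : (0:ℝ) < max 1 ‖y‖ := by positivity
    have h1 : 0 < max ‖x‖ ‖y‖ := lt_of_lt_of_le (by linarith) (le_max_left _ _)
    rw [← add_mul]
    unfold lk
    rw [Real.log_div h0.ne' hy.ne', Real.log_div h1.ne' h0.ne', Real.log_div h1.ne' hy.ne']
    ring
  refine ⟨i3.congr e, ?_⟩
  rw [← integral_congr_ae e, integral_add i1 i2]
  unfold Epot wt
  ring

/-- error function. -/
noncomputable def epsf (f : EuclideanSpace ℝ (Fin n) → ℝ) (r : ℝ) : ℝ :=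
  (∫ y, min 2 (4 * ‖y‖ / r) * |f y|) / cconst n

theorem epsf_int {f : EuclideanSpace ℝ (Fin n) → ℝ} (hc : Continuous f) (hi : Integrable f) {r : ℝ} (hr : 0 < r) :
    Integrable fun y => min 2 (4 * ‖y‖ / r) * |f y| := by
  refine Integrable.mono' (hi.norm.const_mul 2) ?_ (ae_of_all _ fun y => ?_)
  · have : Continuous fun y : EuclideanSpace ℝ (Fin n) => min 2 (4 * ‖y‖ / r) := by fun_prop
    exact (this.mul hc.abs).aestronglyMeasurable
  · rw [Real.norm_of_nonneg (by positivity), Real.norm_eq_abs]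
    gcongr
    exact min_le_left _ _

theorem epsf_tendsto {f : EuclideanSpace ℝ (Fin n) → ℝ} (hc : Continuous f) (hi : Integrable f) :
    Tendsto (epsf f) atTop (𝓝 0) := by
  have : Tendsto (fun r => ∫ y, min 2 (4 * ‖y‖ / r) * |f y|) atTop (𝓝 (∫ _ : EuclideanSpace ℝ (Fin n), (0:ℝ))) := by
    refine tendsto_integral_filter_of_dominated_convergence (fun y => 2 * ‖f y‖) ?_ ?_ (hi.norm.const_mul 2) ?_
    · filter_upwards [eventually_gt_atTop 0] with r hr
      exact (epsf_int hc hi hr).aestronglyMeasurable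
    · filter_upwards [eventually_gt_atTop 0] with r hr
      refine ae_of_all _ fun y => ?_
      rw [Real.norm_of_nonneg (by positivity), Real.norm_eq_abs]
      gcongr
      exact min_le_left _ _
    · refine ae_of_all _ fun y => ?_
      have h1 : Tendsto (fun r : ℝ => 4 * ‖y‖ / r) atTop (𝓝 0) := tendsto_const_nhds.div_atTop tendsto_id
      have h2 : Tendsto (fun r : ℝ => min 2 (4 * ‖y‖ / r)) atTop (𝓝 (min 2 0)) := tendsto_const_nhds.min h1
      have := h2.mul_const |f y|
      simpa using this
  have := this.div_const (cconst n)
  simp only [integral_zero, zero_div] at this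
  exact this

theorem pot_lower (hn : 2 ≤ n) {f : EuclideanSpace ℝ (Fin n) → ℝ} (hc : Continuous f) (hi : Integrable f)
    {R0 : ℝ} (hf0 : ∀ y, R0 ≤ ‖y‖ → 0 ≤ f y)
    {x : EuclideanSpace ℝ (Fin n)} (hx : 1 ≤ ‖x‖) (hxR : 2 * R0 ≤ ‖x‖) :
    -epsf f ‖x‖ ≤ Epot f x / cconst n - wt f ‖x‖ := by
  obtain ⟨i1, e1⟩ := Epot_sub_wt hn hc hi hx
  have hcp := cconst_pos n
  rw [e1, epsf, ← neg_div, ← integral_neg]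
  refine div_le_div_of_nonneg_right ?_ hcp.le
  have i2 : Integrable fun y => -(min 2 (4 * ‖y‖ / ‖x‖) * |f y|) :=
    (epsf_int hc hi (r := ‖x‖) (by linarith)).neg
  refine integral_mono_ae i2 i1 ?_
  filter_upwards [norm_sub_ae_pos hn x] with y hy
  exact (K_bounds hf0 (by linarith) hxR hy).1

end

section
variable {n : ℕ}

theorem exp_jensen {α : Type*} [MeasurableSpace α] {μ : Measure α} {F a b : α → ℝ} {κ : ℝ} (hκ : 0 < κ)
    (hF : Integrable F μ) (hF0 : ∀ y, 0 ≤ F y) (haF : Integrable (fun y => a y * F y) μ)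
    (hbF : Integrable (fun y => b y * F y) μ) (hab : ∀ᵐ y ∂μ, Real.exp (a y / 2) - 1 ≤ b y)
    (hM : ∫ y, F y ∂μ ≤ 1 / (2 * κ)) (ha0 : ∀ y, 0 ≤ a y) :
    Real.exp (κ * ∫ y, a y * F y ∂μ) ≤ 1 + 2 * κ * ∫ y, b y * F y ∂μ := by
  set A := ∫ y, a y * F y ∂μ with hA
  set B := ∫ y, b y * F y ∂μ with hB
  set M := ∫ y, F y ∂μ with hMd
  have hA0 : 0 ≤ A := integral_nonneg fun y => mul_nonneg (ha0 y) (hF0 y)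
  set z := κ * A with hz
  have hz0 : 0 ≤ z := by positivity
  have i1 : Integrable (fun y => (Real.exp z - 1 - z * Real.exp z) * F y + (Real.exp z / 2) * (a y * F y)) μ :=
    (hF.const_mul _).add (haF.const_mul _)
  have h1 : (Real.exp z - 1 - z * Real.exp z) * M + (Real.exp z / 2) * A ≤ B := by
    calc _ = ∫ y, ((Real.exp z - 1 - z * Real.exp z) * F y + (Real.exp z / 2) * (a y * F y)) ∂μ := by
          rw [integral_add (hF.const_mul _) (haF.const_mul _), integral_const_mul, integral_const_mul]
      _ ≤ B := by
          refine integral_mono_ae i1 hbF ?_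
          filter_upwards [hab] with y hy
          have h2 : Real.exp z * (a y / 2 - z + 1) ≤ Real.exp (a y / 2) := by
            have := Real.add_one_le_exp (a y / 2 - z)
            have h3 : Real.exp (a y / 2) = Real.exp z * Real.exp (a y / 2 - z) := by
              rw [← Real.exp_add]; ring_nf
            rw [h3]
            gcongr
          have := mul_le_mul_of_nonneg_right (show Real.exp z * (a y / 2 - z + 1) - 1 ≤ b y by linarith) (hF0 y)
          refine le_trans (le_of_eq ?_) this
          ring
  have h4 : Real.exp z - 1 - z * Real.exp z ≤ 0 := by
    have := Real.add_one_le_exp (-z)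
    have h5 : Real.exp z * Real.exp (-z) = 1 := by rw [← Real.exp_add]; simp
    nlinarith [Real.exp_pos z]
  have h6 := mul_le_mul_of_nonpos_left hM h4
  have h7 : A = z / κ := by rw [hz]; field_simp
  rw [h7] at h1
  have h8 : (Real.exp z - 1 - z * Real.exp z) * (1 / (2 * κ)) + Real.exp z / 2 * (z / κ) = (Real.exp z - 1) / (2 * κ) := by
    field_simp; ring
  have h9 : (Real.exp z - 1) / (2 * κ) ≤ B := by linarith
  rw [div_le_iff₀ (by positivity)] at h9
  linarith

theorem avg_sing (hn : 2 ≤ n) : ∃ C : ℝ, 0 ≤ C ∧ ∀ r : ℝ, 0 < r → ∀ F : EuclideanSpace ℝ (Fin n) → ℝ,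
    Measurable F → (∀ y, 0 ≤ F y) → Integrable F →
    (∀ θ : sphere (0 : EuclideanSpace ℝ (Fin n)) 1,
      Integrable fun y => Real.sqrt (2 * r / ‖y - r • (θ : EuclideanSpace ℝ (Fin n))‖) * F y) →
    ∫⁻ θ, ENNReal.ofReal (∫ y, Real.sqrt (2 * r / ‖y - r • (θ : EuclideanSpace ℝ (Fin n))‖) * F y) ∂(sphereMeasure n) ≤
      ENNReal.ofReal (C * ∫ y, F y) := by
  obtain ⟨C, hC, h⟩ := sphere_sing hn
  refine ⟨Real.sqrt 2 * C.toReal, by positivity, fun r hr F hFm hF0 hFi hI => ?_⟩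
  have h1 : ∀ (θ y : EuclideanSpace ℝ (Fin n)), ENNReal.ofReal (Real.sqrt (2 * r / ‖y - r • θ‖)) ≤
      ENNReal.ofReal (Real.sqrt 2) * ‖θ - r⁻¹ • y‖ₑ ^ (-(1/2) : ℝ) := by
    intro θ y
    have h2 : ‖y - r • θ‖ = r * ‖θ - r⁻¹ • y‖ := by
      rw [norm_sub_rev, ← abs_of_pos hr, ← Real.norm_eq_abs, ← norm_smul, Real.norm_eq_abs, abs_of_pos hr,
        smul_sub, smul_inv_smul₀ hr.ne']
    rw [h2]
    rcases eq_or_lt_of_le (norm_nonneg (θ - r⁻¹ • y)) with h3 | h3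
    · rw [← h3]; simp
    · have h4 : 2 * r / (r * ‖θ - r⁻¹ • y‖) = 2 / ‖θ - r⁻¹ • y‖ := by field_simp
      rw [h4, ← ofReal_norm, ENNReal.ofReal_rpow_of_pos h3, ← ENNReal.ofReal_mul (by positivity)]
      apply ENNReal.ofReal_le_ofReal
      rw [Real.sqrt_div (by norm_num), Real.rpow_neg h3.le, ← Real.sqrt_eq_rpow, div_eq_mul_inv]
  calc _ = ∫⁻ θ, (∫⁻ y, ENNReal.ofReal (Real.sqrt (2 * r / ‖y - r • (θ : EuclideanSpace ℝ (Fin n))‖) * F y)) ∂(sphereMeasure n) := by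
        congr 1; ext θ
        rw [ofReal_integral_eq_lintegral_ofReal (hI _) (ae_of_all _ fun y => mul_nonneg (Real.sqrt_nonneg _) (hF0 y))]
    _ = ∫⁻ y, (∫⁻ θ, ENNReal.ofReal (Real.sqrt (2 * r / ‖y - r • (θ : EuclideanSpace ℝ (Fin n))‖) * F y) ∂(sphereMeasure n)) := by
        rw [lintegral_lintegral_swap]
        apply Measurable.aemeasurable
        unfold Function.uncurry
        have : Measurable fun p : (sphere (0 : EuclideanSpace ℝ (Fin n)) 1) × EuclideanSpace ℝ (Fin n) => F p.2 := hFm.comp measurable_snd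
        have h5 : Measurable fun p : (sphere (0 : EuclideanSpace ℝ (Fin n)) 1) × EuclideanSpace ℝ (Fin n) => ‖p.2 - r • (p.1 : EuclideanSpace ℝ (Fin n))‖ := by
          fun_prop
        exact (((h5.const_div (2 * r)).sqrt).mul this).ennreal_ofReal
    _ ≤ ∫⁻ y, (ENNReal.ofReal (Real.sqrt 2) * C) * ENNReal.ofReal (F y) := by
        apply lintegral_mono
        intro y
        calc _ ≤ ∫⁻ θ, (ENNReal.ofReal (Real.sqrt 2) * ENNReal.ofReal (F y)) * ‖(θ : EuclideanSpace ℝ (Fin n)) - r⁻¹ • y‖ₑ ^ (-(1/2) : ℝ) ∂(sphereMeasure n) := by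
              apply lintegral_mono
              intro θ
              simp only
              rw [ENNReal.ofReal_mul (Real.sqrt_nonneg _), mul_right_comm]
              exact mul_le_mul_left (h1 _ _) _
          _ = (ENNReal.ofReal (Real.sqrt 2) * ENNReal.ofReal (F y)) * ∫⁻ θ, ‖(θ : EuclideanSpace ℝ (Fin n)) - r⁻¹ • y‖ₑ ^ (-(1/2) : ℝ) ∂(sphereMeasure n) := by
              rw [lintegral_const_mul' _ _ (by finiteness)]
          _ ≤ _ := by
              rw [mul_right_comm]
              exact mul_le_mul_left (mul_le_mul_right (h _) _) _
    _ = _ := by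
        rw [lintegral_const_mul' _ _ (by finiteness), ← ofReal_integral_eq_lintegral_ofReal hFi (ae_of_all _ hF0),
          ENNReal.ofReal_mul (by positivity), ENNReal.ofReal_mul (by positivity), ENNReal.ofReal_toReal hC.ne]


theorem tail_tendsto {f : EuclideanSpace ℝ (Fin n) → ℝ} (hc : Continuous f) (hi : Integrable f) :
    Tendsto (fun r : ℝ => ∫ y, {z : EuclideanSpace ℝ (Fin n) | r / 2 < ‖z‖}.indicator (fun z => |f z|) y) atTop (𝓝 0) := by
  have : Tendsto (fun r : ℝ => ∫ y, {z : EuclideanSpace ℝ (Fin n) | r / 2 < ‖z‖}.indicator (fun z => |f z|) y) atTop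
      (𝓝 (∫ _ : EuclideanSpace ℝ (Fin n), (0:ℝ))) := by
    refine tendsto_integral_filter_of_dominated_convergence (fun y => ‖f y‖) ?_ ?_ hi.norm ?_
    · refine Eventually.of_forall fun r => ?_
      exact (hc.abs.measurable.indicator (measurableSet_lt measurable_const measurable_norm)).aestronglyMeasurable
    · refine Eventually.of_forall fun r => ae_of_all _ fun y => ?_
      refine (norm_indicator_le_norm_self _ _).trans (by simp)
    · refine ae_of_all _ fun y => ?_
      refine tendsto_const_nhds.congr' ?_
      filter_upwards [eventually_ge_atTop (2 * ‖y‖)] with r hr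
      rw [Set.indicator_of_notMem]
      simp; linarith
  simpa using this

theorem omegaN_pos (hn : 2 ≤ n) : 0 < omegaN n := by
  have hne : Nonempty (Fin n) := ⟨⟨0, by omega⟩⟩
  unfold omegaN
  apply ENNReal.toReal_pos
  · unfold sphereMeasure
    rw [Measure.measure_univ_ne_zero]
    exact Measure.toSphere_ne_zero _
  · exact measure_ne_top _ _

theorem pot_upper (hn : 2 ≤ n) {f : EuclideanSpace ℝ (Fin n) → ℝ} (hc : Continuous f) (hi : Integrable f)
    {R0 : ℝ} (hf0 : ∀ y, R0 ≤ ‖y‖ → 0 ≤ f y) {k : ℝ} (hk : 0 < k)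
    {x : EuclideanSpace ℝ (Fin n)} (hx : 1 ≤ ‖x‖) (hxR : 2 * R0 ≤ ‖x‖)
    (hM : ∫ y, {z : EuclideanSpace ℝ (Fin n) | ‖x‖ / 2 < ‖z‖}.indicator (fun z => |f z|) y ≤ 1 / (2 * (k / cconst n))) :
    Integrable (fun y => Real.sqrt (2 * ‖x‖ / ‖y - x‖) * {z : EuclideanSpace ℝ (Fin n) | ‖x‖ / 2 < ‖z‖}.indicator (fun z => |f z|) y) ∧
    Real.exp (k * (Epot f x / cconst n - wt f ‖x‖)) ≤ Real.exp (k * epsf f ‖x‖) *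
      (1 + 2 * (k / cconst n) * ∫ y, Real.sqrt (2 * ‖x‖ / ‖y - x‖) * {z : EuclideanSpace ℝ (Fin n) | ‖x‖ / 2 < ‖z‖}.indicator (fun z => |f z|) y) := by
  obtain ⟨i1, e1⟩ := Epot_sub_wt hn hc hi hx
  have hcp := cconst_pos n
  set F : EuclideanSpace ℝ (Fin n) → ℝ := {z : EuclideanSpace ℝ (Fin n) | ‖x‖ / 2 < ‖z‖}.indicator (fun z => |f z|) with hF
  have hmeas : MeasurableSet {z : EuclideanSpace ℝ (Fin n) | ‖x‖ / 2 < ‖z‖} := measurableSet_lt measurable_const measurable_norm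
  have hFm : Measurable F := hc.abs.measurable.indicator hmeas
  have hFi : Integrable F := hi.norm.indicator hmeas
  have hF0 : ∀ y, 0 ≤ F y := fun y => Set.indicator_nonneg (fun _ _ => abs_nonneg _) _
  have hFle : ∀ y, F y ≤ |f y| := fun y => Set.indicator_le_self' (fun _ _ => abs_nonneg _) y
  have hsb : ∀ t : ℝ, 0 ≤ t → Real.sqrt t ≤ 1 + t := fun t ht => by
    rw [Real.sqrt_le_left (by linarith)]; nlinarith
  have ib : Integrable (fun y => Real.sqrt (2 * ‖x‖ / ‖y - x‖) * F y) := by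
    have j1 : Integrable (fun y => |f y| + 2 * ‖x‖ * ‖‖y - x‖⁻¹ * f y‖) :=
      hi.norm.add ((sing_int' hn hc hi x).norm.const_mul (2 * ‖x‖))
    refine Integrable.mono' j1 ?_ (ae_of_all _ fun y => ?_)
    · have : Measurable fun y : EuclideanSpace ℝ (Fin n) => Real.sqrt (2 * ‖x‖ / ‖y - x‖) := by fun_prop
      exact (this.mul hFm).aestronglyMeasurable
    · rw [Real.norm_of_nonneg (mul_nonneg (Real.sqrt_nonneg _) (hF0 y))]
      calc _ ≤ (1 + 2 * ‖x‖ / ‖y - x‖) * |f y| := by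
            gcongr
            · exact hF0 y
            · exact hsb _ (by positivity)
            · exact hFle y
        _ = _ := by
            rw [norm_mul, norm_inv, norm_norm, Real.norm_eq_abs]; ring
  refine ⟨ib, ?_⟩
  have hexp : ∀ᵐ y : EuclideanSpace ℝ (Fin n), Real.exp (max 0 (Real.log (2 * ‖x‖ / ‖y - x‖)) / 2) - 1 ≤ Real.sqrt (2 * ‖x‖ / ‖y - x‖) := by
    filter_upwards [norm_sub_ae_pos hn x] with y hy
    have hp : 0 < 2 * ‖x‖ / ‖y - x‖ := by apply div_pos <;> linarith
    rcases le_total (Real.log (2 * ‖x‖ / ‖y - x‖)) 0 with h | h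
    · rw [max_eq_left h]; simp only [zero_div, Real.exp_zero, sub_self]; exact Real.sqrt_nonneg _
    · rw [max_eq_right h, Real.exp_half, Real.exp_log hp]; linarith
  have ia : Integrable (fun y => max 0 (Real.log (2 * ‖x‖ / ‖y - x‖)) * F y) := by
    refine Integrable.mono' (ib.const_mul 2) ?_ ?_
    · have : Measurable fun y : EuclideanSpace ℝ (Fin n) => max 0 (Real.log (2 * ‖x‖ / ‖y - x‖)) := by fun_prop
      exact (this.mul hFm).aestronglyMeasurable
    · filter_upwards [hexp] with y hy
      have h0 : 0 ≤ max 0 (Real.log (2 * ‖x‖ / ‖y - x‖)) := le_max_left _ _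
      have := Real.add_one_le_exp (max 0 (Real.log (2 * ‖x‖ / ‖y - x‖)) / 2)
      rw [Real.norm_of_nonneg (mul_nonneg h0 (hF0 y)), ← mul_assoc]
      exact mul_le_mul_of_nonneg_right (by linarith) (hF0 y)
  have hJ := exp_jensen (show 0 < k / cconst n by positivity) hFi hF0 ia ib hexp hM (fun y => le_max_left _ _)
  have ie := epsf_int hc hi (r := ‖x‖) (by linarith)
  have hup : Epot f x / cconst n - wt f ‖x‖ ≤ epsf f ‖x‖ + (∫ y, max 0 (Real.log (2 * ‖x‖ / ‖y - x‖)) * F y) / cconst n := by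
    rw [e1, epsf, ← add_div, ← integral_add ie ia]
    refine div_le_div_of_nonneg_right ?_ hcp.le
    refine integral_mono_ae i1 (ie.add ia) ?_
    filter_upwards [norm_sub_ae_pos hn x] with y hy
    exact (K_bounds hf0 (by linarith) hxR hy).2
  calc _ ≤ Real.exp (k * epsf f ‖x‖ + k / cconst n * ∫ y, max 0 (Real.log (2 * ‖x‖ / ‖y - x‖)) * F y) := by
        rw [Real.exp_le_exp]
        have := mul_le_mul_of_nonneg_left hup hk.le
        refine this.trans (le_of_eq ?_)
        ring
    _ ≤ _ := by
        rw [Real.exp_add]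
        gcongr

theorem pot_avg (hn : 2 ≤ n) {f : EuclideanSpace ℝ (Fin n) → ℝ} (hc : Continuous f) (hi : Integrable f)
    (hE : Continuous (Epot f))
    {R0 : ℝ} (hf0 : ∀ y, R0 ≤ ‖y‖ → 0 ≤ f y) {k : ℝ} (hk : 0 < k) :
    Tendsto (fun r : ℝ => ∫ θ, Real.exp (k * (Epot f (r • (θ : EuclideanSpace ℝ (Fin n))) / cconst n - wt f r)) ∂(sphereMeasure n))
      atTop (𝓝 (omegaN n)) := by
  obtain ⟨C, hC, hav⟩ := avg_sing hn
  have hcp := cconst_pos n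
  have ht := tail_tendsto hc hi
  have he := epsf_tendsto hc hi
  have hlo : Tendsto (fun r => Real.exp (-(k * epsf f r)) * omegaN n) atTop (𝓝 (omegaN n)) := by
    have := ((Real.continuous_exp.tendsto _).comp ((he.const_mul k).neg)).mul_const (omegaN n)
    simpa using this
  have hup : Tendsto (fun r => Real.exp (k * epsf f r) * (omegaN n + 2 * (k / cconst n) *
      (C * ∫ y, {z : EuclideanSpace ℝ (Fin n) | r / 2 < ‖z‖}.indicator (fun z => |f z|) y))) atTop (𝓝 (omegaN n)) := by
    have := ((Real.continuous_exp.tendsto _).comp (he.const_mul k)).mul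
      (((ht.const_mul C).const_mul (2 * (k / cconst n))).const_add (omegaN n))
    simpa using this
  have hGc : ∀ r : ℝ, Continuous fun θ : sphere (0 : EuclideanSpace ℝ (Fin n)) 1 =>
      Real.exp (k * (Epot f (r • (θ : EuclideanSpace ℝ (Fin n))) / cconst n - wt f r)) := by
    intro r
    have : Continuous fun θ : sphere (0 : EuclideanSpace ℝ (Fin n)) 1 => Epot f (r • (θ : EuclideanSpace ℝ (Fin n))) :=
      hE.comp (by fun_prop)
    fun_prop
  have hGi : ∀ r : ℝ, Integrable (fun θ : sphere (0 : EuclideanSpace ℝ (Fin n)) 1 =>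
      Real.exp (k * (Epot f (r • (θ : EuclideanSpace ℝ (Fin n))) / cconst n - wt f r))) (sphereMeasure n) := fun r =>
    (hGc r).integrable_of_hasCompactSupport (HasCompactSupport.of_compactSpace _)
  have hω : (sphereMeasure n).real Set.univ = omegaN n := rfl
  have hev : ∀ᶠ r : ℝ in atTop, ∫ y, {z : EuclideanSpace ℝ (Fin n) | r / 2 < ‖z‖}.indicator (fun z => |f z|) y ≤ 1 / (2 * (k / cconst n)) :=
    ht.eventually_le_const (by positivity)
  have hnθ : ∀ r : ℝ, 1 ≤ r → ∀ θ : sphere (0 : EuclideanSpace ℝ (Fin n)) 1, ‖r • (θ : EuclideanSpace ℝ (Fin n))‖ = r := by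
    intro r hr θ
    rw [norm_smul]; simp; linarith
  refine tendsto_of_tendsto_of_tendsto_of_le_of_le' hlo hup ?_ ?_
  · filter_upwards [eventually_ge_atTop 1, eventually_ge_atTop (2 * R0)] with r hr1 hr2
    have : Real.exp (-(k * epsf f r)) * omegaN n = ∫ _ : sphere (0 : EuclideanSpace ℝ (Fin n)) 1, Real.exp (-(k * epsf f r)) ∂(sphereMeasure n) := by
      rw [integral_const, hω, smul_eq_mul, mul_comm]
    rw [this]
    refine integral_mono (integrable_const _) (hGi r) fun θ => ?_
    have h1 := pot_lower hn hc hi hf0 (x := r • (θ : EuclideanSpace ℝ (Fin n))) (by rw [hnθ r hr1 θ]; exact hr1) (by rw [hnθ r hr1 θ]; exact hr2)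
    rw [hnθ r hr1 θ] at h1
    simp only
    rw [Real.exp_le_exp]
    nlinarith [mul_le_mul_of_nonneg_left h1 hk.le]
  · filter_upwards [eventually_ge_atTop 1, eventually_ge_atTop (2 * R0), hev] with r hr1 hr2 hr3
    set F : EuclideanSpace ℝ (Fin n) → ℝ := {z : EuclideanSpace ℝ (Fin n) | r / 2 < ‖z‖}.indicator (fun z => |f z|) with hF
    have hmeas : MeasurableSet {z : EuclideanSpace ℝ (Fin n) | r / 2 < ‖z‖} := measurableSet_lt measurable_const measurable_norm
    have hFm : Measurable F := hc.abs.measurable.indicator hmeas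
    have hFi : Integrable F := hi.norm.indicator hmeas
    have hF0 : ∀ y, 0 ≤ F y := fun y => Set.indicator_nonneg (fun _ _ => abs_nonneg _) _
    have hM0 : 0 ≤ ∫ y, F y := integral_nonneg hF0
    have hω0 := omegaN_pos hn
    have hpt : ∀ θ : sphere (0 : EuclideanSpace ℝ (Fin n)) 1, _ := fun θ =>
      pot_upper hn hc hi hf0 hk (x := r • (θ : EuclideanSpace ℝ (Fin n))) (by rw [hnθ r hr1 θ]; exact hr1)
        (by rw [hnθ r hr1 θ]; exact hr2) (by rw [hnθ r hr1 θ]; exact hr3)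
    simp only [hnθ r hr1] at hpt
    rw [integral_eq_lintegral_of_nonneg_ae (ae_of_all _ fun _ => (Real.exp_pos _).le) (hGi r).aestronglyMeasurable]
    apply ENNReal.toReal_le_of_le_ofReal (by positivity)
    have hav' : ∫⁻ θ, ENNReal.ofReal (∫ y, Real.sqrt (2 * r / ‖y - r • (θ : EuclideanSpace ℝ (Fin n))‖) * F y) ∂(sphereMeasure n) ≤
      ENNReal.ofReal (C * ∫ y, F y) := hav r (by linarith) F hFm hF0 hFi fun θ => (hpt θ).1
    calc _ ≤ ∫⁻ θ, ENNReal.ofReal (Real.exp (k * epsf f r)) * (1 + ENNReal.ofReal (2 * (k / cconst n)) *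
            ENNReal.ofReal (∫ y, Real.sqrt (2 * r / ‖y - r • (θ : EuclideanSpace ℝ (Fin n))‖) * F y)) ∂(sphereMeasure n) := by
          apply lintegral_mono
          intro θ
          refine (ENNReal.ofReal_le_ofReal (hpt θ).2).trans (le_of_eq ?_)
          have hI0 : 0 ≤ ∫ y, Real.sqrt (2 * r / ‖y - r • (θ : EuclideanSpace ℝ (Fin n))‖) * F y :=
            integral_nonneg fun y => mul_nonneg (Real.sqrt_nonneg _) (hF0 y)
          rw [ENNReal.ofReal_mul (Real.exp_pos _).le, ENNReal.ofReal_add (by norm_num) (by positivity),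
            ENNReal.ofReal_mul (by positivity), ENNReal.ofReal_one]
      _ = ENNReal.ofReal (Real.exp (k * epsf f r)) * (sphereMeasure n Set.univ + ENNReal.ofReal (2 * (k / cconst n)) *
            ∫⁻ θ, ENNReal.ofReal (∫ y, Real.sqrt (2 * r / ‖y - r • (θ : EuclideanSpace ℝ (Fin n))‖) * F y) ∂(sphereMeasure n)) := by
          rw [lintegral_const_mul' _ _ (by finiteness), lintegral_add_left measurable_const,
            lintegral_const_mul' _ _ (by finiteness), lintegral_one]
      _ ≤ ENNReal.ofReal (Real.exp (k * epsf f r)) * (sphereMeasure n Set.univ + ENNReal.ofReal (2 * (k / cconst n)) *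
            ENNReal.ofReal (C * ∫ y, F y)) := by
          refine mul_le_mul_right ?_ _
          refine add_le_add le_rfl (mul_le_mul_right hav' _)
      _ = _ := by
          have : sphereMeasure n Set.univ = ENNReal.ofReal (omegaN n) := (ENNReal.ofReal_toReal (measure_ne_top _ _)).symm
          rw [this, ENNReal.ofReal_mul (Real.exp_pos _).le, ENNReal.ofReal_add hω0.le (by positivity),
            ENNReal.ofReal_mul (p := 2 * (k / cconst n)) (by positivity)]

end

section
variable {n : ℕ}

theorem log_lip {a b : ℝ} (ha : 1 ≤ a) (hb : 1 ≤ b) : |Real.log a - Real.log b| ≤ |a - b| := by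
  have key : ∀ {a b : ℝ}, 1 ≤ a → 1 ≤ b → a ≤ b → Real.log b - Real.log a ≤ b - a := by
    intro a b ha hb hab
    rw [← Real.log_div (by linarith) (by linarith)]
    have h1 := Real.log_le_sub_one_of_pos (show 0 < b / a by apply div_pos <;> linarith)
    have h2 : b / a - 1 ≤ b - a := by
      rw [div_sub_one (by linarith), div_le_iff₀ (by linarith)]
      nlinarith
    linarith
  have mono : ∀ {a b : ℝ}, 1 ≤ a → a ≤ b → Real.log a ≤ Real.log b := fun h1 h2 =>
    Real.log_le_log (by linarith) h2
  rcases le_total a b with h | h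
  · rw [abs_of_nonpos (by linarith [mono ha h]), abs_of_nonpos (by linarith)]
    linarith [key ha hb h]
  · rw [abs_of_nonneg (by linarith [mono hb h]), abs_of_nonneg (by linarith)]
    linarith [key hb ha h]

theorem wt_hasDerivAt (hn : 2 ≤ n) {f : EuclideanSpace ℝ (Fin n) → ℝ} (hc : Continuous f) (hi : Integrable f)
    {r : ℝ} (hr : 1 < r) :
    HasDerivAt (wt f) (-(∫ y in ball 0 r, f y) / (cconst n * r)) r := by
  have hne : Nonempty (Fin n) := ⟨⟨0, by omega⟩⟩
  have hF := hasDerivAt_integral_of_dominated_loc_of_lip (μ := (volume : Measure (EuclideanSpace ℝ (Fin n))))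
    (F := fun r y => Real.log (max r ‖y‖ / max 1 ‖y‖) * f y)
    (F' := fun y => (ball (0 : EuclideanSpace ℝ (Fin n)) r).indicator (fun y => r⁻¹ * f y) y)
    (x₀ := r) (bound := fun y => ‖f y‖) (s := Set.Ioi 1) (Ioi_mem_nhds hr)
    (by
      filter_upwards [Ioi_mem_nhds hr] with r' hr'
      exact (wt_int hc hi (le_of_lt hr')).aestronglyMeasurable)
    (wt_int hc hi hr.le)
    ((hi.const_mul r⁻¹).indicator measurableSet_ball).aestronglyMeasurable
    (by
      refine ae_of_all _ fun y => ?_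
      refine LipschitzOnWith.of_dist_le_mul fun a ha b hb => ?_
      have ha : 1 < a := ha
      have hb : 1 < b := hb
      have h0 : (0:ℝ) < max 1 ‖y‖ := by positivity
      have ha1 : 1 ≤ max a ‖y‖ := ha.le.trans (le_max_left _ _)
      have hb1 : 1 ≤ max b ‖y‖ := hb.le.trans (le_max_left _ _)
      rw [Real.dist_eq, Real.dist_eq, ← sub_mul, Real.log_div (by linarith) h0.ne',
        Real.log_div (by linarith) h0.ne', sub_sub_sub_cancel_right]
      have h1 : |Real.log (max a ‖y‖) - Real.log (max b ‖y‖)| ≤ |a - b| :=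
        (log_lip ha1 hb1).trans (abs_max_sub_max_le_abs _ _ _)
      rw [Real.coe_nnabs, abs_norm, Real.norm_eq_abs, abs_mul, mul_comm]
      exact mul_le_mul_of_nonneg_left h1 (abs_nonneg _))
    hi.norm
    (by
      have hs : ∀ᵐ y : EuclideanSpace ℝ (Fin n), y ∉ sphere (0 : EuclideanSpace ℝ (Fin n)) r :=
        compl_mem_ae_iff.mpr (Measure.addHaar_sphere _ _ _)
      filter_upwards [hs] with y hy
      rw [mem_sphere_zero_iff_norm] at hy
      rcases lt_or_gt_of_ne hy with h | h
      · rw [Set.indicator_of_mem (by simpa using h)]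
        have h0 : (0:ℝ) < max 1 ‖y‖ := by positivity
        have h1 : HasDerivAt (fun r' => Real.log (r' / max 1 ‖y‖) * f y) (r⁻¹ * f y) r := by
          have := (((hasDerivAt_id r).div_const (max 1 ‖y‖)).log (by simp; constructor <;> [linarith; exact h0.ne'])).mul_const (f y)
          refine this.congr_deriv ?_
          simp only [id]
          field_simp
        refine h1.congr_of_eventuallyEq ?_
        filter_upwards [Ioi_mem_nhds h] with r' hr'
        rw [max_eq_left (le_of_lt hr')]
      · rw [Set.indicator_of_notMem (by simp; linarith)]
        refine (hasDerivAt_const r (Real.log (‖y‖ / max 1 ‖y‖) * f y)).congr_of_eventuallyEq ?_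
        filter_upwards [Iio_mem_nhds h] with r' hr'
        rw [max_eq_right (le_of_lt hr')])
  have h2 := (hF.2.neg).div_const (cconst n)
  refine h2.congr_deriv ?_
  rw [integral_indicator measurableSet_ball, integral_const_mul]
  have := cconst_pos n
  have hr0 : 0 < r := by linarith
  field_simp

theorem poly_dichotomy {H : EuclideanSpace ℝ (Fin n) → ℝ} {D : ℕ} {p : ℕ → EuclideanSpace ℝ (Fin n) → ℝ}
    (hp : ∀ k, Continuous (p k)) (hH : ∀ x (t : ℝ), H (t • x) = ∑ k ∈ Finset.range (D + 1), p k x * t ^ k) :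
    (∀ x, H x = H 0) ∨ ∃ κ > 0, ∃ T ≥ (1:ℝ), ∃ U : Set (sphere (0 : EuclideanSpace ℝ (Fin n)) 1), IsOpen U ∧ U.Nonempty ∧
      ((∀ θ ∈ U, ∀ r ≥ T, H (r • (θ : EuclideanSpace ℝ (Fin n))) ≤ -κ * r) ∨
       (∀ θ ∈ U, ∀ r ≥ T, κ * r ^ 2 ≤ H (r • (θ : EuclideanSpace ℝ (Fin n))))) := by
  classical
  by_cases hall : ∀ k, 1 ≤ k → k ≤ D → ∀ θ : sphere (0 : EuclideanSpace ℝ (Fin n)) 1, p k θ = 0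
  · left
    intro x
    by_cases hx : x = 0
    · rw [hx]
    · let θ : sphere (0 : EuclideanSpace ℝ (Fin n)) 1 := ⟨‖x‖⁻¹ • x, by simp [norm_smul, hx]⟩
      have h1 : ∀ t : ℝ, H (t • (θ : EuclideanSpace ℝ (Fin n))) = p 0 θ := by
        intro t
        rw [hH, Finset.sum_range_succ', Finset.sum_eq_zero]
        · simp
        · intro k hk
          rw [hall (k + 1) (by omega) (by simp at hk; omega) θ, zero_mul]
      have h2 := h1 0
      have h3 := h1 ‖x‖
      rw [zero_smul] at h2
      have h4 : ‖x‖ • (θ : EuclideanSpace ℝ (Fin n)) = x := smul_inv_smul₀ (norm_ne_zero_iff.mpr hx) x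
      rw [h4] at h3
      rw [h2, h3]
  right
  push Not at hall
  -- maximal degree
  let S : Finset ℕ := (Finset.range (D + 1)).filter fun k => 1 ≤ k ∧ ∃ θ : sphere (0 : EuclideanSpace ℝ (Fin n)) 1, p k θ ≠ 0
  have hS : S.Nonempty := by
    obtain ⟨k, h1, h2, θ, h3⟩ := hall
    exact ⟨k, by simp only [S, Finset.mem_filter, Finset.mem_range]; exact ⟨by omega, h1, θ, h3⟩⟩
  set d := S.max' hS with hd
  have hdS : d ∈ S := Finset.max'_mem _ _
  have hdS' := hdS
  simp only [S, Finset.mem_filter, Finset.mem_range] at hdS'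
  obtain ⟨hdD, hd1, θ1, hθ1⟩ := hdS'
  have hmax : ∀ k, d < k → k ≤ D → ∀ θ : sphere (0 : EuclideanSpace ℝ (Fin n)) 1, p k θ = 0 := by
    intro k hk hkD θ
    by_contra hne
    have : k ∈ S := by simp only [S, Finset.mem_filter, Finset.mem_range]; exact ⟨by omega, by omega, θ, hne⟩
    have := Finset.le_max' S k this
    omega
  have hform : ∀ (θ : sphere (0 : EuclideanSpace ℝ (Fin n)) 1) (t : ℝ), H (t • (θ : EuclideanSpace ℝ (Fin n))) =
      (∑ k ∈ Finset.range d, p k θ * t ^ k) + p d θ * t ^ d := by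
    intro θ t
    rw [hH, ← Finset.sum_range_succ]
    symm
    apply Finset.sum_subset
    · intro k hk; simp at hk ⊢; omega
    · intro k hk hk'
      simp at hk hk'
      rw [hmax k (by omega) (by omega), zero_mul]
  obtain ⟨B, hB⟩ : ∃ B : ℝ, ∀ θ : sphere (0 : EuclideanSpace ℝ (Fin n)) 1, ∑ k ∈ Finset.range d, |p k θ| ≤ B := by
    have hcont : Continuous fun θ : sphere (0 : EuclideanSpace ℝ (Fin n)) 1 => ∑ k ∈ Finset.range d, |p k θ| :=
      continuous_finsetSum _ fun k _ => ((hp k).comp continuous_subtype_val).abs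
    obtain ⟨B, hB⟩ := (isCompact_range hcont).bddAbove
    exact ⟨B, fun θ => hB ⟨θ, rfl⟩⟩
  have hlow : ∀ (θ : sphere (0 : EuclideanSpace ℝ (Fin n)) 1) (r : ℝ), 1 ≤ r →
      |∑ k ∈ Finset.range d, p k θ * r ^ k| ≤ B * r ^ (d - 1) := by
    intro θ r hr
    refine (Finset.abs_sum_le_sum_abs _ _).trans ?_
    calc _ ≤ ∑ k ∈ Finset.range d, |p k θ| * r ^ (d - 1) := by
          refine Finset.sum_le_sum fun k hk => ?_
          rw [abs_mul, abs_of_nonneg (show (0:ℝ) ≤ r ^ k by positivity)]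
          simp at hk
          gcongr
          omega
      _ = (∑ k ∈ Finset.range d, |p k θ|) * r ^ (d - 1) := by rw [Finset.sum_mul]
      _ ≤ _ := by gcongr; exact hB θ
  have hB0 : 0 ≤ B := (Finset.sum_nonneg fun _ _ => abs_nonneg _).trans (hB θ1)
  have hpd : Continuous fun θ : sphere (0 : EuclideanSpace ℝ (Fin n)) 1 => p d θ := (hp d).comp continuous_subtype_val
  by_cases hneg : ∃ θ0 : sphere (0 : EuclideanSpace ℝ (Fin n)) 1, p d θ0 < 0
  · obtain ⟨θ0, h0⟩ := hneg
    set a := -p d θ0 / 2 with ha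
    have ha0 : 0 < a := by rw [ha]; linarith
    refine ⟨a / 2, by linarith, max 1 (2 * B / a), le_max_left _ _, {θ | p d θ < -a}, isOpen_lt hpd continuous_const, ⟨θ0, ?_⟩, Or.inl ?_⟩
    · simp only [Set.mem_ofPred_eq]; linarith
    · intro θ hθ r hr
      have hr1 : 1 ≤ r := (le_max_left _ _).trans hr
      have hr2 : 2 * B / a ≤ r := (le_max_right _ _).trans hr
      rw [div_le_iff₀ ha0] at hr2
      have hθ : p d θ < -a := hθ
      rw [hform]
      have h3 := (abs_le.mp (hlow θ r hr1)).2
      have h4 : r ^ d = r ^ (d - 1) * r := by rw [← pow_succ]; congr 1; omega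
      have h5 : 1 ≤ r ^ (d - 1) := one_le_pow₀ hr1
      rw [h4]
      have h6 : p d θ * (r ^ (d - 1) * r) ≤ -a * (r ^ (d - 1) * r) := by
        apply mul_le_mul_of_nonneg_right hθ.le; positivity
      have h7 : B * r ^ (d - 1) ≤ (a * r / 2) * r ^ (d - 1) := by
        apply mul_le_mul_of_nonneg_right _ (by positivity); linarith
      have h8 : a * r / 2 * 1 ≤ a * r / 2 * r ^ (d - 1) := by
        apply mul_le_mul_of_nonneg_left h5; positivity
      linarith
  · push Not at hneg
    have h1 : 0 < p d θ1 := lt_of_le_of_ne (hneg θ1) (Ne.symm hθ1)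
    have hd2 : 2 ≤ d := by
      by_contra hlt
      have hd1' : d = 1 := by omega
      let θ2 : sphere (0 : EuclideanSpace ℝ (Fin n)) 1 := -θ1
      have e1 := hform θ2 1
      have e2 := hform θ1 (-1)
      have e3 := hform θ1 0
      have e4 := hform θ2 0
      have h2 := hneg θ2
      have e5 : (θ2 : EuclideanSpace ℝ (Fin n)) = -(θ1 : EuclideanSpace ℝ (Fin n)) := rfl
      rw [hd1'] at e1 e2 e3 e4 h2 h1
      simp [e5] at e1 e2 e3 e4 h2
      linarith
    set a := p d θ1 / 2 with ha
    have ha0 : 0 < a := by rw [ha]; linarith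
    refine ⟨a / 2, by linarith, max 1 (2 * B / a), le_max_left _ _, {θ | a < p d θ}, isOpen_lt continuous_const hpd, ⟨θ1, ?_⟩, Or.inr ?_⟩
    · simp only [Set.mem_ofPred_eq]; linarith
    · intro θ hθ r hr
      have hr1 : 1 ≤ r := (le_max_left _ _).trans hr
      have hr2 : 2 * B / a ≤ r := (le_max_right _ _).trans hr
      rw [div_le_iff₀ ha0] at hr2
      have hθ : a < p d θ := hθ
      rw [hform]
      have h3 := (abs_le.mp (hlow θ r hr1)).1
      have h4 : r ^ d = r ^ (d - 1) * r := by rw [← pow_succ]; congr 1; omega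
      have h5 : r ^ 2 ≤ r ^ d := pow_le_pow_right₀ hr1 hd2
      rw [h4] at h5 ⊢
      have h6 : a * (r ^ (d - 1) * r) ≤ p d θ * (r ^ (d - 1) * r) := by
        apply mul_le_mul_of_nonneg_right hθ.le; positivity
      have h7 : B * r ^ (d - 1) ≤ (a * r / 2) * r ^ (d - 1) := by
        apply mul_le_mul_of_nonneg_right _ (by positivity); linarith
      have h8 := mul_le_mul_of_nonneg_left h5 (show 0 ≤ a / 2 by linarith)
      linarith

end

section
variable {n : ℕ}

theorem sphere_open_pos (hn : 2 ≤ n) {U : Set (sphere (0 : EuclideanSpace ℝ (Fin n)) 1)} (hU : IsOpen U)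
    (hUn : U.Nonempty) : sphereMeasure n U ≠ 0 := by
  unfold sphereMeasure
  exact (hU.measure_pos _ hUn).ne'

theorem exp_avg_continuous {f : EuclideanSpace ℝ (Fin n) → ℝ} (hE : Continuous (Epot f)) (k r : ℝ) :
    Continuous fun θ : sphere (0 : EuclideanSpace ℝ (Fin n)) 1 =>
      Real.exp (k * (Epot f (r • (θ : EuclideanSpace ℝ (Fin n))) / cconst n - wt f r)) := by
  have : Continuous fun θ : sphere (0 : EuclideanSpace ℝ (Fin n)) 1 => Epot f (r • (θ : EuclideanSpace ℝ (Fin n))) :=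
    hE.comp (by fun_prop)
  fun_prop

theorem complete_contra (hn : 2 ≤ n) {u f : EuclideanSpace ℝ (Fin n) → ℝ} (hu : Continuous u)
    (hc : Continuous f) (hi : Integrable f)
    (hE : Continuous (Epot f)) {R0 : ℝ} (hf0 : ∀ y, R0 ≤ ‖y‖ → 0 ≤ f y)
    (hcomplete : ∀ θ : EuclideanSpace ℝ (Fin n), ‖θ‖ = 1 →
      ∫⁻ r in Set.Ioi (0 : ℝ), ENNReal.ofReal (Real.exp (u (r • θ))) = ⊤)
    {U : Set (sphere (0 : EuclideanSpace ℝ (Fin n)) 1)} (hU : IsOpen U) (hUn : U.Nonempty) {T : ℝ}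
    {P : ℝ → ℝ≥0∞} (hP : ∫⁻ r in Set.Ioi T, P r < ⊤)
    (hb : ∀ θ ∈ U, ∀ r > T, ENNReal.ofReal (Real.exp (u (r • (θ : EuclideanSpace ℝ (Fin n))))) ≤
      P r * ENNReal.ofReal (Real.exp (1 * (Epot f (r • (θ : EuclideanSpace ℝ (Fin n))) / cconst n - wt f r)))) : False := by
  have hav := pot_avg hn hc hi hE hf0 (k := 1) one_pos
  have hω := omegaN_pos hn
  obtain ⟨T1, hT1⟩ := eventually_atTop.mp (hav.eventually_le_const (show omegaN n < 2 * omegaN n by linarith))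
  set T' := max (max T T1) 0 with hT'
  have hTT : T ≤ T' := (le_max_left _ _).trans (le_max_left _ _)
  have hT1' : T1 ≤ T' := (le_max_right _ _).trans (le_max_left _ _)
  have hT0 : 0 ≤ T' := le_max_right _ _
  have hmeas : Measurable fun q : (sphere (0 : EuclideanSpace ℝ (Fin n)) 1) × ℝ =>
      ENNReal.ofReal (Real.exp (u (q.2 • (q.1 : EuclideanSpace ℝ (Fin n))))) := by
    have : Continuous fun q : (sphere (0 : EuclideanSpace ℝ (Fin n)) 1) × ℝ =>
      Real.exp (u (q.2 • (q.1 : EuclideanSpace ℝ (Fin n)))) := Real.continuous_exp.comp (hu.comp (by fun_prop))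
    exact this.measurable.ennreal_ofReal
  have hin : ∀ θ : sphere (0 : EuclideanSpace ℝ (Fin n)) 1,
      ∫⁻ r in Set.Ioi T', ENNReal.ofReal (Real.exp (u (r • (θ : EuclideanSpace ℝ (Fin n))))) = ⊤ := by
    intro θ
    have h1 := hcomplete θ (by simp)
    rw [← Set.Ioc_union_Ioi_eq_Ioi hT0, lintegral_union measurableSet_Ioi (Set.Ioc_disjoint_Ioi le_rfl)] at h1
    have hcu : Continuous fun r : ℝ => Real.exp (u (r • (θ : EuclideanSpace ℝ (Fin n)))) :=
      Real.continuous_exp.comp (hu.comp (by fun_prop))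
    have h2 : IntegrableOn (fun r : ℝ => Real.exp (u (r • (θ : EuclideanSpace ℝ (Fin n))))) (Set.Ioc 0 T') :=
      (hcu.continuousOn.integrableOn_compact isCompact_Icc).mono_set Set.Ioc_subset_Icc_self
    have h3 : ∫⁻ r in Set.Ioc 0 T', ENNReal.ofReal (Real.exp (u (r • (θ : EuclideanSpace ℝ (Fin n))))) ≠ ⊤ := by
      rw [← ofReal_integral_eq_lintegral_ofReal h2 (ae_of_all _ fun _ => (Real.exp_pos _).le)]
      exact ENNReal.ofReal_ne_top
    exact (ENNReal.add_eq_top.mp h1).resolve_left h3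
  have hJ : ∫⁻ θ in U, (∫⁻ r in Set.Ioi T', ENNReal.ofReal (Real.exp (u (r • (θ : EuclideanSpace ℝ (Fin n)))))) ∂(sphereMeasure n) = ⊤ := by
    simp only [hin, lintegral_const, Measure.restrict_apply_univ]
    exact ENNReal.top_mul (sphere_open_pos hn hU hUn)
  rw [lintegral_lintegral_swap hmeas.aemeasurable] at hJ
  have hle : ∫⁻ r in Set.Ioi T', (∫⁻ θ in U, ENNReal.ofReal (Real.exp (u (r • (θ : EuclideanSpace ℝ (Fin n))))) ∂(sphereMeasure n)) ≤
      (∫⁻ r in Set.Ioi T, P r) * ENNReal.ofReal (2 * omegaN n) := by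
    rw [← lintegral_mul_const' _ _ ENNReal.ofReal_ne_top]
    refine le_trans ?_ (lintegral_mono_set (Set.Ioi_subset_Ioi hTT))
    refine setLIntegral_mono' measurableSet_Ioi fun r hr => ?_
    have hr : T' < r := hr
    calc _ ≤ ∫⁻ θ in U, P r * ENNReal.ofReal (Real.exp (1 * (Epot f (r • (θ : EuclideanSpace ℝ (Fin n))) / cconst n - wt f r))) ∂(sphereMeasure n) :=
          setLIntegral_mono' hU.measurableSet fun θ hθ => hb θ hθ r (lt_of_le_of_lt hTT hr)
      _ ≤ ∫⁻ θ, P r * ENNReal.ofReal (Real.exp (1 * (Epot f (r • (θ : EuclideanSpace ℝ (Fin n))) / cconst n - wt f r))) ∂(sphereMeasure n) :=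
          setLIntegral_le_lintegral _ _
      _ = P r * ∫⁻ θ, ENNReal.ofReal (Real.exp (1 * (Epot f (r • (θ : EuclideanSpace ℝ (Fin n))) / cconst n - wt f r))) ∂(sphereMeasure n) := by
          rw [lintegral_const_mul _ (exp_avg_continuous hE 1 r).measurable.ennreal_ofReal]
      _ ≤ P r * ENNReal.ofReal (2 * omegaN n) := by
          refine mul_le_mul_right ?_ _
          rw [← ofReal_integral_eq_lintegral_ofReal
            ((exp_avg_continuous hE 1 r).integrable_of_hasCompactSupport (HasCompactSupport.of_compactSpace _))
            (ae_of_all _ fun _ => (Real.exp_pos _).le)]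
          exact ENNReal.ofReal_le_ofReal (hT1 r (by linarith))
  rw [hJ] at hle
  exact absurd hle (not_le.mpr (ENNReal.mul_lt_top hP ENNReal.ofReal_lt_top))

theorem cone_contra (hn : 2 ≤ n) {u : EuclideanSpace ℝ (Fin n) → ℝ} (hu : Continuous u) {δ : ℝ}
    (hi : Integrable fun x : EuclideanSpace ℝ (Fin n) => Real.exp (n * u x - δ * ‖x‖ ^ 2))
    {U : Set (sphere (0 : EuclideanSpace ℝ (Fin n)) 1)} (hU : IsOpen U) (hUn : U.Nonempty) {T : ℝ} (hT : 1 ≤ T)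
    (hb : ∀ θ ∈ U, ∀ r > T, δ * r ^ 2 ≤ n * u (r • (θ : EuclideanSpace ℝ (Fin n)))) : False := by
  have hcu : Continuous fun x : EuclideanSpace ℝ (Fin n) => Real.exp (n * u x - δ * ‖x‖ ^ 2) := by fun_prop
  have h1 : ∫⁻ x, ENNReal.ofReal (Real.exp (n * u x - δ * ‖x‖ ^ 2)) < ⊤ := by
    rw [← ofReal_integral_eq_lintegral_ofReal hi (ae_of_all _ fun _ => (Real.exp_pos _).le)]
    exact ENNReal.ofReal_lt_top
  rw [polar_lintegral hn hcu.measurable.ennreal_ofReal] at h1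
  refine absurd h1 (not_lt.mpr ?_)
  calc ⊤ = ∫⁻ θ in U, (∫⁻ r in Set.Ioi T, 1) ∂(sphereMeasure n) := by
        simp only [lintegral_const, Measure.restrict_apply_univ, Real.volume_Ioi, one_mul]
        exact (ENNReal.top_mul (sphere_open_pos hn hU hUn)).symm
    _ ≤ ∫⁻ θ in U, (∫⁻ r in Set.Ioi (0:ℝ), ENNReal.ofReal (r ^ (n - 1)) *
          ENNReal.ofReal (Real.exp (n * u (r • (θ : EuclideanSpace ℝ (Fin n))) - δ * ‖r • (θ : EuclideanSpace ℝ (Fin n))‖ ^ 2))) ∂(sphereMeasure n) := by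
        refine setLIntegral_mono' hU.measurableSet fun θ hθ => ?_
        refine le_trans ?_ (lintegral_mono_set (Set.Ioi_subset_Ioi (show (0:ℝ) ≤ T by linarith)))
        refine setLIntegral_mono' measurableSet_Ioi fun r hr => ?_
        have hr : T < r := hr
        have h2 := hb θ hθ r hr
        have h3 : ‖r • (θ : EuclideanSpace ℝ (Fin n))‖ = r := by rw [norm_smul]; simp; linarith
        rw [h3, ← ENNReal.ofReal_mul (pow_nonneg (by linarith) _), ← ENNReal.ofReal_one]
        apply ENNReal.ofReal_le_ofReal
        have h4 : 1 ≤ r ^ (n - 1) := one_le_pow₀ (by linarith)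
        have h5 : 1 ≤ Real.exp (n * u (r • (θ : EuclideanSpace ℝ (Fin n))) - δ * r ^ 2) := by
          rw [Real.one_le_exp_iff]; linarith
        nlinarith
    _ ≤ _ := setLIntegral_le_lintegral _ _

theorem log_le_ev {A κ : ℝ} (hA : 0 ≤ A) (hκ : 0 < κ) : ∀ᶠ r : ℝ in atTop, A * Real.log r ≤ κ * r := by
  have h1 := Real.isLittleO_log_id_atTop.def (show 0 < κ / (A + 1) by positivity)
  filter_upwards [h1, eventually_ge_atTop 1] with r hr hr1
  simp only [id, Real.norm_eq_abs] at hr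
  rw [abs_of_nonneg (Real.log_nonneg hr1), abs_of_nonneg (by linarith)] at hr
  have h2 : 0 ≤ Real.log r := Real.log_nonneg hr1
  calc A * Real.log r ≤ (A + 1) * (κ / (A + 1) * r) := by
        apply mul_le_mul (by linarith) hr h2 (by linarith)
    _ = κ * r := by field_simp

theorem h_const {m : ℕ} (hm : 1 ≤ m) (hn : n = 2 * m) {u f : EuclideanSpace ℝ (Fin n) → ℝ}
    (hu : ContDiff ℝ (⊤ : ℕ∞) u) (hPDE : ∀ x, negLapIter m u x = 2 * f x)
    (hc : Continuous f) (hi : Integrable f) (hE : Continuous (Epot f))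
    {R0 : ℝ} (hf0 : ∀ y, R0 ≤ ‖y‖ → 0 ≤ f y)
    (hexp : ∀ δ > (0:ℝ), Integrable fun x => Real.exp (n * u x - δ * ‖x‖ ^ 2))
    (hcomplete : ∀ θ : EuclideanSpace ℝ (Fin n), ‖θ‖ = 1 →
      ∫⁻ r in Set.Ioi (0 : ℝ), ENNReal.ofReal (Real.exp (u (r • θ))) = ⊤) :
    ∀ x, hfun u f x = hfun u f 0 := by
  have hn2 : 2 ≤ n := by omega
  obtain ⟨p, hp, hH⟩ := hfun_poly hm hn hu hPDE hc hi (by simpa using hexp 1 one_pos)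
  rcases poly_dichotomy hp hH with h | ⟨κ, hκ, T, hT, U, hU, hUn, h⟩
  · exact h
  exfalso
  set A := (∫ y, ‖f y‖) / cconst n with hA
  have hA0 : 0 ≤ A := div_nonneg (integral_nonneg fun _ => norm_nonneg _) (cconst_pos n).le
  have hdec : ∀ x, u x = hfun u f x + Epot f x / cconst n := fun x => by unfold hfun; ring
  rcases h with h | h
  · obtain ⟨T1, hT1⟩ := eventually_atTop.mp (log_le_ev hA0 (show 0 < κ / 2 by linarith))
    refine complete_contra hn2 hu.continuous hc hi hE hf0 hcomplete hU hUn (T := max T T1)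
      (P := fun r => ENNReal.ofReal (Real.exp (-(κ / 2) * r))) ?_ ?_
    · rw [← ofReal_integral_eq_lintegral_ofReal (exp_neg_integrableOn_Ioi _ (by linarith)) (ae_of_all _ fun _ => (Real.exp_pos _).le)]
      exact ENNReal.ofReal_lt_top
    · intro θ hθ r hr
      have hrT : T < r := lt_of_le_of_lt (le_max_left _ _) hr
      have hrT1 : T1 < r := lt_of_le_of_lt (le_max_right _ _) hr
      rw [← ENNReal.ofReal_mul (Real.exp_pos _).le, ← Real.exp_add]
      apply ENNReal.ofReal_le_ofReal
      rw [Real.exp_le_exp, hdec]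
      have h1 := h θ hθ r hrT.le
      have h2 := hT1 r hrT1.le
      have h3 := (abs_le.mp (wt_bound (n := n) hi (r := r) (by linarith))).2
      linarith
  · have hε := (epsf_tendsto hc hi).eventually_le_const (show (0:ℝ) < κ / 4 by linarith)
    obtain ⟨T1, hT1⟩ := eventually_atTop.mp ((log_le_ev hA0 (show 0 < κ / 4 by linarith)).and hε)
    refine cone_contra hn2 hu.continuous (hexp (κ / 2) (by linarith)) hU hUn (T := max (max T T1) (2 * R0)) 
      (hT.trans ((le_max_left _ _).trans (le_max_left _ _))) ?_
    intro θ hθ r hr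
    have hrR : 2 * R0 < r := lt_of_le_of_lt (le_max_right _ _) hr
    have hr' := lt_of_le_of_lt (le_max_left _ _) hr
    have hrT : T < r := lt_of_le_of_lt (le_max_left _ _) hr'
    have hrT1 : T1 < r := lt_of_le_of_lt (le_max_right _ _) hr'
    have h1 := h θ hθ r hrT.le
    have h2 := hT1 r hrT1.le
    have h3 := (abs_le.mp (wt_bound (n := n) hi (r := r) (by linarith))).1
    have hnr : ‖r • (θ : EuclideanSpace ℝ (Fin n))‖ = r := by rw [norm_smul]; simp; linarith
    have h4 := pot_lower hn2 hc hi hf0 (x := r • (θ : EuclideanSpace ℝ (Fin n))) (by rw [hnr]; linarith) (by rw [hnr]; linarith)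
    rw [hnr] at h4
    have h5 : r ≤ r ^ 2 := by nlinarith
    have h6 : κ / 2 * r ^ 2 ≤ u (r • (θ : EuclideanSpace ℝ (Fin n))) := by
      rw [hdec]
      have h7 : κ / 4 ≤ κ / 4 * r ^ 2 := by nlinarith
      have h8 : κ / 4 * r ≤ κ / 4 * r ^ 2 := by nlinarith
      linarith [h2.1, h2.2]
    have h9 : (1:ℝ) ≤ n := by exact_mod_cast (show 1 ≤ n by omega)
    nlinarith [mul_nonneg (show 0 ≤ κ / 2 by linarith) (sq_nonneg r)]

theorem ball_tendsto {f : EuclideanSpace ℝ (Fin n) → ℝ} (hi : Integrable f) :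
    Tendsto (fun r : ℝ => ∫ y in ball 0 r, f y) atTop (𝓝 (∫ y, f y)) :=
  (aecover_ball (tendsto_id (α := ℝ) (x := atTop))).integral_tendsto_of_countably_generated hi

theorem alpha_le_one (hn2 : 2 ≤ n) {u f : EuclideanSpace ℝ (Fin n) → ℝ} (hu : Continuous u)
    (hc : Continuous f) (hi : Integrable f) (hE : Continuous (Epot f))
    {R0 : ℝ} (hf0 : ∀ y, R0 ≤ ‖y‖ → 0 ≤ f y) {b : ℝ} (hub : ∀ x, u x = b + Epot f x / cconst n)
    (hcomplete : ∀ θ : EuclideanSpace ℝ (Fin n), ‖θ‖ = 1 →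
      ∫⁻ r in Set.Ioi (0 : ℝ), ENNReal.ofReal (Real.exp (u (r • θ))) = ⊤) :
    (∫ y, f y) / cconst n ≤ 1 := by
  by_contra hlt
  push Not at hlt
  have hne : Nonempty (Fin n) := ⟨⟨0, by omega⟩⟩
  have hcp := cconst_pos n
  set α := (∫ y, f y) / cconst n with hα
  set η := (α - 1) / 2 with hη
  have hη0 : 0 < η := by rw [hη]; linarith
  have h1 := ((ball_tendsto hi).div_const (cconst n)).eventually_const_le (show 1 + η < α by rw [hη]; linarith)
  obtain ⟨T0, hT0⟩ := eventually_atTop.mp h1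
  set T := max T0 2 with hT
  have hT1 : 2 ≤ T := le_max_right _ _
  have hder : ∀ r, T ≤ r → HasDerivAt (fun r => wt f r + (1 + η) * Real.log r)
      (-(∫ y in ball 0 r, f y) / (cconst n * r) + (1 + η) * r⁻¹) r := fun r hr =>
    (wt_hasDerivAt hn2 hc hi (by linarith)).add ((Real.hasDerivAt_log (by linarith)).const_mul _)
  have hanti : AntitoneOn (fun r => wt f r + (1 + η) * Real.log r) (Set.Ici T) := by
    refine antitoneOn_of_deriv_nonpos (convex_Ici T) (fun r hr => (hder r hr).continuousAt.continuousWithinAt)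
      (fun r hr => ?_) (fun r hr => ?_)
    · rw [interior_Ici] at hr
      exact (hder r (le_of_lt hr)).differentiableAt.differentiableWithinAt
    · rw [interior_Ici] at hr
      have hr : T < r := hr
      have hr0 : 0 < r := by linarith
      rw [(hder r hr.le).deriv]
      have h2 := hT0 r ((le_max_left _ _).trans hr.le)
      have h3 : -(∫ y in ball 0 r, f y) / (cconst n * r) + (1 + η) * r⁻¹ = ((1 + η) - (∫ y in ball 0 r, f y) / cconst n) / r := by
        field_simp; ring
      rw [h3]
      exact div_nonpos_of_nonpos_of_nonneg (by linarith) hr0.le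
  set C := wt f T + (1 + η) * Real.log T with hC
  have hsne : (Set.univ : Set (sphere (0 : EuclideanSpace ℝ (Fin n)) 1)).Nonempty := by
    obtain ⟨e, he, _⟩ := exists_unit_orth hn2 (0 : EuclideanSpace ℝ (Fin n))
    exact ⟨⟨e, by simpa using he⟩, trivial⟩
  refine complete_contra hn2 hu hc hi hE hf0 hcomplete isOpen_univ hsne (T := T)
      (P := fun r => ENNReal.ofReal (Real.exp (b + C) * r ^ (-(1 + η)))) ?_ ?_
  · have := (integrableOn_Ioi_rpow_of_lt (show -(1 + η) < -1 by linarith) (show 0 < T by linarith)).const_mul (Real.exp (b + C))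
    rw [← ofReal_integral_eq_lintegral_ofReal this]
    · exact ENNReal.ofReal_lt_top
    · filter_upwards [ae_restrict_mem measurableSet_Ioi] with r hr
      have hr : T < r := hr
      have : 0 < r := by linarith
      positivity
  · intro θ _ r hr
    have hr0 : 0 < r := by linarith
    rw [← ENNReal.ofReal_mul (by positivity)]
    apply ENNReal.ofReal_le_ofReal
    rw [Real.rpow_def_of_pos hr0, ← Real.exp_add, ← Real.exp_add, Real.exp_le_exp, hub]
    have h4 : wt f r + (1 + η) * Real.log r ≤ C := hanti (Set.mem_Ici.mpr le_rfl) (Set.mem_Ici.mpr hr.le) hr.le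
    linarith

end

section
variable {n : ℕ}

theorem barrier {q q' : ℝ → ℝ} {T M c m0 : ℝ} (hT : 0 < T) (hc : 0 < c)
    (hd : ∀ r, T ≤ r → HasDerivAt q (q' r) r) (hm : ∀ r, T ≤ r → m0 ≤ q r)
    (hq : ∀ r, T ≤ r → M ≤ q r → q' r ≤ -c / r) : ∀ᶠ r in atTop, q r ≤ M := by
  have hex : ∃ r1, T ≤ r1 ∧ q r1 ≤ M := by
    by_contra hne
    push Not at hne
    have hanti : AntitoneOn (fun r => q r + c * Real.log r) (Set.Ici T) := by
      have hder : ∀ r, T ≤ r → HasDerivAt (fun r => q r + c * Real.log r) (q' r + c * r⁻¹) r :=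
        fun r hr => (hd r hr).add ((Real.hasDerivAt_log (by linarith)).const_mul _)
      refine antitoneOn_of_deriv_nonpos (convex_Ici T)
        (fun r hr => (hder r hr).continuousAt.continuousWithinAt) (fun r hr => ?_) (fun r hr => ?_)
      · rw [interior_Ici] at hr
        exact (hder r (le_of_lt hr)).differentiableAt.differentiableWithinAt
      · rw [interior_Ici] at hr
        have hr : T < r := hr
        rw [(hder r hr.le).deriv]
        have := hq r hr.le (hne r hr.le).le
        have h3 : -c / r = - (c * r⁻¹) := by ring
        linarith
    have h1 : Tendsto (fun r => c * Real.log r) atTop atTop :=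
      Real.tendsto_log_atTop.const_mul_atTop hc
    obtain ⟨r, hr1, hr2⟩ := ((h1.eventually_gt_atTop (q T + c * Real.log T - m0)).and
      (eventually_ge_atTop T)).exists
    have h2 : q r + c * Real.log r ≤ q T + c * Real.log T :=
      hanti (Set.mem_Ici.mpr le_rfl) (Set.mem_Ici.mpr hr2) hr2
    have := hm r hr2
    linarith
  obtain ⟨r1, hr1, hq1⟩ := hex
  filter_upwards [eventually_ge_atTop r1] with r hr
  refine image_le_of_deriv_right_lt_deriv_boundary (f := q) (f' := q') (a := r1) (b := r)
    (B := fun _ => M) (B' := fun _ => 0)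
    (fun x hx => (hd x (hr1.trans hx.1)).continuousAt.continuousWithinAt)
    (fun x hx => (hd x (hr1.trans hx.1)).hasDerivWithinAt) hq1 (fun x => hasDerivAt_const x M)
    (fun x hx h => ?_) (Set.right_mem_Icc.mpr hr)
  have hx0 : 0 < x := by linarith [hx.1]
  have := hq x (hr1.trans hx.1) h.ge
  have h4 : -c / x < 0 := div_neg_of_neg_of_pos (by linarith) hx0
  linarith

/-- logistic-type equation -/
theorem logistic {q A γ : ℝ → ℝ} {T N L : ℝ} (hT : 0 < T) (hN : 0 < N) (hL : 0 ≤ L)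
    (hq0 : ∀ r, T ≤ r → 0 < q r)
    (hd : ∀ r, T ≤ r → HasDerivAt q (N * A r * q r * (γ r - q r) / r) r)
    (hA : Tendsto A atTop (𝓝 1)) (hγ : Tendsto γ atTop (𝓝 L)) : Tendsto q atTop (𝓝 L) := by
  have up : ∀ ε > 0, ∀ᶠ r in atTop, q r ≤ L + 2 * ε := by
    intro ε hε
    obtain ⟨T1, hT1⟩ := eventually_atTop.mp ((hA.eventually_const_le (show (1/2 : ℝ) < 1 by norm_num)).and
      (hγ.eventually_le_const (show L < L + ε by linarith)))
    refine barrier (T := max T T1) (c := N / 2 * (L + 2 * ε) * ε) (m0 := 0) (lt_max_of_lt_left hT) (by positivity)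
      (fun r hr => hd r ((le_max_left _ _).trans hr))
      (fun r hr => (hq0 r ((le_max_left _ _).trans hr)).le) (fun r hr hqr => ?_)
    have hrT := (le_max_left _ _).trans hr
    have hr0 : 0 < r := by linarith
    obtain ⟨h1, h2⟩ := hT1 r ((le_max_right _ _).trans hr)
    apply div_le_div_of_nonneg_right _ hr0.le
    have h3 : N / 2 * (L + 2 * ε) ≤ N * A r * q r := by
      have : N / 2 ≤ N * A r := by nlinarith
      exact mul_le_mul this hqr (by positivity) (by nlinarith)
    have h4 : ε ≤ q r - γ r := by linarith
    have h5 := mul_le_mul h3 h4 hε.le ((by positivity : 0 ≤ N / 2 * (L + 2 * ε)).trans h3)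
    linarith
  have low : ∀ l, l < L → ∀ᶠ r in atTop, l ≤ q r := by
    intro l hl
    rcases le_or_gt l 0 with h0 | h0
    · filter_upwards [eventually_ge_atTop T] with r hr using h0.trans (hq0 r hr).le
    obtain ⟨T1, hT1⟩ := eventually_atTop.mp (((hA.eventually_const_le (show (1/2 : ℝ) < 1 by norm_num)).and
      (hγ.eventually_const_le (show (L + l) / 2 < L by linarith))).and (up 1 one_pos))
    have := barrier (q := fun r => - Real.log (q r)) (q' := fun r => -(N * A r * (γ r - q r) / r))
      (T := max T T1) (c := N / 2 * ((L - l) / 2)) (m0 := - Real.log (L + 2 * 1)) (M := - Real.log l)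
      (lt_max_of_lt_left hT) (by have : 0 < L - l := by linarith
                                 positivity)
      (fun r hr => ?_) (fun r hr => ?_) (fun r hr hqr => ?_)
    · filter_upwards [this, eventually_ge_atTop T] with r hr hrT
      exact (Real.log_le_log_iff h0 (hq0 r hrT)).mp (by linarith)
    · have hrT := (le_max_left _ _).trans hr
      have hp := hq0 r hrT
      have hr0 : 0 < r := by linarith
      refine (((hd r hrT).log hp.ne').neg).congr_deriv ?_
      field_simp
    · have hrT := (le_max_left _ _).trans hr
      have hp := hq0 r hrT
      have := Real.log_le_log hp (hT1 r ((le_max_right _ _).trans hr)).2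
      linarith
    · have hrT := (le_max_left _ _).trans hr
      have hp := hq0 r hrT
      have hr0 : 0 < r := by linarith
      obtain ⟨⟨h1, h2⟩, -⟩ := hT1 r ((le_max_right _ _).trans hr)
      have h3 : q r ≤ l := (Real.log_le_log_iff hp h0).mp (by linarith)
      rw [← neg_div]
      apply div_le_div_of_nonneg_right _ hr0.le
      have h4 : N / 2 ≤ N * A r := by nlinarith
      have h5 := mul_le_mul h4 (show (L - l) / 2 ≤ γ r - q r by linarith) (by linarith) (by linarith)
      linarith
  refine tendsto_order.mpr ⟨fun l hl => ?_, fun l hl => ?_⟩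
  · filter_upwards [low ((l + L) / 2) (by linarith)] with r hr
    linarith
  · filter_upwards [up ((l - L) / 4) (by linarith)] with r hr
    linarith

theorem vol_polar (hn : 2 ≤ n) {G : EuclideanSpace ℝ (Fin n) → ℝ} (hG : Continuous G)
    (hG0 : ∀ x, 0 ≤ G x) {r : ℝ} (hr : 0 ≤ r) :
    ∫ y in ball (0 : EuclideanSpace ℝ (Fin n)) r, G y =
      ∫ s in (0:ℝ)..r, s ^ (n - 1) * ∫ θ, G (s • (θ : EuclideanSpace ℝ (Fin n))) ∂(sphereMeasure n) := by
  have hnorm : ∀ (s : ℝ) (θ : sphere (0 : EuclideanSpace ℝ (Fin n)) 1), 0 < s →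
      ‖s • (θ : EuclideanSpace ℝ (Fin n))‖ = s := by
    intro s θ hs
    rw [norm_smul]; simp; linarith
  have hI : ∀ s : ℝ, Integrable (fun θ : sphere (0 : EuclideanSpace ℝ (Fin n)) 1 =>
      G (s • (θ : EuclideanSpace ℝ (Fin n)))) (sphereMeasure n) := by
    intro s
    exact (by fun_prop : Continuous (fun θ : sphere (0 : EuclideanSpace ℝ (Fin n)) 1 =>
      G (s • (θ : EuclideanSpace ℝ (Fin n))))).integrable_of_hasCompactSupport (HasCompactSupport.of_compactSpace _)
  have hmeas : Measurable (fun p : (sphere (0 : EuclideanSpace ℝ (Fin n)) 1) × ℝ =>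
      ENNReal.ofReal (G (p.2 • (p.1 : EuclideanSpace ℝ (Fin n))))) := by
    have : Continuous (fun p : (sphere (0 : EuclideanSpace ℝ (Fin n)) 1) × ℝ =>
      G (p.2 • (p.1 : EuclideanSpace ℝ (Fin n)))) := by fun_prop
    exact this.measurable.ennreal_ofReal
  rw [intervalIntegral.integral_of_le hr, integral_eq_lintegral_of_nonneg_ae (ae_of_all _ hG0)
    hG.aestronglyMeasurable, integral_eq_lintegral_of_nonneg_ae]
  · congr 1
    rw [← lintegral_indicator measurableSet_ball, polar_lintegral hn
      (hG.measurable.ennreal_ofReal.indicator measurableSet_ball), ]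
    have e1 : ∀ θ : sphere (0 : EuclideanSpace ℝ (Fin n)) 1,
        (∫⁻ s in Set.Ioi (0:ℝ), ENNReal.ofReal (s ^ (n - 1)) *
          (ball (0 : EuclideanSpace ℝ (Fin n)) r).indicator (fun y => ENNReal.ofReal (G y)) (s • (θ : EuclideanSpace ℝ (Fin n))))
        = ∫⁻ s in Set.Ioc 0 r, ENNReal.ofReal (s ^ (n - 1)) * ENNReal.ofReal (G (s • (θ : EuclideanSpace ℝ (Fin n)))) := by
      intro θ
      rw [← setLIntegral_congr (Ioo_ae_eq_Ioc (a := (0:ℝ)) (b := r) (μ := volume)),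
        ← lintegral_indicator measurableSet_Ioi, ← lintegral_indicator measurableSet_Ioo]
      congr 1
      ext s
      by_cases hs : 0 < s
      · by_cases hsr : s < r
        · rw [Set.indicator_of_mem (show s ∈ Set.Ioi 0 from hs), Set.indicator_of_mem (show s ∈ Set.Ioo 0 r from ⟨hs, hsr⟩),
            Set.indicator_of_mem (by rw [mem_ball_zero_iff, hnorm s θ hs]; exact hsr)]
        · rw [Set.indicator_of_mem (show s ∈ Set.Ioi 0 from hs), Set.indicator_of_notMem (fun h : s ∈ Set.Ioo 0 r => hsr h.2),
            Set.indicator_of_notMem (by rw [mem_ball_zero_iff, hnorm s θ hs]; exact hsr), mul_zero]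
      · rw [Set.indicator_of_notMem (fun h : s ∈ Set.Ioi 0 => hs h), Set.indicator_of_notMem (fun h : s ∈ Set.Ioo 0 r => hs h.1)]
    simp_rw [e1]
    rw [lintegral_lintegral_swap]
    · refine setLIntegral_congr_fun measurableSet_Ioc fun s hs => ?_
      have hs : 0 < s := hs.1
      rw [ENNReal.ofReal_mul (by positivity), ofReal_integral_eq_lintegral_ofReal (hI s) (ae_of_all _ fun θ => hG0 _),
        lintegral_const_mul]
      exact hmeas.comp (measurable_id.prodMk measurable_const)
    · refine Measurable.aemeasurable ?_
      exact (by fun_prop : Measurable (fun p : (sphere (0 : EuclideanSpace ℝ (Fin n)) 1) × ℝ => ENNReal.ofReal (p.2 ^ (n - 1)))).mul hmeas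
  · filter_upwards [ae_restrict_mem measurableSet_Ioc] with s hs
    have hs : 0 < s := hs.1
    exact mul_nonneg (by positivity) (integral_nonneg fun θ => hG0 _)
  · refine Measurable.aestronglyMeasurable ?_
    refine Measurable.mul (by fun_prop) ?_
    have : StronglyMeasurable (fun p : ℝ × (sphere (0 : EuclideanSpace ℝ (Fin n)) 1) =>
      G (p.1 • (p.2 : EuclideanSpace ℝ (Fin n)))) := (by fun_prop : Continuous _).stronglyMeasurable
    exact (this.integral_prod_right (ν := sphereMeasure n)).measurable

end

section
variable {n : ℕ}

theorem sphere_int_continuous {G : EuclideanSpace ℝ (Fin n) → ℝ} (hG : Continuous G) :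
    Continuous (fun s : ℝ => ∫ θ, G (s • (θ : EuclideanSpace ℝ (Fin n))) ∂(sphereMeasure n)) := by
  have := continuous_parametric_integral_of_continuous (μ := sphereMeasure n)
    (f := fun (s : ℝ) (θ : sphere (0 : EuclideanSpace ℝ (Fin n)) 1) => G (s • (θ : EuclideanSpace ℝ (Fin n))))
    (by unfold Function.uncurry; fun_prop) isCompact_univ
  simpa using this

theorem vol_hasDerivAt (hn : 2 ≤ n) {G : EuclideanSpace ℝ (Fin n) → ℝ} (hG : Continuous G)
    (hG0 : ∀ x, 0 ≤ G x) {r : ℝ} (hr : 0 < r) :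
    HasDerivAt (fun r => ∫ y in ball (0 : EuclideanSpace ℝ (Fin n)) r, G y)
      (r ^ (n - 1) * ∫ θ, G (r • (θ : EuclideanSpace ℝ (Fin n))) ∂(sphereMeasure n)) r := by
  have hcont : Continuous (fun s : ℝ => s ^ (n - 1) * ∫ θ, G (s • (θ : EuclideanSpace ℝ (Fin n))) ∂(sphereMeasure n)) :=
    (continuous_pow _).mul (sphere_int_continuous hG)
  have h1 := (hcont.integral_hasStrictDerivAt 0 r).hasDerivAt
  refine h1.congr_of_eventuallyEq ?_
  filter_upwards [lt_mem_nhds hr] with s hs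
  exact vol_polar hn hG hG0 hs.le

theorem sph_exp {u f : EuclideanSpace ℝ (Fin n) → ℝ} {b : ℝ} (hub : ∀ x, u x = b + Epot f x / cconst n) (k r : ℝ) :
    ∫ θ, Real.exp (k * u (r • (θ : EuclideanSpace ℝ (Fin n)))) ∂(sphereMeasure n) =
      Real.exp (k * (b + wt f r)) *
        ∫ θ, Real.exp (k * (Epot f (r • (θ : EuclideanSpace ℝ (Fin n))) / cconst n - wt f r)) ∂(sphereMeasure n) := by
  rw [← integral_const_mul]
  congr 1
  ext θ
  rw [← Real.exp_add, hub]
  congr 1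
  ring

theorem vol_pos {u : EuclideanSpace ℝ (Fin n) → ℝ} (hu : Continuous u) {r : ℝ} (hr : 0 < r) :
    0 < ∫ y in ball (0 : EuclideanSpace ℝ (Fin n)) r, Real.exp (n * u y) := by
  have hc : Continuous fun y => Real.exp (n * u y) := by fun_prop
  have hi : IntegrableOn (fun y => Real.exp (n * u y)) (ball (0 : EuclideanSpace ℝ (Fin n)) r) :=
    (hc.continuousOn.integrableOn_compact (isCompact_closedBall 0 r)).mono_set ball_subset_closedBall
  have : NeZero (volume.restrict (ball (0 : EuclideanSpace ℝ (Fin n)) r)) := by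
    refine ⟨fun h => ?_⟩
    rw [Measure.restrict_eq_zero] at h
    exact (measure_ball_pos volume 0 hr).ne' h
  exact integral_exp_pos hi

theorem ratio_tendsto (hn2 : 2 ≤ n) {u f : EuclideanSpace ℝ (Fin n) → ℝ} (hu : Continuous u)
    (hc : Continuous f) (hi : Integrable f) (hE : Continuous (Epot f))
    {R0 : ℝ} (hf0 : ∀ y, R0 ≤ ‖y‖ → 0 ≤ f y) {b : ℝ} (hub : ∀ x, u x = b + Epot f x / cconst n)
    (hα : (∫ y, f y) / cconst n ≤ 1) :
    Tendsto (fun r => omegaN n * (r ^ n * Real.exp (n * (b + wt f r))) /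
        (n * ∫ y in ball (0 : EuclideanSpace ℝ (Fin n)) r, Real.exp (n * u y))) atTop
      (𝓝 (1 - (∫ y, f y) / cconst n)) := by
  have hω := omegaN_pos hn2
  have hcp := cconst_pos n
  have hn0 : (0:ℝ) < n := by exact_mod_cast (by omega : 0 < n)
  set I : ℝ → ℝ := fun r => ∫ θ, Real.exp (n * (Epot f (r • (θ : EuclideanSpace ℝ (Fin n))) / cconst n - wt f r)) ∂(sphereMeasure n) with hI
  have hI1 : Tendsto I atTop (𝓝 (omegaN n)) := pot_avg hn2 hc hi hE hf0 hn0
  have hA : Tendsto (fun r => I r / omegaN n) atTop (𝓝 1) := by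
    have := hI1.div_const (omegaN n)
    rwa [div_self hω.ne'] at this
  have hβ : Tendsto (fun r : ℝ => 1 - (∫ y in ball 0 r, f y) / cconst n) atTop (𝓝 (1 - (∫ y, f y) / cconst n)) :=
    ((ball_tendsto hi).div_const _).const_sub 1
  have hγ : Tendsto (fun r : ℝ => (1 - (∫ y in ball 0 r, f y) / cconst n) / (I r / omegaN n)) atTop
      (𝓝 (1 - (∫ y, f y) / cconst n)) := by
    have := hβ.div hA one_ne_zero
    rwa [div_one] at this
  obtain ⟨T0, hT0⟩ := eventually_atTop.mp (hI1.eventually_const_lt hω)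
  set V : ℝ → ℝ := fun r => ∫ y in ball (0 : EuclideanSpace ℝ (Fin n)) r, Real.exp (n * u y) with hV
  refine logistic (T := max T0 2) (N := n) (lt_max_of_lt_right two_pos) hn0 (by linarith) (fun r hr => ?_) (fun r hr => ?_) hA hγ
  · have hr0 : 0 < r := by linarith [(le_max_right T0 2).trans hr]
    have := vol_pos hu hr0
    positivity
  · have hr2 : 2 ≤ r := (le_max_right T0 2).trans hr
    have hr0 : 0 < r := by linarith
    have hIp := hT0 r ((le_max_left T0 2).trans hr)
    have hVp : 0 < V r := vol_pos hu hr0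
    have dV : HasDerivAt V (r ^ (n - 1) * (Real.exp (n * (b + wt f r)) * I r)) r := by
      have := vol_hasDerivAt hn2 (G := fun y => Real.exp (n * u y)) (by fun_prop) (fun x => (Real.exp_pos _).le) hr0
      rwa [sph_exp hub] at this
    have dw := wt_hasDerivAt hn2 hc hi (show 1 < r by linarith)
    have dg := ((hasDerivAt_pow n r).mul (((dw.const_add b).const_mul (n:ℝ)).exp)).const_mul (omegaN n)
    have hpow : r ^ n = r ^ (n - 1) * r := by rw [← pow_succ]; congr 1; omega
    refine (dg.div (dV.const_mul (n:ℝ)) (by positivity)).congr_deriv ?_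
    simp only [Pi.mul_apply]
    change _ = n * (I r / omegaN n) * (omegaN n * (r ^ n * Real.exp (n * (b + wt f r))) / (n * V r)) * ((1 - (∫ y in ball 0 r, f y) / cconst n) / (I r / omegaN n) - omegaN n * (r ^ n * Real.exp (n * (b + wt f r))) / (n * V r)) / r
    rw [hpow]
    generalize Real.exp (n * (b + wt f r)) = e
    generalize (∫ y in ball 0 r, f y) = F
    generalize V r = v at *
    generalize I r = i at *
    generalize r ^ (n - 1) = p at *
    field_simp
    ring

theorem iso_tendsto (hn2 : 2 ≤ n) {u f : EuclideanSpace ℝ (Fin n) → ℝ} (hu : Continuous u)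
    (hc : Continuous f) (hi : Integrable f) (hE : Continuous (Epot f))
    {R0 : ℝ} (hf0 : ∀ y, R0 ≤ ‖y‖ → 0 ≤ f y) {b : ℝ} (hub : ∀ x, u x = b + Epot f x / cconst n)
    (hα : (∫ y, f y) / cconst n ≤ 1) :
    Tendsto (fun r : ℝ =>
        (sphereIntegral n (fun y => Real.exp ((n - 1) * u y)) r) ^ ((n : ℝ) / (n - 1))
          / (n * omegaN n ^ ((1 : ℝ) / (n - 1))
            * ∫ y in Metric.ball (0 : EuclideanSpace ℝ (Fin n)) r, Real.exp (n * u y))) atTop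
      (𝓝 (1 - (∫ y, f y) / cconst n)) := by
  have hω := omegaN_pos hn2
  have hn1 : (0:ℝ) < n - 1 := by
    have : (2:ℝ) ≤ n := by exact_mod_cast hn2
    linarith
  have hn0 : (0:ℝ) < n := by linarith
  set J : ℝ → ℝ := fun r => ∫ θ, Real.exp (((n:ℝ) - 1) * (Epot f (r • (θ : EuclideanSpace ℝ (Fin n))) / cconst n - wt f r)) ∂(sphereMeasure n) with hJ
  have hJ1 : Tendsto J atTop (𝓝 (omegaN n)) := pot_avg hn2 hc hi hE hf0 hn1
  have hA : Tendsto (fun r => (J r / omegaN n) ^ ((n : ℝ) / (n - 1))) atTop (𝓝 1) := by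
    have := hJ1.div_const (omegaN n)
    rw [div_self hω.ne'] at this
    have h2 := this.rpow_const (p := (n : ℝ) / (n - 1)) (Or.inl one_ne_zero)
    rwa [Real.one_rpow] at h2
  have hfin := (ratio_tendsto hn2 hu hc hi hE hf0 hub hα).mul hA
  rw [mul_one] at hfin
  refine hfin.congr' ?_
  filter_upwards [eventually_gt_atTop 0] with r hr
  have hJ0 : 0 ≤ J r := integral_nonneg fun θ => (Real.exp_pos _).le
  have hVp := vol_pos hu hr
  unfold sphereIntegral
  rw [sph_exp hub]
  change _ = (r ^ (n - 1) * (Real.exp (((n:ℝ) - 1) * (b + wt f r)) * J r)) ^ ((n : ℝ) / (n - 1)) / _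
  have e1 : (r ^ (n - 1)) ^ ((n : ℝ) / (n - 1)) = r ^ n := by
    rw [← Real.rpow_natCast r (n - 1), ← Real.rpow_mul hr.le, ← Real.rpow_natCast r n]
    congr 1
    rw [Nat.cast_sub (by omega)]
    push_cast
    field_simp
  have e2 : (Real.exp (((n:ℝ) - 1) * (b + wt f r))) ^ ((n : ℝ) / (n - 1)) = Real.exp (n * (b + wt f r)) := by
    rw [← Real.exp_mul]
    congr 1
    field_simp
  have e3 : omegaN n ^ ((n : ℝ) / (n - 1)) = omegaN n * omegaN n ^ ((1 : ℝ) / (n - 1)) := by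
    nth_rewrite 2 [← Real.rpow_one (omegaN n)]
    rw [← Real.rpow_add hω]
    congr 1
    field_simp
    ring
  rw [Real.mul_rpow (by positivity) (by positivity), Real.mul_rpow (by positivity) hJ0, e1, e2,
    Real.div_rpow hJ0 hω.le, e3]
  have : 0 < omegaN n ^ ((1 : ℝ) / (n - 1)) := Real.rpow_pos_of_pos hω _
  field_simp

end

/-- Chern-Gauss-Bonnet formula: under completeness and the decay assumption on `Q`,
`1 - (1/c_n) ∫ Q e^{nu}` equals the limit of the isoperimetric ratio, and this limit is
nonnegative. -/
theorem stmt13 (m n : ℕ) (hm : 2 ≤ m) (hn : n = 2 * m)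
    (u Q : EuclideanSpace ℝ (Fin n) → ℝ) (hu : ContDiff ℝ (⊤ : ℕ∞) u)
    (hPDE : ∀ x, negLapIter m u x = 2 * Q x * Real.exp (n * u x))
    (hf : MeasureTheory.Integrable (fun y => Q y * Real.exp (n * u y)))
    (hQ : ∀ δ > (0 : ℝ), ∃ Rδ : ℝ, ∀ x : EuclideanSpace ℝ (Fin n), Rδ ≤ ‖x‖ →
      Real.exp (-δ * ‖x‖ ^ 2) ≤ Q x)
    (hcomplete : ∀ θ : EuclideanSpace ℝ (Fin n), ‖θ‖ = 1 →
      ∫⁻ r in Set.Ioi (0 : ℝ), ENNReal.ofReal (Real.exp (u (r • θ))) = ⊤) :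
    Filter.Tendsto
      (fun r : ℝ =>
        (sphereIntegral n (fun y => Real.exp ((n - 1) * u y)) r) ^ ((n : ℝ) / (n - 1))
          / (n * omegaN n ^ ((1 : ℝ) / (n - 1))
            * ∫ y in Metric.ball (0 : EuclideanSpace ℝ (Fin n)) r, Real.exp (n * u y)))
      Filter.atTop
      (nhds (1 - (1 / cconst n) * ∫ y, Q y * Real.exp (n * u y))) ∧
    0 ≤ 1 - (1 / cconst n) * ∫ y, Q y * Real.exp (n * u y) := by
  have hn2 : 2 ≤ n := by omega
  have hm1 : 1 ≤ m := by omega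
  have hcp := cconst_pos n
  have huc := hu.continuous
  set f : EuclideanSpace ℝ (Fin n) → ℝ := fun y => Q y * Real.exp (n * u y) with hfdef
  have hPDE' : ∀ x, negLapIter m u x = 2 * f x := by
    intro x; rw [hPDE, hfdef]; ring
  have hc : Continuous f := by
    have h1 : f = fun x => negLapIter m u x / 2 := by
      ext x; rw [hPDE']; ring
    rw [h1]
    exact (negLapIter_smooth hu m).continuous.div_const 2
  have hH := hfun_continuous hm1 hn hu hPDE' hc hf
  have hE : Continuous (Epot f) := by
    have h1 : Epot f = fun x => cconst n * (u x - hfun u f x) := by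
      ext x; unfold hfun; field_simp; ring
    rw [h1]
    exact continuous_const.mul (huc.sub hH)
  obtain ⟨R0, hR0⟩ := hQ 1 one_pos
  have hf0 : ∀ y, R0 ≤ ‖y‖ → 0 ≤ f y := fun y hy =>
    mul_nonneg ((Real.exp_pos _).le.trans (hR0 y hy)) (Real.exp_pos _).le
  have hexp : ∀ δ > (0:ℝ), Integrable fun x => Real.exp (n * u x - δ * ‖x‖ ^ 2) := by
    intro δ hδ
    obtain ⟨R, hR⟩ := hQ δ hδ
    have hcont : Continuous fun x => Real.exp (n * u x - δ * ‖x‖ ^ 2) := by fun_prop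
    have h1 : IntegrableOn (fun x => Real.exp (n * u x - δ * ‖x‖ ^ 2)) (closedBall (0 : EuclideanSpace ℝ (Fin n)) R) :=
      hcont.continuousOn.integrableOn_compact (isCompact_closedBall 0 R)
    have h2 : IntegrableOn (fun x => Real.exp (n * u x - δ * ‖x‖ ^ 2)) (closedBall (0 : EuclideanSpace ℝ (Fin n)) R)ᶜ := by
      refine Integrable.mono hf.norm.integrableOn hcont.aestronglyMeasurable ?_
      filter_upwards [ae_restrict_mem measurableSet_closedBall.compl] with x hx
      have hx : R ≤ ‖x‖ := by
        simp only [Set.mem_compl_iff, mem_closedBall_zero_iff, not_le] at hx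
        exact hx.le
      rw [norm_norm, Real.norm_of_nonneg (Real.exp_pos _).le]
      refine le_trans ?_ (le_abs_self _)
      have : n * u x - δ * ‖x‖ ^ 2 = -δ * ‖x‖ ^ 2 + n * u x := by ring
      rw [this, Real.exp_add]
      exact mul_le_mul_of_nonneg_right (hR x hx) (Real.exp_pos _).le
    have := h1.union h2
    rwa [Set.union_compl_self, integrableOn_univ] at this
  have hconst := h_const hm1 hn hu hPDE' hc hf hE hf0 hexp hcomplete
  have hub : ∀ x, u x = hfun u f 0 + Epot f x / cconst n := by
    intro x
    rw [← hconst x]; unfold hfun; ring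
  have hα := alpha_le_one hn2 huc hc hf hE hf0 hub hcomplete
  have heq : 1 - (1 / cconst n) * ∫ y, f y = 1 - (∫ y, f y) / cconst n := by ring
  rw [heq]
  exact ⟨iso_tendsto hn2 huc hc hf hE hf0 hub hα, by linarith⟩
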